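/- Let F be a free group of finite rank and A a nonabelian subgroup of F. Then F is constructible from acl(A) over cyclic subgroups, i.e. F can be obtained from acl(A) by a finite sequence of amalgamated free products and HNN-extensions along cyclic subgroups. In particular, acl(A) is finitely generated. -/

import Mathlib

open FirstOrder Filter

/-! Common definitions: the first-order language of groups, algebraic/definable closures,
free products, amalgams, HNN extensions, etc. -/

/-- Function symbols of the language of groups: `1`, `⁻¹`, `·`. -/
inductive GrpFunc : ℕ → Type
  | one : GrpFunc 0
  | inv : GrpFunc 1
  | mul : GrpFunc 2

/-- The first-order language of groups `L = {·, ⁻¹, 1}` (no relation symbols). -/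
def grpLang : FirstOrder.Language := ⟨GrpFunc, fun _ => Empty⟩

/-- Every group is a `grpLang`-structure in the natural way. -/
instance grpStructure (G : Type*) [Group G] : grpLang.Structure G where
  funMap {_} f := match f with
    | .one => fun _ => (1 : G)
    | .inv => fun x => (x 0)⁻¹
    | .mul => fun x => x 0 * x 1
  RelMap {_} r := Empty.elim r

/-- A formula is existential if it is obtained from a quantifier-free formula by
prefixing existential quantifiers. -/
def IsExistential {L : FirstOrder.Language} {α : Type*} (φ : L.Formula α) : Prop :=
  ∃ (n : ℕ) (ψ : L.BoundedFormula α n), ψ.IsQF ∧ φ = ψ.exs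

section ModelTheory

variable (L : FirstOrder.Language) {M : Type*} [L.Structure M]

/-- The algebraic closure of a set of parameters `A` in an `L`-structure `M`:
elements satisfying, together with only finitely many other elements, some formula
with parameters from `A`. -/
def Lacl (A : Set M) : Set M :=
  {b | ∃ φ : L.Formula (↥A ⊕ Fin 1),
    {c : M | φ.Realize (Sum.elim Subtype.val fun _ => c)}.Finite ∧
    φ.Realize (Sum.elim Subtype.val fun _ => b)}

/-- The definable closure of a set of parameters `A` in an `L`-structure `M`. -/
def Ldcl (A : Set M) : Set M :=
  {b | ∃ φ : L.Formula (↥A ⊕ Fin 1),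
    {c : M | φ.Realize (Sum.elim Subtype.val fun _ => c)} = {b}}

/-- The existential algebraic closure of `A` in `M`. -/
def LaclE (A : Set M) : Set M :=
  {b | ∃ φ : L.Formula (↥A ⊕ Fin 1), IsExistential φ ∧
    {c : M | φ.Realize (Sum.elim Subtype.val fun _ => c)}.Finite ∧
    φ.Realize (Sum.elim Subtype.val fun _ => b)}

/-- The existential definable closure of `A` in `M`. -/
def LdclE (A : Set M) : Set M :=
  {b | ∃ φ : L.Formula (↥A ⊕ Fin 1), IsExistential φ ∧
    {c : M | φ.Realize (Sum.elim Subtype.val fun _ => c)} = {b}}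

end ModelTheory

section GroupDefs

variable {G : Type*} [Group G]

/-- Algebraic closure in a group, w.r.t. the language of groups. -/
def acl (A : Set G) : Set G := Lacl grpLang A

/-- Definable closure in a group, w.r.t. the language of groups. -/
def dcl (A : Set G) : Set G := Ldcl grpLang A

/-- Existential algebraic closure in a group. -/
def aclE (A : Set G) : Set G := LaclE grpLang A

/-- Existential definable closure in a group. -/
def dclE (A : Set G) : Set G := LdclE grpLang A

/-- Restricted algebraic closure: elements with finite orbit under automorphisms
of `G` fixing `A` pointwise. -/
def racl (A : Set G) : Set G :=
  {g | {x : G | ∃ f : G ≃* G, (∀ a ∈ A, f a = a) ∧ f g = x}.Finite}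

/-- Restricted definable closure: elements fixed by every automorphism of `G`
fixing `A` pointwise. -/
def rdcl (A : Set G) : Set G :=
  {g | ∀ f : G ≃* G, (∀ a ∈ A, f a = a) → f g = g}

/-- A set of group elements is nonabelian (contains two non-commuting elements). -/
def Nonabelian (A : Set G) : Prop := ∃ x ∈ A, ∃ y ∈ A, x * y ≠ y * x

/-- `F` is a free group of finite rank. -/
def IsFreeOfFiniteRank (F : Type*) [Group F] : Prop :=
  ∃ n : ℕ, Nonempty (F ≃* FreeGroup (Fin n))

/-- `G` is the internal free product of its subgroups `H` and `K`: the canonical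
homomorphism from the abstract free product `H ∗ K` to `G` is an isomorphism. -/
def InternalFreeProduct (H K : Subgroup G) : Prop :=
  Function.Bijective (Monoid.Coprod.lift H.subtype K.subtype)

/-- `G` is freely indecomposable relative to its subgroup `A`. -/
def FreelyIndecomposableRel (A : Subgroup G) : Prop :=
  ¬ ∃ G₁ G₂ : Subgroup G, G₁ ≠ ⊥ ∧ G₂ ≠ ⊥ ∧ A ≤ G₁ ∧ InternalFreeProduct G₁ G₂

/-- `B` is a free factor of the subgroup `K`: there is `L` such that the canonical
homomorphism from the abstract free product `B ∗ L` to the ambient group is injective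
with image exactly `K`. -/
def IsFreeFactorOf (B K : Subgroup G) : Prop :=
  ∃ L : Subgroup G,
    Function.Injective (Monoid.Coprod.lift B.subtype L.subtype) ∧
    (Monoid.Coprod.lift B.subtype L.subtype).range = K

/-- `K'` is the amalgamated free product `K ∗_C B` inside the ambient group `G`:
the canonical homomorphism from the abstract amalgamated product (pushout) of `K` and
`B` over `C` to `G` is injective with image exactly `K'`. -/
def IsAmalgamOf (K B C : Subgroup G) (hCK : C ≤ K) (hCB : C ≤ B) (K' : Subgroup G) : Prop :=
  ∃ ℓ : Monoid.PushoutI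
      (fun i : Bool =>
        (Subgroup.inclusion (show C ≤ cond i K B by cases i <;> assumption) :
          ↥C →* ↥(cond i K B))) →* G,
    (∀ i : Bool, ℓ.comp (Monoid.PushoutI.of i) = (cond i K B).subtype) ∧
    Function.Injective ℓ ∧ ℓ.range = K'

/-- `K'` is the HNN extension of `K` along `φ : C ≃* D` inside the ambient group `G`:
the canonical homomorphism from the abstract HNN extension of `K` along `φ` to `G` is
injective with image exactly `K'` (and is the inclusion on `K`). -/
def IsHNNOf (K : Subgroup G) {C D : Subgroup ↥K} (φ : ↥C ≃* ↥D) (K' : Subgroup G) : Prop :=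
  ∃ ℓ : HNNExtension ↥K C D φ →* G,
    ℓ.comp HNNExtension.of = K.subtype ∧ Function.Injective ℓ ∧ ℓ.range = K'

/-- One constructibility step: `K'` is an amalgamated free product of `K` with some
subgroup over a cyclic subgroup, or an HNN extension of `K` along an isomorphism of two
cyclic subgroups of `K`. -/
def ConstructStep (K K' : Subgroup G) : Prop :=
  (∃ (B C : Subgroup G) (hCK : C ≤ K) (hCB : C ≤ B),
      (∃ c : G, C = Subgroup.zpowers c) ∧ B ≤ K' ∧ K ≤ K' ∧ IsAmalgamOf K B C hCK hCB K')
  ∨ (∃ (C D : Subgroup ↥K) (φ : ↥C ≃* ↥D),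
      (∃ c : ↥K, C = Subgroup.zpowers c) ∧ (∃ d : ↥K, D = Subgroup.zpowers d) ∧ IsHNNOf K φ K')

/-- `B` is constructible from `A` by a finite sequence of amalgamated free products and
HNN-extensions along cyclic subgroups. -/
def ConstructibleFrom (A B : Subgroup G) : Prop := Relation.ReflTransGen ConstructStep A B

/-- The rank of a subgroup: the least cardinality of a generating set. For (subgroups of)
free groups this is the cardinality of a basis. -/
noncomputable def srank (H : Subgroup G) : Cardinal :=
  sInf {c : Cardinal | ∃ S : Set G, Subgroup.closure S = H ∧ c = Cardinal.mk ↥S}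

/-- `M` is a maximal abelian subgroup. -/
def IsMaxAbelian (M : Subgroup G) : Prop :=
  (∀ x ∈ M, ∀ y ∈ M, x * y = y * x) ∧
  ∀ N : Subgroup G, (∀ x ∈ N, ∀ y ∈ N, x * y = y * x) → M ≤ N → M = N

/-- `M` is a maximal abelian subgroup of the subgroup `H`. -/
def IsMaxAbelianIn (M H : Subgroup G) : Prop :=
  M ≤ H ∧ (∀ x ∈ M, ∀ y ∈ M, x * y = y * x) ∧
  ∀ N : Subgroup G, N ≤ H → (∀ x ∈ N, ∀ y ∈ N, x * y = y * x) → M ≤ N → M = N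

/-- `M` is a malnormal subgroup: `gMg⁻¹ ∩ M = 1` for every `g ∉ M`. -/
def Malnormal (M : Subgroup G) : Prop :=
  ∀ g : G, g ∉ M → ∀ x ∈ M, g * x * g⁻¹ ∈ M → x = 1

/-- A group is CSA if every maximal abelian subgroup is malnormal. -/
def IsCSA (G : Type*) [Group G] : Prop := ∀ M : Subgroup G, IsMaxAbelian M → Malnormal M

/-- Every abelian subgroup of `G` is cyclic. -/
def AbelianSubgroupsCyclic (G : Type*) [Group G] : Prop :=
  ∀ H : Subgroup G, (∀ x ∈ H, ∀ y ∈ H, x * y = y * x) → ∃ g : G, H = Subgroup.zpowers g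

/-- `G` is equationally noetherian: every system of equations over `G` in finitely many
variables is equivalent to a finite subsystem. -/
def EqNoetherian (G : Type*) [Group G] : Prop :=
  ∀ n : ℕ, 0 < n → ∀ S : Set (Monoid.Coprod G (FreeGroup (Fin n))),
    ∃ S₀ : Set (Monoid.Coprod G (FreeGroup (Fin n))), S₀ ⊆ S ∧ S₀.Finite ∧
      ∀ f : Monoid.Coprod G (FreeGroup (Fin n)) →* G,
        f.comp Monoid.Coprod.inl = MonoidHom.id G →
        ((∀ s ∈ S₀, f s = 1) ↔ ∀ s ∈ S, f s = 1)

/-- A group homomorphism is elementary w.r.t. the language of groups: it preserves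
and reflects all first-order formulas. -/
def ElementaryEmb {H K : Type*} [Group H] [Group K] (e : H →* K) : Prop :=
  ∀ (n : ℕ) (φ : grpLang.Formula (Fin n)) (v : Fin n → H),
    (φ.Realize fun i => e (v i)) ↔ φ.Realize v

/-- The inclusion of the subgroup `H` is an elementary embedding; i.e. the ambient group
is an elementary extension of `H`. -/
def ElementarySub (H : Subgroup G) : Prop := ElementaryEmb H.subtype

/-- A sequence of homomorphisms is stable. -/
def StableSeq {K H : Type*} [Group K] [Group H] (h : ℕ → (K →* H)) : Prop :=
  ∀ k : K, (∀ᶠ n in Filter.atTop, h n k = 1) ∨ (∀ᶠ n in Filter.atTop, h n k ≠ 1)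

/-- A sequence of homomorphisms has trivial stable kernel. -/
def TrivialStableKernel {K H : Type*} [Group K] [Group H] (h : ℕ → (K →* H)) : Prop :=
  ∀ k : K, (∀ᶠ n in Filter.atTop, h n k = 1) → k = 1

/-- A stable sequence of homomorphisms `g n : D → H` with trivial stable kernel strongly
converges to `D`, where `D` is a subgroup of an extension of the base group `H`, the base
group being embedded via `e`. -/
def StronglyConverges {H Gs : Type*} [Group H] [Group Gs] (e : H →* Gs)
    (D : Subgroup Gs) (g : ℕ → (↥D →* H)) : Prop :=
  StableSeq g ∧ TrivialStableKernel g ∧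
  (∀ (d : ↥D) (b : H), (d : Gs) = e b → ∀ᶠ n in Filter.atTop, g n d = b) ∧
  (∀ (d : ↥D) (b : H), (∃ᶠ n in Filter.atTop, g n d = b) → (d : Gs) = e b)

/-- The ball of radius `r` about the identity in the word metric w.r.t. `S`. -/
def wordBall (S : Set G) (r : ℕ) : Set G :=
  {g | ∃ l : List G, l.length ≤ r ∧ (∀ x ∈ l, x ∈ S ∨ x⁻¹ ∈ S) ∧ l.prod = g}

end GroupDefs

namespace AclConstruct

/-! ### Ping-pong criteria for amalgams and HNN extensions -/

section PingPong

variable {F : Type*} [Group F]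

/-- `ConstructStep` remembering a generator of the cyclic subgroup along which one splits. -/
def StepOver (c : F) (P G : Subgroup F) : Prop :=
  (∃ (B : Subgroup F) (hP : Subgroup.zpowers c ≤ P) (hB : Subgroup.zpowers c ≤ B),
      B ≤ G ∧ P ≤ G ∧ IsAmalgamOf P B (Subgroup.zpowers c) hP hB G)
  ∨ (∃ (C D : Subgroup ↥P) (φ : ↥C ≃* ↥D) (c' d : ↥P),
      C = Subgroup.zpowers c' ∧ D = Subgroup.zpowers d ∧ (d : F) = c ∧ (c = 1 → (c' : F) = 1) ∧
        IsHNNOf P φ G)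

theorem StepOver.constructStep {c : F} {P G : Subgroup F} (h : StepOver c P G) :
    ConstructStep P G := by
  rcases h with ⟨B, hP, hB, h1, h2, h3⟩ | ⟨C, D, φ, c', d, hC, hD, -, -, h⟩
  · exact Or.inl ⟨B, _, hP, hB, ⟨c, rfl⟩, h1, h2, h3⟩
  · exact Or.inr ⟨C, D, φ, ⟨c', hC⟩, ⟨d, hD⟩, h⟩

theorem pushout_injective_of_pingPong {H : Type*} [Group H] {Γ : Bool → Type*} [∀ i, Group (Γ i)]
    (φ : ∀ i, H →* Γ i) (hφ : ∀ i, Function.Injective (φ i)) (ℓ : Monoid.PushoutI φ →* F)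
    (hℓ : ∀ i, Function.Injective (ℓ.comp (Monoid.PushoutI.of i)))
    (U : F → Prop) (hC : ∀ (c : H) (g : Monoid.PushoutI φ),
      U (ℓ (Monoid.PushoutI.base φ c * g)) ↔ U (ℓ g))
    (hP : ∀ p : Γ true, p ∉ (φ true).range → ∀ g : Monoid.PushoutI φ, U (ℓ g) →
      ¬ U (ℓ (Monoid.PushoutI.of true p * g)))
    (hQ : ∀ q : Γ false, q ∉ (φ false).range → ∀ g : Monoid.PushoutI φ, ¬ U (ℓ g) →
      U (ℓ (Monoid.PushoutI.of false q * g)))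
    (hPU : ∀ p : Γ true, ¬ U (ℓ (Monoid.PushoutI.of true p))) :
    Function.Injective ℓ := by
  classical
  have hbase : ∀ i c, Monoid.PushoutI.base φ c = Monoid.PushoutI.of i (φ i c) :=
    fun i c => (Monoid.PushoutI.of_apply_eq_base φ i c).symm
  obtain ⟨d⟩ := Monoid.PushoutI.NormalWord.transversal_nonempty φ hφ
  have key : ∀ w : Monoid.PushoutI.NormalWord d,
      (w.fstIdx = none ∧ ∃ c, w.prod = Monoid.PushoutI.base φ c) ∨
      (w.fstIdx = some false ∧ U (ℓ w.prod)) ∨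
      (w.fstIdx = some true ∧ ¬ U (ℓ w.prod) ∧ ∀ c, ℓ w.prod ≠ ℓ (Monoid.PushoutI.base φ c)) := by
    intro w
    induction w using Monoid.PushoutI.NormalWord.consRecOn with
    | empty => exact Or.inl ⟨rfl, 1, by simp⟩
    | cons i g w hmw hgn hgr hw1 ih =>
      have hi : (Monoid.PushoutI.NormalWord.cons g w hmw hgr).fstIdx = some i := by
        simp [Monoid.PushoutI.NormalWord.cons, Monoid.CoprodI.Word.cons, Monoid.CoprodI.Word.fstIdx]
      rw [Monoid.PushoutI.NormalWord.prod_cons, hi]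
      cases i with
      | false =>
        refine Or.inr (Or.inl ⟨rfl, hQ _ hgr _ ?_⟩)
        rcases ih with ⟨_, c, hc⟩ | ⟨h, _⟩ | ⟨h, h2, _⟩
        · rw [hc, hbase true]; exact hPU _
        · exact absurd h hmw
        · exact h2
      | true =>
        refine Or.inr (Or.inr ⟨rfl, ?_⟩)
        rcases ih with ⟨_, c, hc⟩ | ⟨h, hU⟩ | ⟨h, h2, _⟩
        · rw [hc]
          constructor
          · rw [hbase true, ← map_mul]; exact hPU _
          · intro c' h
            rw [hbase true, hbase true, ← map_mul] at h
            have := hℓ true h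
            exact hgr ⟨c' * c⁻¹, by rw [map_mul, map_inv, ← this, mul_inv_cancel_right]⟩
        · refine ⟨hP _ hgr _ hU, fun c h => ?_⟩
          have : ℓ w.prod = ℓ (Monoid.PushoutI.of true (g⁻¹ * φ true c)) := by
            rw [map_mul, ← hbase, map_mul, ← h, map_inv, map_mul, map_inv, inv_mul_cancel_left]
          rw [this] at hU
          exact hPU _ hU
        · exact absurd h hmw
    | base h w hw1 ih =>
      have hi : (Monoid.PushoutI.base φ h • w).fstIdx = w.fstIdx := by
        rw [Monoid.PushoutI.NormalWord.base_smul_def]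
      rw [Monoid.PushoutI.NormalWord.prod_smul, hi]
      rcases ih with ⟨h1, c, hc⟩ | ⟨h1, hU⟩ | ⟨h1, h2, h3⟩
      · exact Or.inl ⟨h1, h * c, by rw [hc, map_mul]⟩
      · exact Or.inr (Or.inl ⟨h1, (hC _ _).2 hU⟩)
      · refine Or.inr (Or.inr ⟨h1, fun h' => h2 ((hC _ _).1 h'), fun c h' => h3 (h⁻¹ * c) ?_⟩)
        rw [map_mul, map_mul, ← h', map_mul, map_inv, map_inv, inv_mul_cancel_left]
  rw [injective_iff_map_eq_one]
  intro x hx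
  have hw : (Monoid.PushoutI.NormalWord.equiv (d := d) x).prod = x :=
    Monoid.PushoutI.NormalWord.equiv.symm_apply_apply x
  have h := key (Monoid.PushoutI.NormalWord.equiv (d := d) x)
  rw [hw] at h
  rcases h with ⟨-, c, hc⟩ | ⟨-, h⟩ | ⟨-, -, h⟩
  · rw [hc, hbase true] at hx
    have := hℓ true (a₁ := φ true c) (a₂ := 1) (by simpa using hx)
    rw [hc, hbase true, this, map_one]
  · rw [hx] at h
    exact absurd h (by simpa using hPU 1)
  · exact absurd hx (by simpa using h 1)

theorem isAmalgamOf_of_pingPong {P Q C G : Subgroup F} (hCP : C ≤ P) (hCQ : C ≤ Q)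
    (U : F → Prop) (hC : ∀ c ∈ C, ∀ g ∈ G, U (c * g) ↔ U g)
    (hP : ∀ p ∈ P, p ∉ C → ∀ g ∈ G, U g → ¬ U (p * g))
    (hQ : ∀ q ∈ Q, q ∉ C → ∀ g ∈ G, ¬ U g → U (q * g))
    (hPU : ∀ p ∈ P, ¬ U p) (hG : P ⊔ Q = G) : IsAmalgamOf P Q C hCP hCQ G := by
  have hPG : P ≤ G := hG ▸ le_sup_left
  have hQG : Q ≤ G := hG ▸ le_sup_right
  let φ : ∀ i : Bool, ↥C →* ↥(cond i P Q) := fun i : Bool =>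
        (Subgroup.inclusion (show C ≤ cond i P Q by cases i <;> assumption) :
          ↥C →* ↥(cond i P Q))
  let f : ∀ i : Bool, ↥(cond i P Q) →* F := fun i => (cond i P Q).subtype
  have hf : ∀ i, (f i).comp (φ i) = C.subtype := by intro i; ext x; rfl
  have hof : ∀ (i : Bool) (x : ↥(cond i P Q)),
      Monoid.PushoutI.lift f C.subtype hf (Monoid.PushoutI.of i x) = x := 
    fun i x => Monoid.PushoutI.lift_of f C.subtype hf x
  have hbase : ∀ x : C, Monoid.PushoutI.lift f C.subtype hf (Monoid.PushoutI.base φ x) = x :=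
    fun x => Monoid.PushoutI.lift_base f C.subtype hf x
  have hr : (Monoid.PushoutI.lift f C.subtype hf).range = G := by
    apply le_antisymm
    · rintro _ ⟨x, rfl⟩
      induction x using Monoid.PushoutI.induction_on with
      | of i g => rw [hof]; cases i; exacts [hQG g.2, hPG g.2]
      | base h => rw [hbase]; exact hPG (hCP h.2)
      | mul x y hx hy => rw [map_mul]; exact G.mul_mem hx hy
    · rw [← hG, sup_le_iff]
      exact ⟨fun x hx => ⟨Monoid.PushoutI.of true (⟨x, hx⟩ : ↥P), hof true _⟩,
        fun x hx => ⟨Monoid.PushoutI.of false (⟨x, hx⟩ : ↥Q), hof false _⟩⟩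
  have hmem : ∀ x, Monoid.PushoutI.lift f C.subtype hf x ∈ G := fun x => hr ▸ ⟨x, rfl⟩
  refine ⟨Monoid.PushoutI.lift f C.subtype hf, ?_, ?_, hr⟩
  · intro i; ext x; exact hof i x
  · refine pushout_injective_of_pingPong φ (fun i => Subgroup.inclusion_injective _) _ ?_ U
      ?_ ?_ ?_ ?_
    · intro i x y h
      exact Subtype.ext (by simpa only [MonoidHom.comp_apply, hof] using h)
    · intro c g; rw [map_mul, hbase]; exact hC _ c.2 _ (hmem g)
    · intro p hp g hg; rw [map_mul, hof]
      exact hP _ p.2 (fun h => hp ⟨⟨p, h⟩, rfl⟩) _ (hmem g) hg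
    · intro p hp g hg; rw [map_mul, hof]
      exact hQ _ p.2 (fun h => hp ⟨⟨p, h⟩, rfl⟩) _ (hmem g) hg
    · intro p; rw [hof]; exact hPU _ p.2

theorem isHNNOf_of_pingPong {P G : Subgroup F} {A B : Subgroup ↥P} (φ : ↥A ≃* ↥B) (t : F)
    (ht : ∀ a : A, t * ((a : P) : F) = ((φ a : P) : F) * t)
    (U : ℤˣ → F → Prop)
    (htU : ∀ u : ℤˣ, ∀ g ∈ G, ¬ U (-u) g → U u (t ^ (u : ℤ) * g))
    (hsame : ∀ u : ℤˣ, ∀ p : P, p ∉ HNNExtension.toSubgroup A B (-u) → ∀ g ∈ G, U u g →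
      ¬ U u (p * g))
    (hdiff : ∀ u : ℤˣ, ∀ p : P, ∀ g ∈ G, U u g → ¬ U (-u) (p * g))
    (hPU : ∀ u : ℤˣ, ∀ p ∈ P, ¬ U u p) (hG : P ⊔ Subgroup.zpowers t = G) : IsHNNOf P φ G := by
  classical
  have hPG : P ≤ G := hG ▸ le_sup_left
  have htG : t ∈ G := (hG ▸ le_sup_right : Subgroup.zpowers t ≤ G) (Subgroup.mem_zpowers t)
  let ℓ : HNNExtension ↥P A B φ →* F := HNNExtension.lift P.subtype t (fun a => ht a)
  have hof : ∀ x : P, ℓ (HNNExtension.of x) = x := fun x => HNNExtension.lift_of _ _ _ _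
  have hlt : ℓ HNNExtension.t = t := HNNExtension.lift_t _ _ _
  obtain ⟨d⟩ := HNNExtension.NormalWord.TransversalPair.nonempty ↥P A B
  have key : ∀ w : HNNExtension.NormalWord d, ℓ (w.prod φ) ∈ G ∧ 
      ((w.toList = [] ∧ w.prod φ = HNNExtension.of w.head) ∨
       ∃ u : ℤˣ, u ∈ w.toList.head?.map Prod.fst ∧ U u ((w.head : F)⁻¹ * ℓ (w.prod φ))) := by
    intro w
    induction w using HNNExtension.NormalWord.consRecOn with
    | ofGroup g =>
      have : (HNNExtension.NormalWord.ofGroup g : HNNExtension.NormalWord d).prod φ =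
          HNNExtension.of g := by
        simp [HNNExtension.NormalWord.ReducedWord.prod, HNNExtension.NormalWord.ofGroup]
      refine ⟨?_, Or.inl ⟨rfl, this⟩⟩
      rw [this, hof]; exact hPG g.2
    | cons g u w h1 h2 ih =>
      obtain ⟨hwG, ih⟩ := ih
      have hp : ℓ ((HNNExtension.NormalWord.cons g u w h1 h2).prod φ) =
          g * (t ^ (u : ℤ) * ℓ (w.prod φ)) := by
        rw [HNNExtension.NormalWord.prod_cons]
        simp only [map_mul, hof, map_zpow, hlt]
      rw [hp]
      refine ⟨G.mul_mem (hPG g.2) (G.mul_mem (G.zpow_mem htG _) hwG), Or.inr ⟨u, by simp, ?_⟩⟩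
      rw [HNNExtension.NormalWord.cons_head, inv_mul_cancel_left]
      apply htU u _ hwG
      rcases ih with ⟨-, hw⟩ | ⟨u', hu', hU⟩
      · rw [hw, hof]; exact hPU _ _ w.head.2
      · have e : ℓ (w.prod φ) = w.head * ((w.head : F)⁻¹ * ℓ (w.prod φ)) := by group
        have hG' : (w.head : F)⁻¹ * ℓ (w.prod φ) ∈ G :=
          G.mul_mem (G.inv_mem (hPG w.head.2)) hwG
        rw [e]
        by_cases huu : u = u'
        · subst huu
          exact hdiff u w.head _ hG' hU
        · have h3 : w.head ∉ HNNExtension.toSubgroup A B u := fun h => huu (h2 u' hu' h)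
          have h4 : u' = -u := Int.units_ne_iff_eq_neg.1 (Ne.symm huu)
          subst h4
          exact hsame (-u) w.head (by rwa [neg_neg]) _ hG' hU
  refine ⟨ℓ, ?_, ?_, ?_⟩
  · ext x; exact hof x
  · rw [injective_iff_map_eq_one]
    intro x hx
    have hw : (HNNExtension.NormalWord.equiv φ d x).prod φ = x :=
      (HNNExtension.NormalWord.equiv φ d).symm_apply_apply x
    obtain ⟨-, h⟩ := key (HNNExtension.NormalWord.equiv φ d x)
    rw [hw, hx] at h
    rcases h with ⟨-, h⟩ | ⟨u, -, h⟩
    · rw [h, hof] at hx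
      rw [h, show (HNNExtension.NormalWord.equiv φ d x).head = 1 from Subtype.ext hx, map_one]
    · rw [mul_one] at h
      exact absurd h (hPU u _ (P.inv_mem (Subtype.prop _)))
  · apply le_antisymm
    · rintro _ ⟨x, rfl⟩
      induction x using HNNExtension.induction_on with
      | of g => rw [hof]; exact hPG g.2
      | t => rw [hlt]; exact htG
      | mul x y hx hy => rw [map_mul]; exact G.mul_mem hx hy
      | inv x hx => rw [map_inv]; exact G.inv_mem hx
    · rw [← hG, sup_le_iff, Subgroup.zpowers_le]
      exact ⟨fun x hx => ⟨HNNExtension.of ⟨x, hx⟩, hof _⟩, ⟨HNNExtension.t, hlt⟩⟩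

end PingPong

/-! ### Splittings from one orbit of walls -/

theorem rtg_symm {X : Type*} {r : X → X → Prop} (h : ∀ x y, r x y → r y x) {x y : X}
    (hxy : Relation.ReflTransGen r x y) : Relation.ReflTransGen r y x := by
  induction hxy with
  | refl => exact .refl
  | tail _ h' ih => exact .head (h _ _ h') ih

theorem rtg_lift {X Y : Type*} {r : X → X → Prop} {r' : Y → Y → Prop} (f : X → Y)
    (h : ∀ x y, r x y → r' (f x) (f y)) {x y : X} (hxy : Relation.ReflTransGen r x y) :
    Relation.ReflTransGen r' (f x) (f y) := by
  induction hxy with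
  | refl => exact .refl
  | tail _ h' ih => exact .tail ih (h _ _ h')

section Wall

variable {F M X : Type*} [Group F] [Group M] [MulAction M X]

theorem stepOver_of_amalgam_pingPong (j : M →* F) (hj : Function.Injective j)
    {P Q : Subgroup M} {c : M} (hcP : c ∈ P) (hcQ : c ∈ Q) (U : M → Prop)
    (hC : ∀ c' ∈ Subgroup.zpowers c, ∀ g, U (c' * g) ↔ U g)
    (hP : ∀ p ∈ P, p ∉ Subgroup.zpowers c → ∀ g, U g → ¬ U (p * g))
    (hQ : ∀ q ∈ Q, q ∉ Subgroup.zpowers c → ∀ g, ¬ U g → U (q * g))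
    (hPU : ∀ p ∈ P, ¬ U p) (hG : P ⊔ Q = ⊤) :
    StepOver (j c) (P.map j) j.range := by
  let U' : F → Prop := fun f => ∃ m, j m = f ∧ U m
  have hU : ∀ m, U' (j m) ↔ U m := fun m =>
    ⟨fun ⟨m', h, h'⟩ => hj h ▸ h', fun h => ⟨m, rfl, h⟩⟩
  have hz : ∀ m, j m ∈ Subgroup.zpowers (j c) ↔ m ∈ Subgroup.zpowers c := by
    intro m
    rw [← MonoidHom.map_zpowers]
    exact Subgroup.mem_map_iff_mem hj
  have h1 : Subgroup.zpowers (j c) ≤ P.map j := by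
    rw [Subgroup.zpowers_le]; exact ⟨c, hcP, rfl⟩
  have h2 : Subgroup.zpowers (j c) ≤ Q.map j := by
    rw [Subgroup.zpowers_le]; exact ⟨c, hcQ, rfl⟩
  have hle : ∀ R : Subgroup M, R.map j ≤ j.range := by
    rintro R _ ⟨x, -, rfl⟩; exact ⟨x, rfl⟩
  refine Or.inl ⟨Q.map j, h1, h2, hle _, hle _, isAmalgamOf_of_pingPong h1 h2 U' ?_ ?_ ?_ ?_ ?_⟩
  · rintro _ hc' _ ⟨g, rfl⟩
    obtain ⟨x, hx, rfl⟩ : _ ∈ (Subgroup.zpowers c).map j := by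
      rw [MonoidHom.map_zpowers]; exact hc'
    rw [← map_mul, hU, hU]
    exact hC x hx g
  · rintro _ ⟨p, hp, rfl⟩ hpc _ ⟨g, rfl⟩ hg
    rw [← map_mul, hU]; rw [hU] at hg
    exact hP p hp (fun h => hpc ((hz p).2 h)) g hg
  · rintro _ ⟨p, hp, rfl⟩ hpc _ ⟨g, rfl⟩ hg
    rw [← map_mul, hU]; rw [hU] at hg
    exact hQ p hp (fun h => hpc ((hz p).2 h)) g hg
  · rintro _ ⟨p, hp, rfl⟩
    rw [hU]; exact hPU p hp
  · rw [← Subgroup.map_sup, hG, MonoidHom.range_eq_map]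

theorem stepOver_of_hnn_pingPong (j : M →* F) (hj : Function.Injective j)
    {P : Subgroup M} {c t : M} (hcP : c ∈ P) (hct : t⁻¹ * c * t ∈ P) (U : ℤˣ → M → Prop)
    (htU : ∀ u : ℤˣ, ∀ g, ¬ U (-u) g → U u (t ^ (u : ℤ) * g))
    (hs1 : ∀ p ∈ P, p ∉ Subgroup.zpowers c → ∀ g, U 1 g → ¬ U 1 (p * g))
    (hs2 : ∀ p ∈ P, t * p * t⁻¹ ∉ Subgroup.zpowers c → ∀ g, U (-1) g → ¬ U (-1) (p * g))
    (hdiff : ∀ u : ℤˣ, ∀ p ∈ P, ∀ g, U u g → ¬ U (-u) (p * g))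
    (hPU : ∀ u : ℤˣ, ∀ p ∈ P, ¬ U u p) (hG : P ⊔ Subgroup.zpowers t = ⊤) :
    StepOver (j c) (P.map j) j.range := by
  let U' : ℤˣ → F → Prop := fun u f => ∃ m, j m = f ∧ U u m
  have hU : ∀ u m, U' u (j m) ↔ U u m := fun u m =>
    ⟨fun ⟨m', h, h'⟩ => hj h ▸ h', fun h => ⟨m, rfl, h⟩⟩
  let d : ↥(P.map j) := ⟨j c, c, hcP, rfl⟩
  let c' : ↥(P.map j) := ⟨j (t⁻¹ * c * t), _, hct, rfl⟩
  have hcd : ∀ k : ℤ, j t * ((c' ^ k : ↥(P.map j)) : F) * (j t)⁻¹ = ((d ^ k : ↥(P.map j)) : F) := by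
    intro k
    have : (c' : F) = (j t)⁻¹ * j c * j t := by simp [c']
    rw [Subgroup.coe_zpow, Subgroup.coe_zpow, this]
    have := conj_zpow (i := k) (a := (j t)⁻¹) (b := j c)
    rw [inv_inv] at this
    rw [this]; simp [d, mul_assoc]
  let φ : ↥(Subgroup.zpowers c') ≃* ↥(Subgroup.zpowers d) :=
    { toFun := fun a => ⟨⟨j t * (a : ↥(P.map j)) * (j t)⁻¹, by
          obtain ⟨_, k, rfl⟩ := a
          have := hcd k
          simp only at this ⊢
          rw [this]; exact (d ^ k).2⟩, by
          obtain ⟨_, k, rfl⟩ := a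
          exact ⟨k, Subtype.ext (hcd k).symm⟩⟩
      invFun := fun a => ⟨⟨(j t)⁻¹ * (a : ↥(P.map j)) * (j t), by
          obtain ⟨_, k, rfl⟩ := a
          have := hcd k
          simp only at this ⊢
          rw [← this]; simpa [mul_assoc] using (c' ^ k).2⟩, by
          obtain ⟨_, k, rfl⟩ := a
          exact ⟨k, Subtype.ext (by simp only; rw [← hcd k]; simp [mul_assoc])⟩⟩
      left_inv := fun a => by ext; simp [mul_assoc]
      right_inv := fun a => by ext; simp [mul_assoc]
      map_mul' := fun a b => by ext; simp [mul_assoc] }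
  have hmemd : ∀ p (hp : p ∈ P), (⟨j p, p, hp, rfl⟩ : ↥(P.map j)) ∈ Subgroup.zpowers d ↔
      p ∈ Subgroup.zpowers c := by
    intro p hp
    constructor
    · rintro ⟨k, hk⟩
      refine ⟨k, hj ?_⟩
      have := congrArg Subtype.val hk
      simpa [d] using this
    · rintro ⟨k, hk⟩
      exact ⟨k, Subtype.ext (by simp [d, ← hk])⟩
  have hmemc : ∀ p (hp : p ∈ P), (⟨j p, p, hp, rfl⟩ : ↥(P.map j)) ∈ Subgroup.zpowers c' ↔
      t * p * t⁻¹ ∈ Subgroup.zpowers c := by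
    intro p hp
    constructor
    · rintro ⟨k, hk⟩
      refine ⟨k, hj ?_⟩
      have h1 := congrArg Subtype.val hk
      have h2 := hcd k
      simp only at h1
      rw [h1] at h2
      simpa [d] using h2.symm
    · rintro ⟨k, hk⟩
      refine ⟨k, Subtype.ext ?_⟩
      have h2 := hcd k
      have h3 : ((d ^ k : ↥(P.map j)) : F) = j (t * p * t⁻¹) := by simp [d, ← hk]
      rw [h3, map_mul, map_mul, map_inv] at h2
      exact mul_left_cancel (mul_right_cancel h2)
  refine Or.inr ⟨_, _, φ, c', d, rfl, rfl, rfl, ?_, isHNNOf_of_pingPong φ (j t) ?_ U' ?_ ?_ ?_ ?_ ?_⟩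
  · intro h
    simp [c', h]
  · intro a
    simp [φ]
  · rintro u _ ⟨g, rfl⟩ hg
    rw [← map_zpow, ← map_mul, hU]; rw [hU] at hg
    exact htU u g hg
  · rintro u ⟨_, p, hp, rfl⟩ hpu _ ⟨g, rfl⟩ hg
    rw [← map_mul, hU]; rw [hU] at hg
    rcases Int.units_eq_one_or u with rfl | rfl
    · rw [HNNExtension.toSubgroup_neg_one, hmemd p hp] at hpu
      exact hs1 p hp hpu g hg
    · rw [neg_neg, HNNExtension.toSubgroup_one, hmemc p hp] at hpu
      exact hs2 p hp hpu g hg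
  · rintro u ⟨_, p, hp, rfl⟩ _ ⟨g, rfl⟩ hg
    rw [← map_mul, hU]; rw [hU] at hg
    exact hdiff u p hp g hg
  · rintro u _ ⟨p, hp, rfl⟩
    rw [hU]; exact hPU u p hp
  · rw [← MonoidHom.map_zpowers, ← Subgroup.map_sup, hG, MonoidHom.range_eq_map]

/-- An adjacency not crossed by any translate of the wall `Φ`. -/
def Uncrossed (M : Type*) {X : Type*} [Group M] [MulAction M X] (E Φ : X → X → Prop)
    (x y : X) : Prop :=
  E x y ∧ ∀ g : M, ¬ Φ (g • x) (g • y) ∧ ¬ Φ (g • y) (g • x)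

theorem exists_stepOver_of_wall (j : M →* F) (hj : Function.Injective j)
    (E Φ : X → X → Prop) (H : X → Prop) (a b : X) (c : M)
    (hEsymm : ∀ x y, E x y → E y x) (hEM : ∀ (g : M) x y, E x y → E (g • x) (g • y))
    (hab : Φ a b) (hΦ : ∀ x y, Φ x y → E x y ∧ ¬ H x ∧ H y)
    (hH : ∀ x y, E x y → ¬ H x → H y → Φ x y)
    (hdisj : ∀ (g : M) x y, Φ x y → Φ (g • x) (g • y) → ∀ x' y', Φ x' y' → Φ (g • x') (g • y'))
    (horient : ∀ (g : M) x y, Φ x y → ¬ Φ (g • y) (g • x))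
    (hconn : ∀ g : M, Relation.ReflTransGen E a (g • a))
    (hnear : ∀ x y, Φ x y → Relation.ReflTransGen (Uncrossed M E Φ) a x ∧
      Relation.ReflTransGen (Uncrossed M E Φ) b y)
    (hc : ∀ g : M, Φ (g • a) (g • b) ↔ g ∈ Subgroup.zpowers c) :
    ∃ P : Subgroup M, (∀ g, g ∈ P ↔ Relation.ReflTransGen (Uncrossed M E Φ) a (g • a)) ∧
      StepOver (j c) (P.map j) j.range := by
  set R := Relation.ReflTransGen (Uncrossed M E Φ) with hR
  have nsymm : ∀ x y, Uncrossed M E Φ x y → Uncrossed M E Φ y x :=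
    fun x y h => ⟨hEsymm _ _ h.1, fun g => ⟨(h.2 g).2, (h.2 g).1⟩⟩
  have nM : ∀ (g : M) x y, Uncrossed M E Φ x y → Uncrossed M E Φ (g • x) (g • y) := by
    intro g x y h
    refine ⟨hEM _ _ _ h.1, fun g' => ?_⟩
    rw [smul_smul, smul_smul]; exact h.2 _
  have rsymm : ∀ {x y}, R x y → R y x := fun h => rtg_symm nsymm h
  have rtrans : ∀ {x y z}, R x y → R y z → R x z := fun h h' => h.trans h'
  have rM : ∀ (g : M) {x y}, R x y → R (g • x) (g • y) :=
    fun g x y h => rtg_lift (g • ·) (fun _ _ h => nM g _ _ h) h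
  have rH : ∀ {x y}, R x y → (H x ↔ H y) := by
    intro x y h
    induction h with
    | refl => rfl
    | tail _ h ih =>
      rw [ih]
      have h1 := h.2 1
      simp only [one_smul] at h1
      constructor
      · intro hy; by_contra hz; exact h1.2 (hH _ _ (hEsymm _ _ h.1) hz hy)
      · intro hy; by_contra hz; exact h1.1 (hH _ _ h.1 hz hy)
  have ha : ¬ H a := (hΦ a b hab).2.1
  have hb : H b := (hΦ a b hab).2.2
  have hcross : ∀ (g : M) x y, Φ (g • x) (g • y) → R (g⁻¹ • a) x ∧ R (g⁻¹ • b) y := by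
    intro g x y h
    obtain ⟨h1, h2⟩ := hnear _ _ h
    have h1' := rM g⁻¹ h1
    have h2' := rM g⁻¹ h2
    rw [inv_smul_smul] at h1' h2'
    exact ⟨h1', h2'⟩
  have hCΦ : ∀ g ∈ Subgroup.zpowers c, ∀ x y, Φ (g • x) (g • y) ↔ Φ x y := by
    intro g hg x y
    constructor
    · intro h
      have hg' := (hc g⁻¹).2 (Subgroup.inv_mem _ hg)
      have := hdisj g⁻¹ a b hab hg' _ _ h
      simpa using this
    · exact fun h => hdisj g a b hab ((hc g).2 hg) _ _ h
  have hdiffE : ∀ x y, E x y → ((H x ↔ H y) ↔ (¬ Φ x y ∧ ¬ Φ y x)) := by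
    intro x y hE
    constructor
    · exact fun h => ⟨fun h' => (hΦ _ _ h').2.1 (h.2 (hΦ _ _ h').2.2),
        fun h' => (hΦ _ _ h').2.1 (h.1 (hΦ _ _ h').2.2)⟩
    · intro h
      constructor
      · intro hy; by_contra hz; exact h.2 (hH _ _ (hEsymm _ _ hE) hz hy)
      · intro hy; by_contra hz; exact h.1 (hH _ _ hE hz hy)
  have hCH : ∀ g ∈ Subgroup.zpowers c, ∀ x, Relation.ReflTransGen E a x → (H (g • x) ↔ H x) := by
    intro g hg x hx
    induction hx with
    | refl =>
      have := (hΦ _ _ ((hc g).2 hg)).2.1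
      simp [this, ha]
    | tail _ hE ih =>
      have h1 := hdiffE _ _ hE
      have h2 := hdiffE _ _ (hEM g _ _ hE)
      rw [hCΦ g hg, hCΦ g hg] at h2
      tauto
  have far : ∀ (s₁ s₂ : Bool) (g₁ g₂ : M) (z₀ z : X),
      R (g₁ • cond s₁ b a) z₀ → R (g₂ • cond s₂ b a) z₀ → Relation.ReflTransGen E z₀ z →
      (H (g₁⁻¹ • z) ↔ s₁ = false) → (H (g₂⁻¹ • z) ↔ s₂ = false) →
      s₁ = s₂ ∧ g₁⁻¹ * g₂ ∈ Subgroup.zpowers c := by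
    intro s₁ s₂ g₁ g₂ z₀ z hz₁ hz₂ hz
    have base : ∀ (s : Bool) (g : M), R (g • cond s b a) z₀ → ∀ z, R z₀ z →
        ¬ (H (g⁻¹ • z) ↔ s = false) := by
      intro s g h z hz
      have h2 := rH (rM g⁻¹ (rtrans h hz))
      rw [inv_smul_smul] at h2
      rw [← h2]
      cases s <;> simp [ha, hb]
    have flip : ∀ (s : Bool) (g : M) (z z' : X), E z z' → ¬ (H (g⁻¹ • z) ↔ s = false) →
        (H (g⁻¹ • z') ↔ s = false) →
        cond s (Φ (g⁻¹ • z') (g⁻¹ • z)) (Φ (g⁻¹ • z) (g⁻¹ • z')) := by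
      intro s g z z' hE h1 h2
      cases s with
      | false =>
        simp only [iff_true] at h1 h2
        exact hH _ _ (hEM _ _ _ hE) h1 h2
      | true =>
        simp only [Bool.true_eq_false, iff_false, not_not] at h1 h2
        exact hH _ _ (hEM _ _ _ (hEsymm _ _ hE)) h2 h1
    have flipR : ∀ (s : Bool) (g : M) (z z' : X), E z z' → ¬ (H (g⁻¹ • z) ↔ s = false) →
        (H (g⁻¹ • z') ↔ s = false) → R (g • cond s b a) z := by
      intro s g z z' hE h1 h2
      have h3 := flip s g z z' hE h1 h2
      cases s with
      | false => simpa using (hcross _ _ _ h3).1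
      | true => simpa using (hcross _ _ _ h3).2
    induction hz with
    | refl => intro h1; exact absurd h1 (base _ _ hz₁ _ Relation.ReflTransGen.refl)
    | @tail z z' hz hE ih =>
      intro h1 h2
      by_cases k1 : (H (g₁⁻¹ • z) ↔ s₁ = false)
      · by_cases k2 : (H (g₂⁻¹ • z) ↔ s₂ = false)
        · exact ih k1 k2
        · exact absurd k1 (base _ _ hz₁ _ (rtrans (rsymm hz₂) (flipR _ _ _ _ hE k2 h2)))
      · by_cases k2 : (H (g₂⁻¹ • z) ↔ s₂ = false)
        · exact absurd k2 (base _ _ hz₂ _ (rtrans (rsymm hz₁) (flipR _ _ _ _ hE k1 h1)))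
        · have f1 := flip _ _ _ _ hE k1 h1
          have f2 := flip _ _ _ _ hE k2 h2
          have e : ∀ x : X, g₁⁻¹ • x = (g₁⁻¹ * g₂) • (g₂⁻¹ • x) := by
            intro x; rw [smul_smul, mul_inv_cancel_right]
          have done : ∀ x y, Φ x y → Φ ((g₁⁻¹ * g₂) • x) ((g₁⁻¹ * g₂) • y) →
              g₁⁻¹ * g₂ ∈ Subgroup.zpowers c := fun x y h h' =>
            (hc _).1 (hdisj _ _ _ h h' _ _ hab)
          cases s₁ <;> cases s₂ <;> simp only [cond_true, cond_false] at f1 f2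
          · rw [e z, e z'] at f1; exact ⟨rfl, done _ _ f2 f1⟩
          · rw [e z, e z'] at f1; exact absurd f1 (horient _ _ _ f2)
          · rw [e z, e z'] at f1; exact absurd f1 (horient _ _ _ f2)
          · rw [e z, e z'] at f1; exact ⟨rfl, done _ _ f2 f1⟩
  have rE : ∀ {x y}, R x y → Relation.ReflTransGen E x y := fun h =>
    rtg_lift id (fun _ _ h => h.1) h
  let stab : X → Subgroup M := fun x =>
    { carrier := {g | R x (g • x)}
      one_mem' := by simp only [Set.mem_ofPred_eq, one_smul]; exact Relation.ReflTransGen.refl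
      mul_mem' := by
        intro g h hg hh
        simp only [Set.mem_ofPred_eq] at *
        rw [mul_smul]; exact rtrans hg (rM g hh)
      inv_mem' := by
        intro g hg
        simp only [Set.mem_ofPred_eq] at *
        have := rM g⁻¹ hg
        rw [inv_smul_smul] at this
        exact rsymm this }
  have hstab : ∀ x g, g ∈ stab x ↔ R x (g • x) := fun x g => Iff.rfl
  have hCa : ∀ g ∈ Subgroup.zpowers c, R a (g • a) ∧ R b (g • b) := fun g hg =>
    hnear _ _ ((hc g).2 hg)
  refine ⟨stab a, hstab a, ?_⟩
  have hconn' : ∀ z₀ g, R a z₀ → Relation.ReflTransGen E z₀ (g • a) := fun z₀ g h =>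
    (rE (rsymm h)).trans (hconn g)
  have hEab : Relation.ReflTransGen E b a :=
    Relation.ReflTransGen.single (hEsymm _ _ (hΦ _ _ hab).1)
  have stepcases : ∀ z z', E z z' → R z z' ∨ (∃ g : M, R (g • a) z ∧ R (g • b) z') ∨
      ∃ g : M, R (g • b) z ∧ R (g • a) z' := by
    intro z z' hE
    by_cases h : Uncrossed M E Φ z z'
    · exact Or.inl (Relation.ReflTransGen.single h)
    · have : ∃ g : M, Φ (g • z) (g • z') ∨ Φ (g • z') (g • z) := by
        by_contra! h'
        exact h ⟨hE, h'⟩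
      obtain ⟨g, h | h⟩ := this
      · exact Or.inr (Or.inl ⟨g⁻¹, hcross _ _ _ h⟩)
      · exact Or.inr (Or.inr ⟨g⁻¹, (hcross _ _ _ h).2, (hcross _ _ _ h).1⟩)
  have memstab : ∀ x z (g h : M), R (g • x) z → R (h • x) z → h⁻¹ * g ∈ stab x := by
    intro x z g h h1 h2
    have := rM h⁻¹ (rtrans h2 (rsymm h1))
    rw [inv_smul_smul, smul_smul] at this
    exact this
  by_cases hcase : ∃ t : M, R b (t • a)
  · obtain ⟨t, hta⟩ := hcase
    have hta' : R (t⁻¹ • b) a := by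
      have := rM t⁻¹ hta
      rwa [inv_smul_smul] at this
    refine stepOver_of_hnn_pingPong j hj (t := t) (hCa c (Subgroup.mem_zpowers c)).1 ?_
      (fun u g => if u = 1 then H (g • a) else ¬ H ((t * g) • a)) ?_ ?_ ?_ ?_ ?_ ?_
    · rw [hstab, mul_smul, mul_smul]
      have h1 := (hCa c (Subgroup.mem_zpowers c)).2
      have h2 := rM t⁻¹ (rM c hta)
      exact rtrans (rtrans (rsymm hta') (rM t⁻¹ h1)) h2
    · intro u g h
      rcases Int.units_eq_one_or u with rfl | rfl
      · simpa using h
      · simpa using h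
    · intro p hp hpc g hg hg'
      simp only [if_true] at hg hg'
      have := far false false 1 p a ((p * g) • a) (by simpa using Relation.ReflTransGen.refl)
        (by simpa using rsymm hp) (hconn _) (by simpa using hg')
        (by simpa [mul_smul] using hg)
      exact hpc (by simpa using this.2)
    · intro p hp hpc g hg hg'
      have hne : (-1 : ℤˣ) ≠ 1 := by decide
      simp only [if_neg hne] at hg hg'
      have := far true true t⁻¹ (p * t⁻¹) a ((p * g) • a) hta'
        (by simpa [mul_smul] using rtrans (rM p hta') (rsymm hp)) (hconn _)
        (by simpa [mul_smul] using hg') (by simpa [mul_smul] using hg)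
      exact hpc (by simpa [mul_assoc] using this.2)
    · intro u p hp g hg hg'
      have hne : (-1 : ℤˣ) ≠ 1 := by decide
      rcases Int.units_eq_one_or u with rfl | rfl
      · simp only [if_true, if_neg hne] at hg hg'
        have := far false true p t⁻¹ a ((p * g) • a) (rsymm hp) hta' (hconn _)
          (by simpa [mul_smul] using hg) (by simpa [mul_smul] using hg')
        exact absurd this.1 (by decide)
      · simp only [if_true, if_neg hne, neg_neg] at hg hg'
        have := far false true 1 (p * t⁻¹) a ((p * g) • a)
          (by simpa using Relation.ReflTransGen.refl)
          (by simpa [mul_smul] using rtrans (rM p hta') (rsymm hp)) (hconn _)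
          (by simpa [mul_smul] using hg') (by simpa [mul_smul] using hg)
        exact absurd this.1 (by decide)
    · intro u p hp
      have hne : (-1 : ℤˣ) ≠ 1 := by decide
      rcases Int.units_eq_one_or u with rfl | rfl
      · simp only [if_true]
        exact fun h => ha ((rH hp).2 h)
      · simp only [if_neg hne, not_not, mul_smul]
        exact (rH (rtrans hta (rM t hp))).1 hb
    · rw [eq_top_iff]
      rintro g -
      have ht : t ∈ stab a ⊔ Subgroup.zpowers t :=
        (le_sup_right : Subgroup.zpowers t ≤ _) (Subgroup.mem_zpowers t)
      have key : ∀ z, Relation.ReflTransGen E a z →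
          ∃ h ∈ stab a ⊔ Subgroup.zpowers t, R (h • a) z := by
        intro z hz
        induction hz with
        | refl => exact ⟨1, Subgroup.one_mem _, by simpa using Relation.ReflTransGen.refl⟩
        | @tail z z' _ hE ih =>
          obtain ⟨h, hh, hz⟩ := ih
          rcases stepcases _ _ hE with h1 | ⟨g, h1, h2⟩ | ⟨g, h1, h2⟩
          · exact ⟨h, hh, rtrans hz h1⟩
          · have h3 := memstab a z g h h1 hz
            have h4 := Subgroup.mul_mem _ hh ((le_sup_left : stab a ≤ _) h3)
            rw [mul_inv_cancel_left] at h4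
            refine ⟨g * t, Subgroup.mul_mem _ h4 ht, ?_⟩
            rw [mul_smul]
            exact rtrans (rM g (rsymm hta)) h2
          · have h1' : R ((g * t) • a) z := by
              rw [mul_smul]; exact rtrans (rM g (rsymm hta)) h1
            have h3 := memstab a z (g * t) h h1' hz
            have h4 := Subgroup.mul_mem _ hh ((le_sup_left : stab a ≤ _) h3)
            rw [mul_inv_cancel_left] at h4
            refine ⟨g, ?_, h2⟩
            have h5 := Subgroup.mul_mem _ h4 (Subgroup.inv_mem _ ht)
            rwa [mul_inv_cancel_right] at h5
      obtain ⟨h, hh, hz⟩ := key _ (hconn g)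
      have h3 := memstab a _ g h Relation.ReflTransGen.refl hz
      have h4 := Subgroup.mul_mem _ hh ((le_sup_left : stab a ≤ _) h3)
      rwa [mul_inv_cancel_left] at h4
  · push Not at hcase
    refine stepOver_of_amalgam_pingPong j hj (Q := stab b)
      (hCa c (Subgroup.mem_zpowers c)).1 (hCa c (Subgroup.mem_zpowers c)).2
      (fun g => H (g • a)) ?_ ?_ ?_ ?_ ?_
    · intro c' hc' g
      simp only [mul_smul]
      exact hCH c' hc' _ (hconn g)
    · intro p hp hpc g hg hg'
      have := far false false 1 p a ((p * g) • a) (by simpa using Relation.ReflTransGen.refl)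
        (by simpa using rsymm hp) (hconn _) (by simpa using hg')
        (by simpa [mul_smul] using hg)
      exact hpc (by simpa using this.2)
    · intro p hp hpc g hg
      by_contra hg'
      have := far true true 1 p b ((p * g) • a) (by simpa using Relation.ReflTransGen.refl)
        (by simpa using rsymm hp) (hEab.trans (hconn _)) (by simpa using hg')
        (by simpa [mul_smul] using hg)
      exact hpc (by simpa using this.2)
    · intro p hp h
      exact ha ((rH hp).2 h)
    · rw [eq_top_iff]
      rintro g -
      have hno : ∀ z (g h : M), R (g • a) z → ¬ R (h • b) z := by
        intro z g h h1 h2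
        have := rM h⁻¹ (rtrans h2 (rsymm h1))
        rw [inv_smul_smul, smul_smul] at this
        exact hcase _ this
      have key : ∀ z, Relation.ReflTransGen E a z →
          ∃ h ∈ stab a ⊔ stab b, R (h • a) z ∨ R (h • b) z := by
        intro z hz
        induction hz with
        | refl => exact ⟨1, Subgroup.one_mem _, by simpa using Or.inl Relation.ReflTransGen.refl⟩
        | @tail z z' _ hE ih =>
          obtain ⟨h, hh, hz⟩ := ih
          rcases stepcases _ _ hE with h1 | ⟨g, h1, h2⟩ | ⟨g, h1, h2⟩
          · exact ⟨h, hh, hz.imp (fun k => rtrans k h1) (fun k => rtrans k h1)⟩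
          · rcases hz with hz | hz
            · have h3 := memstab a z g h h1 hz
              have h4 := Subgroup.mul_mem _ hh ((le_sup_left : stab a ≤ stab a ⊔ stab b) h3)
              rw [mul_inv_cancel_left] at h4
              exact ⟨g, h4, Or.inr h2⟩
            · exact absurd hz (hno _ _ _ h1)
          · rcases hz with hz | hz
            · exact absurd h1 (hno _ _ _ hz)
            · have h3 := memstab b z g h h1 hz
              have h4 := Subgroup.mul_mem _ hh ((le_sup_right : stab b ≤ stab a ⊔ stab b) h3)
              rw [mul_inv_cancel_left] at h4
              exact ⟨g, h4, Or.inl h2⟩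
      obtain ⟨h, hh, hz | hz⟩ := key _ (hconn g)
      · have h3 := memstab a _ g h Relation.ReflTransGen.refl hz
        have h4 := Subgroup.mul_mem _ hh ((le_sup_left : stab a ≤ stab a ⊔ stab b) h3)
        rwa [mul_inv_cancel_left] at h4
      · exact absurd hz (hno _ _ _ Relation.ReflTransGen.refl)

end Wall

/-! ### Homomorphisms to a group of order two control the rank -/

/-- The group of order two. -/
abbrev Z2 : Type := Multiplicative (ZMod 2)

theorem Z2.mul_self (x : Z2) : x * x = 1 := by revert x; decide

theorem Z2.eq_of_ne {x y z : Z2} (h : x ≠ z) (h' : y ≠ z) : x = y := by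
  revert x y z; decide

section Rank

variable {F : Type*} [Group F]

theorem isAmalgamOf_exists_hom {P B C G : Subgroup F} {hP : C ≤ P} {hB : C ≤ B}
    (h : IsAmalgamOf P B C hP hB G) (hPG : P ≤ G) (hBG : B ≤ G) {A : Type*} [Group A]
    (ψ : P →* A) (θ : B →* A) (hψθ : ∀ c : C, ψ ⟨c, hP c.2⟩ = θ ⟨c, hB c.2⟩) :
    ∃ χ : G →* A, χ.comp (Subgroup.inclusion hPG) = ψ ∧ χ.comp (Subgroup.inclusion hBG) = θ := by
  obtain ⟨ℓ, hℓ, hinj, hr⟩ := h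
  let e : _ ≃* ↥G := (MonoidHom.ofInjective hinj).trans (MulEquiv.subgroupCongr hr)
  have he : ∀ x, ((e x : G) : F) = ℓ x := fun x => rfl
  let f : ∀ i : Bool, ↥(cond i P B) →* A := fun i => match i with
    | true => ψ
    | false => θ
  let φ : ∀ i : Bool, ↥C →* ↥(cond i P B) := fun i : Bool =>
        (Subgroup.inclusion (show C ≤ cond i P B by cases i <;> assumption) :
          ↥C →* ↥(cond i P B))
  have hf : ∀ i, (f i).comp (φ i) = θ.comp (Subgroup.inclusion hB) := by
    intro i; ext x
    cases i with
    | true => exact hψθ x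
    | false => rfl
  have hof : ∀ (i : Bool) (x : ↥(cond i P B)) (hx : (x : F) ∈ G),
      (Monoid.PushoutI.lift f (θ.comp (Subgroup.inclusion hB)) hf) (e.symm ⟨x, hx⟩) = f i x := by
    intro i x hx
    have : e.symm ⟨x, hx⟩ = Monoid.PushoutI.of i x := by
      rw [MulEquiv.symm_apply_eq]
      apply Subtype.ext
      rw [he]
      exact (DFunLike.congr_fun (hℓ i) x).symm
    rw [this]
    exact Monoid.PushoutI.lift_of f _ hf x
  refine ⟨(Monoid.PushoutI.lift f (θ.comp (Subgroup.inclusion hB)) hf).comp e.symm.toMonoidHom,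
    ?_, ?_⟩
  · exact MonoidHom.ext fun x => hof true x (hPG x.2)
  · exact MonoidHom.ext fun x => hof false x (hBG x.2)

theorem isAmalgamOf_le_sup {P B C G : Subgroup F} {hP : C ≤ P} {hB : C ≤ B}
    (h : IsAmalgamOf P B C hP hB G) : G ≤ P ⊔ B := by
  obtain ⟨ℓ, hℓ, hinj, hr⟩ := h
  rw [← hr]
  rintro _ ⟨x, rfl⟩
  have hof : ∀ i (x : ↥(cond i P B)), ℓ (Monoid.PushoutI.of i x) = x :=
    fun i x => DFunLike.congr_fun (hℓ i) x
  induction x using Monoid.PushoutI.induction_on with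
  | of i g =>
    rw [hof]; cases i
    exacts [(le_sup_right : B ≤ _) g.2, (le_sup_left : P ≤ _) g.2]
  | base h =>
    rw [← Monoid.PushoutI.of_apply_eq_base _ true, hof]
    exact (le_sup_left : P ≤ P ⊔ B) (hP h.2)
  | mul x y hx hy => rw [map_mul]; exact Subgroup.mul_mem _ hx hy

theorem isHNNOf_le {P G : Subgroup F} {C D : Subgroup ↥P} {φ : ↥C ≃* ↥D} (h : IsHNNOf P φ G) :
    P ≤ G := by
  obtain ⟨ℓ, hℓ, hinj, hr⟩ := h
  intro x hx
  rw [← hr]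
  exact ⟨HNNExtension.of ⟨x, hx⟩, DFunLike.congr_fun hℓ ⟨x, hx⟩⟩

theorem isHNNOf_exists_hom {P G : Subgroup F} {C D : Subgroup ↥P} {φ : ↥C ≃* ↥D}
    (h : IsHNNOf P φ G) (hPG : P ≤ G) {A : Type*} [CommGroup A] :
    ∃ t : G, ∀ (ψ : P →* A) (z : A), (∀ c : C, ψ c = ψ (φ c)) →
      ∃ χ : G →* A, χ.comp (Subgroup.inclusion hPG) = ψ ∧ χ t = z := by
  obtain ⟨ℓ, hℓ, hinj, hr⟩ := h
  let e : _ ≃* ↥G := (MonoidHom.ofInjective hinj).trans (MulEquiv.subgroupCongr hr)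
  have he : ∀ x, ((e x : G) : F) = ℓ x := fun x => rfl
  refine ⟨e HNNExtension.t, fun ψ z hψ => ?_⟩
  have hz : ∀ c : C, z * ψ c = ψ (φ c) * z := fun c => by rw [hψ, mul_comm]
  refine ⟨(HNNExtension.lift ψ z hz).comp e.symm.toMonoidHom, ?_, ?_⟩
  · refine MonoidHom.ext fun x => ?_
    have : e.symm (Subgroup.inclusion hPG x) = HNNExtension.of x := by
      rw [MulEquiv.symm_apply_eq]
      apply Subtype.ext
      rw [he]
      exact (DFunLike.congr_fun hℓ x).symm
    change HNNExtension.lift ψ z hz (e.symm (Subgroup.inclusion hPG x)) = ψ x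
    rw [this, HNNExtension.lift_of]
  · change HNNExtension.lift ψ z hz (e.symm (e HNNExtension.t)) = z
    rw [MulEquiv.symm_apply_apply, HNNExtension.lift_t]

theorem exists_hom_ne_one {B : Type*} [Group B] [IsFreeGroup B] [Nontrivial B] :
    ∃ (θ : B →* Z2) (b : B), θ b ≠ 1 := by
  classical
  have : Nonempty (IsFreeGroup.Generators B) := by
    by_contra h
    rw [not_nonempty_iff] at h
    have h2 : MonoidHom.id B = 1 := IsFreeGroup.ext_hom (fun a => h.elim a)
    obtain ⟨x, hx⟩ := exists_ne (1 : B)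
    exact hx (DFunLike.congr_fun h2 x)
  obtain ⟨x⟩ := this
  refine ⟨IsFreeGroup.lift (fun _ => Multiplicative.ofAdd 1), IsFreeGroup.of x, ?_⟩
  rw [IsFreeGroup.lift_of]; decide

theorem exists_injection_of_obstruction {Γ Δ : Type*} [Group Γ] [Group Δ] (D : (Γ →* Z2) →* Z2)
    (T : (Δ →* Z2) → Prop) (res : (Δ →* Z2) → (Γ →* Z2))
    (hlift : ∀ ψ, D ψ = 1 → ∃ χ₁ χ₂, res χ₁ = ψ ∧ res χ₂ = ψ ∧ T χ₁ ∧ ¬ T χ₂) :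
    ∃ f : (Γ →* Z2) → (Δ →* Z2), Function.Injective f ∧ (D = 1 → ¬ Function.Surjective f) := by
  classical
  choose! χ₁ χ₂ h1 h2 h3 h4 using hlift
  by_cases hD : D = 1
  · have hD' : ∀ ψ, D ψ = 1 := fun ψ => by rw [hD]; rfl
    refine ⟨χ₁, fun x y h => ?_, fun _ hs => ?_⟩
    · rw [← h1 x (hD' x), h, h1 y (hD' y)]
    · obtain ⟨y, hy⟩ := hs (χ₂ 1)
      exact h4 1 (hD' 1) (hy ▸ h3 y (hD' y))
  · obtain ⟨ψ₁, hψ₁⟩ : ∃ ψ₁, D ψ₁ ≠ 1 := by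
      by_contra! h
      exact hD (MonoidHom.ext h)
    have hm : ∀ ψ, D ψ ≠ 1 → D (ψ * ψ₁) = 1 := by
      intro ψ hψ
      rw [map_mul, Z2.eq_of_ne hψ hψ₁, Z2.mul_self]
    refine ⟨fun ψ => if D ψ = 1 then χ₁ ψ else χ₂ (ψ * ψ₁), fun x y h => ?_, fun h => absurd h hD⟩
    by_cases hx : D x = 1 <;> by_cases hy : D y = 1 <;> simp only [hx, hy, if_true, if_false] at h
    · rw [← h1 x hx, h, h1 y hy]
    · exact absurd (h ▸ h3 x hx) (h4 _ (hm y hy))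
    · exact absurd (h.symm ▸ h3 y hy) (h4 _ (hm x hx))
    · have := h2 _ (hm x hx)
      rw [h, h2 _ (hm y hy)] at this
      exact mul_right_cancel this.symm

/-- Evaluation of homomorphisms at an element. -/
def evalZ2 {Γ : Type*} [Group Γ] (x : Γ) : (Γ →* Z2) →* Z2 where
  toFun ψ := ψ x
  map_one' := rfl
  map_mul' _ _ := rfl

theorem StepOver.exists_injection [IsFreeGroup F] {c : F} {P G : Subgroup F}
    (h : StepOver c P G) :
    ∃ f : (P →* Z2) → (G →* Z2), Function.Injective f ∧
      (c = 1 → P ≠ G → ¬ Function.Surjective f) := by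
  classical
  rcases h with ⟨B, hP, hB, hBG, hPG, hA⟩ | ⟨C, D, φ, c', d, hC, hD, hdc, hc1, hH⟩
  · by_cases hex : ∃ θ : B →* Z2, θ ⟨c, hB (Subgroup.mem_zpowers c)⟩ ≠ 1
    · obtain ⟨θ, hθ⟩ := hex
      have hext : ∀ ψ : P →* Z2, ∃ χ : G →* Z2, χ.comp (Subgroup.inclusion hPG) = ψ := by
        intro ψ
        have hm : ∀ (θ' : B →* Z2), ψ ⟨c, hP (Subgroup.mem_zpowers c)⟩ =
            θ' ⟨c, hB (Subgroup.mem_zpowers c)⟩ → ∀ x : Subgroup.zpowers c,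
            ψ ⟨x, hP x.2⟩ = θ' ⟨x, hB x.2⟩ := by
          rintro θ' h ⟨_, k, rfl⟩
          have e1 : (⟨c ^ k, hP ⟨k, rfl⟩⟩ : P) = ⟨c, hP (Subgroup.mem_zpowers c)⟩ ^ k := by
            ext; simp
          have e2 : (⟨c ^ k, hB ⟨k, rfl⟩⟩ : B) = ⟨c, hB (Subgroup.mem_zpowers c)⟩ ^ k := by
            ext; simp
          change ψ ⟨c ^ k, _⟩ = θ' ⟨c ^ k, _⟩
          rw [e1, e2, map_zpow, map_zpow, h]
        by_cases hψ : ψ ⟨c, hP (Subgroup.mem_zpowers c)⟩ = 1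
        · obtain ⟨χ, h1, -⟩ := isAmalgamOf_exists_hom hA hPG hBG ψ 1 (hm 1 hψ)
          exact ⟨χ, h1⟩
        · obtain ⟨χ, h1, -⟩ := isAmalgamOf_exists_hom hA hPG hBG ψ θ (hm θ (Z2.eq_of_ne hψ hθ))
          exact ⟨χ, h1⟩
      choose f hf using hext
      refine ⟨f, fun x y h => by rw [← hf x, h, hf y], fun hc => ?_⟩
      exact absurd (by subst hc; exact map_one θ) hθ
    · push Not at hex
      have hθ1 : ∀ (θ : B →* Z2) (x : Subgroup.zpowers c), θ ⟨x, hB x.2⟩ = 1 := by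
        rintro θ ⟨_, k, rfl⟩
        have e2 : (⟨c ^ k, hB ⟨k, rfl⟩⟩ : B) = ⟨c, hB (Subgroup.mem_zpowers c)⟩ ^ k := by
          ext; simp
        change θ ⟨c ^ k, _⟩ = 1
        rw [e2, map_zpow, hex, one_zpow]
      rcases subsingleton_or_nontrivial B with hsub | hnon
      · have hBbot : B = ⊥ := Subgroup.eq_bot_of_subsingleton B
        have hPG' : P = G := le_antisymm hPG (by simpa [hBbot] using isAmalgamOf_le_sup hA)
        subst hPG'
        exact ⟨id, Function.injective_id, fun _ h => absurd rfl h⟩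
      · obtain ⟨θ₀, b, hb⟩ := exists_hom_ne_one (B := B)
        obtain ⟨f, hf, hf'⟩ := exists_injection_of_obstruction
          (evalZ2 (⟨c, hP (Subgroup.mem_zpowers c)⟩ : P))
          (fun χ : G →* Z2 => χ (Subgroup.inclusion hBG b) = 1)
          (fun χ => χ.comp (Subgroup.inclusion hPG)) (by
            intro ψ hψ
            have hψ1 : ∀ x : Subgroup.zpowers c, ψ ⟨x, hP x.2⟩ = 1 := by
              rintro ⟨_, k, rfl⟩
              have e2 : (⟨c ^ k, hP ⟨k, rfl⟩⟩ : P) = ⟨c, hP (Subgroup.mem_zpowers c)⟩ ^ k := by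
                ext; simp
              change ψ ⟨c ^ k, _⟩ = 1
              rw [e2, map_zpow, show ψ ⟨c, hP (Subgroup.mem_zpowers c)⟩ = 1 from hψ, one_zpow]
            obtain ⟨χ₁, h1, h2⟩ := isAmalgamOf_exists_hom hA hPG hBG ψ 1 (fun x => by rw [hψ1, hθ1])
            obtain ⟨χ₂, h3, h4⟩ := isAmalgamOf_exists_hom hA hPG hBG ψ θ₀ (fun x => by rw [hψ1, hθ1])
            refine ⟨χ₁, χ₂, h1, h3, DFunLike.congr_fun h2 b, ?_⟩
            have := DFunLike.congr_fun h4 b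
            simp only [MonoidHom.comp_apply] at this
            rwa [this])
        refine ⟨f, hf, fun hc _ => hf' ?_⟩
        subst hc
        exact MonoidHom.ext fun ψ => map_one ψ
  · obtain ⟨t, ht⟩ := isHNNOf_exists_hom hH (isHNNOf_le hH) (A := Z2)
    have hgen : ∀ a : C, ∀ ψ : P →* Z2, ψ c' = 1 → ψ a = 1 := by
      intro a ψ h
      obtain ⟨k, hk⟩ := (hC ▸ a.2 : (a : P) ∈ Subgroup.zpowers c')
      rw [← hk]; simp [h]
    have hc'C : c' ∈ C := hC ▸ Subgroup.mem_zpowers c'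
    have hmatch : ∀ ψ : P →* Z2, ψ c' * ψ (φ ⟨c', hc'C⟩ : P) = 1 → ∀ a : C, ψ a = ψ (φ a) := by
      intro ψ h a
      obtain ⟨k, hk⟩ := (hC ▸ a.2 : (a : P) ∈ Subgroup.zpowers c')
      have ha : a = (⟨c', hc'C⟩ : C) ^ k := Subtype.ext (by simpa using hk.symm)
      have h' : ψ c' = ψ (φ ⟨c', hc'C⟩ : P) := by
        have := Z2.mul_self (ψ (φ ⟨c', hc'C⟩ : P))
        exact mul_right_cancel (h.trans this.symm)
      rw [ha, map_zpow]
      simp [h']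
    obtain ⟨f, hf, hf'⟩ := exists_injection_of_obstruction
      (evalZ2 c' * evalZ2 (φ ⟨c', hc'C⟩ : P)) (fun χ : G →* Z2 => χ t = 1)
      (fun χ => χ.comp (Subgroup.inclusion (isHNNOf_le hH))) (by
        intro ψ hψ
        obtain ⟨χ₁, h1, h2⟩ := ht ψ 1 (hmatch ψ hψ)
        obtain ⟨χ₂, h3, h4⟩ := ht ψ (Multiplicative.ofAdd 1) (hmatch ψ hψ)
        exact ⟨χ₁, χ₂, h1, h3, h2, by rw [h4]; decide⟩)
    refine ⟨f, hf, fun hc _ => hf' ?_⟩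
    have e1 : c' = 1 := Subtype.ext (hc1 hc)
    have e2 : (φ ⟨c', hc'C⟩ : P) = 1 := by
      have : (⟨c', hc'C⟩ : C) = 1 := Subtype.ext e1
      rw [this, map_one]; rfl
    refine MonoidHom.ext fun ψ => ?_
    rw [e2, e1]
    simp [evalZ2]

theorem finite_generators_of_finite_hom {B : Type*} [Group B] [IsFreeGroup B]
    [Finite (B →* Z2)] : Finite (IsFreeGroup.Generators B) := by
  classical
  have : Finite (IsFreeGroup.Generators B → Z2) := Finite.of_equiv _ IsFreeGroup.lift.symm
  have hinj : Function.Injective (fun (i : IsFreeGroup.Generators B) =>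
      (fun k => if k = i then Multiplicative.ofAdd 1 else 1 : IsFreeGroup.Generators B → Z2)) := by
    intro i k h
    by_contra hne
    have := congrFun h i
    simp only [if_true, if_neg hne] at this
    exact absurd this (by decide)
  exact Finite.of_injective _ hinj

theorem exists_freeGroup_equiv_of_finite_hom {B : Type*} [Group B] [IsFreeGroup B]
    [Finite (B →* Z2)] : ∃ n : ℕ, Nonempty (FreeGroup (Fin n) ≃* B) := by
  have := finite_generators_of_finite_hom (B := B)
  obtain ⟨n, ⟨e⟩⟩ := Finite.exists_equiv_fin (IsFreeGroup.Generators B)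
  exact ⟨n, ⟨(FreeGroup.freeGroupCongr e.symm).trans (IsFreeGroup.toFreeGroup B).symm⟩⟩

end Rank

/-! ### Orbits of a pair of involutions -/

/-- The orbit of `c₀` under the group generated by two involutions `s` and `t`. -/
def DihedralOrbit {Y : Type*} (s t : Equiv.Perm Y) (c₀ c : Y) : Prop :=
  ∃ k : ℤ, c = ((s * t) ^ k) c₀ ∨ c = s (((s * t) ^ k) c₀)

section Dihedral

variable {Y : Type*} {s t : Equiv.Perm Y} {c₀ : Y}

theorem DihedralOrbit.self : DihedralOrbit s t c₀ c₀ := ⟨0, Or.inl rfl⟩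

theorem dihedral_conj (hs : s * s = 1) (ht : t * t = 1) (k : ℤ) :
    s * (s * t) ^ k = (s * t) ^ (-k) * s := by
  have hsi : s⁻¹ = s := inv_eq_of_mul_eq_one_left hs
  have hti : t⁻¹ = t := inv_eq_of_mul_eq_one_left ht
  have h1 : s * (s * t) * s⁻¹ = (s * t)⁻¹ := by
    rw [mul_inv_rev, hsi, hti, ← mul_assoc, hs, one_mul]
  have h2 : s * (s * t) ^ k * s⁻¹ = (s * t) ^ (-k) := by
    rw [← conj_zpow, h1, inv_zpow, zpow_neg]
  rw [← h2, inv_mul_cancel_right]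

theorem DihedralOrbit.left (hs : s * s = 1) {c : Y} (h : DihedralOrbit s t c₀ c) :
    DihedralOrbit s t c₀ (s c) := by
  obtain ⟨k, rfl | rfl⟩ := h
  · exact ⟨k, Or.inr rfl⟩
  · refine ⟨k, Or.inl ?_⟩
    change (s * s) _ = _
    rw [hs]; rfl

theorem DihedralOrbit.right (hs : s * s = 1) (ht : t * t = 1) {c : Y}
    (h : DihedralOrbit s t c₀ c) : DihedralOrbit s t c₀ (t c) := by
  have key : ∀ k : ℤ, t (((s * t) ^ k) c₀) = s (((s * t) ^ (k + 1)) c₀) := by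
    intro k
    rw [add_comm, zpow_add, zpow_one]
    change (t * (s * t) ^ k) c₀ = (s * (s * t * (s * t) ^ k)) c₀
    rw [← mul_assoc, ← mul_assoc, hs, one_mul]
  obtain ⟨k, rfl | rfl⟩ := h
  · exact ⟨k + 1, Or.inr (key k)⟩
  · refine ⟨k - 1, Or.inl ?_⟩
    have := key (k - 1)
    rw [sub_add_cancel] at this
    rw [← this]
    change (t * t) _ = _
    rw [ht]; rfl

theorem DihedralOrbit.induction (hs : s * s = 1) (ht : t * t = 1) {p : Y → Prop} (h0 : p c₀)
    (hl : ∀ c, DihedralOrbit s t c₀ c → p c → p (s c))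
    (hr : ∀ c, DihedralOrbit s t c₀ c → p c → p (t c))
    {c : Y} (h : DihedralOrbit s t c₀ c) : p c := by
  have hpos : ∀ k : ℕ, p (((s * t) ^ k) c₀) := by
    intro k
    induction k with
    | zero => exact h0
    | succ k ih =>
      have hk : DihedralOrbit s t c₀ (((s * t) ^ k) c₀) := ⟨k, Or.inl (by simp)⟩
      rw [pow_succ']
      exact hl _ (hk.right hs ht) (hr _ hk ih)
  have hneg : ∀ k : ℕ, p (((s * t) ^ (-(k : ℤ))) c₀) := by
    intro k
    induction k with
    | zero => exact h0
    | succ k ih =>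
      have hk : DihedralOrbit s t c₀ (((s * t) ^ (-(k : ℤ))) c₀) := ⟨-k, Or.inl rfl⟩
      have e : (s * t) ^ (-((k + 1 : ℕ) : ℤ)) = t * (s * (s * t) ^ (-(k : ℤ))) := by
        have hsi : s⁻¹ = s := inv_eq_of_mul_eq_one_left hs
        have hti : t⁻¹ = t := inv_eq_of_mul_eq_one_left ht
        rw [show -((k + 1 : ℕ) : ℤ) = -1 + -(k : ℤ) by push_cast; ring, zpow_add, zpow_neg_one,
          mul_inv_rev, hsi, hti, mul_assoc]
      rw [e]
      exact hr _ (hk.left hs) (hl _ hk ih)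
  have hall : ∀ k : ℤ, p (((s * t) ^ k) c₀) := by
    intro k
    obtain ⟨n, rfl | rfl⟩ := k.eq_nat_or_neg
    · simpa using hpos n
    · exact hneg n
  obtain ⟨k, rfl | rfl⟩ := h
  · exact hall k
  · exact hl _ ⟨k, Or.inl rfl⟩ (hall k)

variable {M : Type*} [Group M] (act : M → Y → Y)

theorem dihedralOrbit_symm (hs : s * s = 1) (ht : t * t = 1) {c d : Y}
    (h : DihedralOrbit s t c d) : DihedralOrbit s t d c := by
  refine DihedralOrbit.induction (p := fun x => DihedralOrbit s t x c) hs ht DihedralOrbit.self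
    ?_ ?_ h
  · intro x _ hx
    have h1 : DihedralOrbit s t (s x) (s (s x)) := DihedralOrbit.self.left hs
    have h2 : s (s x) = x := by change (s * s) x = x; rw [hs]; rfl
    rw [h2] at h1
    exact DihedralOrbit.induction (p := fun y => DihedralOrbit s t (s x) y) hs ht h1
      (fun _ _ h => h.left hs) (fun _ _ h => h.right hs ht) hx
  · intro x _ hx
    have h1 : DihedralOrbit s t (t x) (t (t x)) := DihedralOrbit.self.right hs ht
    have h2 : t (t x) = x := by change (t * t) x = x; rw [ht]; rfl
    rw [h2] at h1
    exact DihedralOrbit.induction (p := fun y => DihedralOrbit s t (t x) y) hs ht h1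
      (fun _ _ h => h.left hs) (fun _ _ h => h.right hs ht) hx

theorem DihedralOrbit.trans (hs : s * s = 1) (ht : t * t = 1) {c d e : Y}
    (h : DihedralOrbit s t c d) (h' : DihedralOrbit s t d e) : DihedralOrbit s t c e :=
  DihedralOrbit.induction (p := fun y => DihedralOrbit s t c y) hs ht h
      (fun _ _ h => h.left hs) (fun _ _ h => h.right hs ht) h'

theorem DihedralOrbit.map_act (hs : s * s = 1) (ht : t * t = 1)
    (hsa : ∀ g c, s (act g c) = act g (s c)) (hta : ∀ g c, t (act g c) = act g (t c)) {c d : Y}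
    (g : M) (h : DihedralOrbit s t c d) : DihedralOrbit s t (act g c) (act g d) := by
  refine DihedralOrbit.induction (p := fun y => DihedralOrbit s t (act g c) (act g y)) hs ht
    DihedralOrbit.self ?_ ?_ h
  · intro x _ hx; rw [← hsa]; exact hx.left hs
  · intro x _ hx; rw [← hta]; exact hx.right hs ht

/-- The stabilizer of an orbit of two involutions under a free action of a group without
involutions is cyclic. -/
theorem exists_zpowers_stabilizer (hs : s * s = 1) (ht : t * t = 1)
    (hone : ∀ c, act 1 c = c) (hmul : ∀ g h c, act (g * h) c = act g (act h c))
    (hfree : ∀ g c, act g c = c → g = 1)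
    (hsa : ∀ g c, s (act g c) = act g (s c)) (hta : ∀ g c, t (act g c) = act g (t c))
    (htf : ∀ g : M, g * g = 1 → g = 1) :
    ∃ z : M, ∀ g, DihedralOrbit s t c₀ (act g c₀) ↔ g ∈ Subgroup.zpowers z := by
  have hsta : ∀ g c, (s * t) (act g c) = act g ((s * t) c) := fun g c => by
    simp only [Equiv.Perm.mul_apply, hsa, hta]
  have hst' : ∀ g c, (s * t)⁻¹ (act g c) = act g ((s * t)⁻¹ c) := fun g c => by
    rw [Equiv.Perm.inv_eq_iff_eq, hsta, ← Equiv.Perm.mul_apply _ _⁻¹, mul_inv_cancel]; rfl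
  have hpow : ∀ (k : ℤ) g c, ((s * t) ^ k) (act g c) = act g (((s * t) ^ k) c) := by
    intro k
    induction k using Int.induction_on with
    | zero => intro g c; rfl
    | succ k ih =>
      intro g c
      rw [zpow_add_one, Equiv.Perm.mul_apply, hsta, ih]; rfl
    | pred k ih =>
      intro g c
      rw [zpow_sub_one, Equiv.Perm.mul_apply, hst', ih]; rfl
  let I : AddSubgroup ℤ :=
    { carrier := {k | ∃ g, act g c₀ = ((s * t) ^ k) c₀}
      zero_mem' := ⟨1, hone _⟩
      add_mem' := by
        rintro k l ⟨g, hg⟩ ⟨h, hh⟩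
        refine ⟨h * g, ?_⟩
        rw [hmul, hg, ← hpow, hh, zpow_add]; rfl
      neg_mem' := by
        rintro k ⟨g, hg⟩
        refine ⟨g⁻¹, ?_⟩
        have h1 : ((s * t) ^ (-k)) (act g c₀) = c₀ := by
          rw [hg, ← Equiv.Perm.mul_apply, ← zpow_add]; simp
        rw [hpow] at h1
        calc act g⁻¹ c₀ = act g⁻¹ (act g (((s * t) ^ (-k)) c₀)) := by rw [h1]
          _ = _ := by rw [← hmul, inv_mul_cancel, hone] }
  obtain ⟨k₀, hk₀⟩ := Int.subgroup_cyclic I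
  have hk₀I : k₀ ∈ I := hk₀ ▸ AddSubgroup.mem_closure_singleton_self k₀
  obtain ⟨z, hz⟩ := hk₀I
  have hzpow : ∀ m : ℤ, act (z ^ m) c₀ = ((s * t) ^ (m * k₀)) c₀ := by
    intro m
    induction m using Int.induction_on with
    | zero => simp [hone]
    | succ m ih =>
      rw [zpow_add_one, hmul, hz, ← hpow, ih, ← Equiv.Perm.mul_apply, ← zpow_add]
      congr 2; ring
    | pred m ih =>
      have h1 : ((s * t) ^ (-k₀)) (act z c₀) = c₀ := by
        rw [hz, ← Equiv.Perm.mul_apply, ← zpow_add]; simp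
      have h2 : act z⁻¹ c₀ = ((s * t) ^ (-k₀)) c₀ := by
        rw [hpow] at h1
        calc act z⁻¹ c₀ = act z⁻¹ (act z (((s * t) ^ (-k₀)) c₀)) := by rw [h1]
          _ = _ := by rw [← hmul, inv_mul_cancel, hone]
      rw [zpow_sub_one, hmul, h2, ← hpow, ih, ← Equiv.Perm.mul_apply, ← zpow_add]
      congr 2; ring
  refine ⟨z, fun g => ⟨?_, ?_⟩⟩
  · rintro ⟨k, hk | hk⟩
    · have : k ∈ I := ⟨g, hk⟩
      rw [hk₀, AddSubgroup.mem_closure_singleton] at this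
      obtain ⟨m, rfl⟩ := this
      refine ⟨m, ?_⟩
      have h3 : act (z ^ m) c₀ = act g c₀ := by rw [hzpow, hk, smul_eq_mul]
      have h4 := hfree ((z ^ m)⁻¹ * g) c₀ (by rw [hmul, ← h3, ← hmul, inv_mul_cancel, hone])
      exact (inv_mul_eq_one.1 h4)
    · have h5 : g * g = 1 := by
        refine hfree _ c₀ ?_
        rw [hmul]
        rw [show act g (act g c₀) = act g (s (((s * t) ^ k) c₀)) from congrArg _ hk]
        rw [← hsa, ← hpow, hk, ← Equiv.Perm.mul_apply, ← Equiv.Perm.mul_apply,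
          ← Equiv.Perm.mul_apply, dihedral_conj hs ht]
        rw [show (s * t) ^ (-k) * s * s * (s * t) ^ k = (s * t) ^ (-k) * (s * s) * (s * t) ^ k by
          group, hs, mul_one, ← zpow_add]
        simp
      rw [htf g h5]; exact Subgroup.one_mem _
  · rintro ⟨m, rfl⟩
    exact ⟨m * k₀, Or.inl (hzpow m)⟩

end Dihedral

/-! ### Square complexes with a group action -/

/-- A complex of edges and squares with an action of `M`: `side q d α` is the side of the square
`q` in direction `d` at level `α`, and `pt e β` are the two endpoints of `e`. -/
structure SqComplex (M V E Q : Type*) [Group M] [MulAction M V] [MulAction M E]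
    [MulAction M Q] where
  side : Q → Bool → Bool → E
  pt : E → Bool → V
  comm : ∀ q α β, pt (side q false α) β = pt (side q true β) α
  smul_side : ∀ (g : M) q d α, side (g • q) d α = g • side q d α
  smul_pt : ∀ (g : M) e β, pt (g • e) β = g • pt e β
  pt_ne : ∀ e, pt e false ≠ pt e true
  side_inj : ∀ q d α d' α', side q d α = side q d' α' → d = d' ∧ α = α'

namespace SqComplex

variable {M V E Q : Type*} [Group M] [MulAction M V] [MulAction M E] [MulAction M Q]
  (K : SqComplex M V E Q)

/-- Adjacency of vertices along the edges in `S`. -/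
def Adj (S : E → Prop) (x y : V) : Prop := ∃ e β, S e ∧ x = K.pt e β ∧ y = K.pt e (!β)

/-- `ZMod 2`-cochains on the edges in `ES` vanishing on the squares in `QS` are coboundaries. -/
def H1 (ES : E → Prop) (QS : Q → Prop) : Prop :=
  ∀ c : E → ZMod 2, (∀ q, QS q → c (K.side q false false) + c (K.side q false true) +
      (c (K.side q true false) + c (K.side q true true)) = 0) →
    ∃ h : V → ZMod 2, ∀ e, ES e → c e = h (K.pt e false) + h (K.pt e true)

variable {K}

theorem Adj.symm {S : E → Prop} {x y : V} (h : K.Adj S x y) : K.Adj S y x := by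
  obtain ⟨e, β, he, rfl, rfl⟩ := h
  exact ⟨e, !β, he, rfl, by rw [Bool.not_not]⟩

theorem pt_injective {e : E} {β β' : Bool} (h : K.pt e β = K.pt e β') : β = β' := by
  have := K.pt_ne e
  cases β <;> cases β' <;> first | rfl | exact absurd h this | exact absurd h.symm this

theorem Adj.smul {S : E → Prop} (hS : ∀ (g : M) e, S (g • e) ↔ S e) {x y : V} (g : M)
    (h : K.Adj S x y) : K.Adj S (g • x) (g • y) := by
  obtain ⟨e, β, he, rfl, rfl⟩ := h
  exact ⟨g • e, β, (hS g e).2 he, (K.smul_pt _ _ _).symm, (K.smul_pt _ _ _).symm⟩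

theorem rtg_adj_smul {S : E → Prop} (hS : ∀ (g : M) e, S (g • e) ↔ S e) {x y : V} (g : M)
    (h : Relation.ReflTransGen (K.Adj S) x y) :
    Relation.ReflTransGen (K.Adj S) (g • x) (g • y) := by
  induction h with
  | refl => exact .refl
  | tail _ h ih => exact ih.tail (h.smul hS g)

variable (K)

/-- Flags of a square complex: a square, one of its sides (direction and level) and an endpoint. -/
abbrev Flag (Q : Type*) : Type _ := Q × Bool × Bool × Bool

/-- The edge of a flag. -/
def fEdge (c : Flag Q) : E := K.side c.1 c.2.1 c.2.2.1

/-- The vertex of a flag. -/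
def fVert (c : Flag Q) : V := K.pt (K.fEdge c) c.2.2.2

/-- The action on flags. -/
def fAct (g : M) (c : Flag Q) : Flag Q := (g • c.1, c.2)

/-- Exchange the two sides of the square of a flag at its vertex. -/
def fSwap : Equiv.Perm (Flag Q) :=
  Function.Involutive.toPerm (fun c => (c.1, !c.2.1, c.2.2.2, c.2.2.1))
    (fun c => by simp)

theorem fSwap_mul_self : (fSwap : Equiv.Perm (Flag Q)) * fSwap = 1 :=
  Equiv.ext fun c => by
    obtain ⟨q, d, α, β⟩ := c
    change (q, !(!d), α, β) = _
    rw [Bool.not_not]; rfl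

theorem fVert_fSwap (c : Flag Q) : K.fVert (fSwap c) = K.fVert c := by
  obtain ⟨q, d, α, β⟩ := c
  cases d
  · exact (K.comm q α β).symm
  · exact K.comm q β α

theorem fEdge_fAct (g : M) (c : Flag Q) : K.fEdge (fAct g c) = g • K.fEdge c :=
  K.smul_side _ _ _ _

/-- Every edge of `ES` outside `DQ` lies in exactly two squares. -/
def TwoSided (ES DQ : E → Prop) (QS : Q → Prop) : Prop :=
  ∀ e, ES e → ¬ DQ e → ∃ x y : Q × Bool × Bool, x ≠ y ∧
    ∀ z, (QS z.1 ∧ K.side z.1 z.2.1 z.2.2 = e) ↔ z = x ∨ z = y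

variable {K}

/-- The involution on flags crossing two-sided edges and moving along the other ones. -/
structure IsTrackInvolution (K : SqComplex M V E Q) (DQ : E → Prop) (QS : Q → Prop)
    (t : Equiv.Perm (Flag Q)) : Prop where
  sq : t * t = 1
  act : ∀ (g : M) c, t (fAct g c) = fAct g (t c)
  along : ∀ c, QS c.1 → DQ (K.fEdge c) → t c = (c.1, c.2.1, c.2.2.1, !c.2.2.2)
  cross : ∀ c, QS c.1 → ¬ DQ (K.fEdge c) → QS (t c).1 ∧ K.fEdge (t c) = K.fEdge c ∧
        (t c).2.2.2 = c.2.2.2 ∧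
        ∀ z : Flag Q, QS z.1 → K.fEdge z = K.fEdge c → z.2.2.2 = c.2.2.2 → z = c ∨ z = t c

theorem exists_flag_involution {ES DQ : E → Prop} {QS : Q → Prop}
    (hDQ : ∀ (g : M) e, DQ (g • e) ↔ DQ e) (hQS : ∀ (g : M) q, QS (g • q) ↔ QS q)
    (hface : ∀ q d α, QS q → ES (K.side q d α)) (htwo : K.TwoSided ES DQ QS) :
    ∃ t, IsTrackInvolution K DQ QS t := by
  classical
  have hoth : ∀ x : Q × Bool × Bool, ∃ y : Q × Bool × Bool, QS x.1 →
      ¬ DQ (K.side x.1 x.2.1 x.2.2) → (QS y.1 ∧ K.side y.1 y.2.1 y.2.2 = K.side x.1 x.2.1 x.2.2 ∧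
      y ≠ x ∧ ∀ z : Q × Bool × Bool, QS z.1 → K.side z.1 z.2.1 z.2.2 = K.side x.1 x.2.1 x.2.2 →
        z = x ∨ z = y) := by
    intro x
    by_cases hq : QS x.1
    · by_cases hd : DQ (K.side x.1 x.2.1 x.2.2)
      · exact ⟨x, fun _ h => absurd hd h⟩
      · obtain ⟨a, b, hab, h⟩ := htwo _ (hface x.1 x.2.1 x.2.2 hq) hd
        rcases (h x).1 ⟨hq, rfl⟩ with hx | hx
        · have hb := (h b).2 (Or.inr rfl)
          refine ⟨b, fun _ _ => ⟨hb.1, hb.2, fun e => hab (hx ▸ e.symm), fun z hz1 hz2 => ?_⟩⟩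
          rw [hx]; exact (h z).1 ⟨hz1, hz2⟩
        · have ha := (h a).2 (Or.inl rfl)
          refine ⟨a, fun _ _ => ⟨ha.1, ha.2, fun e => hab (hx ▸ e), fun z hz1 hz2 => ?_⟩⟩
          rw [hx]; exact ((h z).1 ⟨hz1, hz2⟩).symm
    · exact ⟨x, fun h => absurd h hq⟩
  choose oth hoth using hoth
  let tf : Flag Q → Flag Q := fun c =>
    if QS c.1 then
      if DQ (K.fEdge c) then (c.1, c.2.1, c.2.2.1, !c.2.2.2)
      else ((oth (c.1, c.2.1, c.2.2.1)).1, (oth (c.1, c.2.1, c.2.2.1)).2.1,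
        (oth (c.1, c.2.1, c.2.2.1)).2.2, c.2.2.2)
    else c
  have t1 : ∀ c, QS c.1 → DQ (K.fEdge c) → tf c = (c.1, c.2.1, c.2.2.1, !c.2.2.2) := by
    intro c h1 h2; simp only [tf, if_pos h1, if_pos h2]
  have t2 : ∀ c, QS c.1 → ¬ DQ (K.fEdge c) → tf c = ((oth (c.1, c.2.1, c.2.2.1)).1,
      (oth (c.1, c.2.1, c.2.2.1)).2.1, (oth (c.1, c.2.1, c.2.2.1)).2.2, c.2.2.2) := by
    intro c h1 h2; simp only [tf, if_pos h1, if_neg h2]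
  have t3 : ∀ c, ¬ QS c.1 → tf c = c := by
    intro c h1; simp only [tf, if_neg h1]
  have t4 : ∀ c, QS c.1 → ¬ DQ (K.fEdge c) → QS (tf c).1 ∧ K.fEdge (tf c) = K.fEdge c ∧
        (tf c).2.2.2 = c.2.2.2 ∧ tf c ≠ c ∧
        ∀ z : Flag Q, QS z.1 → K.fEdge z = K.fEdge c → z.2.2.2 = c.2.2.2 →
          z = c ∨ z = tf c := by
    intro c h1 h2
    rw [t2 c h1 h2]
    obtain ⟨a1, a2, a3, a4⟩ := hoth (c.1, c.2.1, c.2.2.1) h1 h2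
    refine ⟨a1, a2, rfl, fun h => a3 ?_, fun z hz1 hz2 hz3 => ?_⟩
    · simp only [Prod.ext_iff] at h
      exact Prod.ext h.1 (Prod.ext h.2.1 h.2.2.1)
    · obtain ⟨q, d, α, β⟩ := z
      obtain ⟨q', d', α', β'⟩ := c
      have hz3' : β = β' := hz3
      subst hz3'
      rcases a4 (q, d, α) hz1 hz2 with h | h
      · left; simp only [Prod.mk.injEq] at h ⊢; tauto
      · right
        have h' := Prod.ext_iff.1 h
        simp only [Prod.ext_iff] at h ⊢
        simpa using h
  have hinv : Function.Involutive tf := by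
    intro c
    by_cases h1 : QS c.1
    · by_cases h2 : DQ (K.fEdge c)
      · rw [t1 c h1 h2, t1 (c.1, c.2.1, c.2.2.1, !c.2.2.2) h1 h2]; simp
      · obtain ⟨a1, a2, a3, a4, a5⟩ := t4 c h1 h2
        obtain ⟨b1, b2, b3, b4, b5⟩ := t4 (tf c) a1 (by rw [a2]; exact h2)
        rcases b5 c h1 a2.symm a3.symm with h | h
        · exact absurd h.symm a4
        · exact h.symm
    · rw [t3 c h1, t3 c h1]
  refine ⟨hinv.toPerm, Equiv.ext fun c => by simp [hinv c], ?_, t1, fun c h1 h2 => ?_⟩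
  · intro g c
    change tf _ = fAct g (tf c)
    by_cases h1 : QS c.1
    · have h1' : QS (fAct g c).1 := (hQS _ _).2 h1
      by_cases h2 : DQ (K.fEdge c)
      · rw [t1 c h1 h2, t1 _ h1' (by rw [fEdge_fAct]; exact (hDQ _ _).2 h2)]; rfl
      · have h2' : ¬ DQ (K.fEdge (fAct g c)) := by rw [fEdge_fAct, hDQ]; exact h2
        obtain ⟨a1, a2, a3, a4, a5⟩ := t4 c h1 h2
        obtain ⟨b1, b2, b3, b4, b5⟩ := t4 _ h1' h2'
        rcases b5 (fAct g (tf c)) ((hQS _ _).2 a1) (by rw [fEdge_fAct, fEdge_fAct, a2]) a3 with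
          h | h
        · refine absurd ?_ a4
          have h6 := Prod.ext_iff.1 h
          exact Prod.ext (smul_left_cancel g h6.1) h6.2
        · exact h.symm
    · rw [t3 c h1, t3]; exact fun h => h1 ((hQS _ _).1 h)
  · obtain ⟨a1, a2, a3, a4, a5⟩ := t4 c h1 h2
    exact ⟨a1, a2, a3, a5⟩

end SqComplex

namespace SqComplex

variable {M V E Q : Type*} [Group M] [MulAction M V] [MulAction M E] [MulAction M Q]
  {K : SqComplex M V E Q} {ES DQ : E → Prop} {QS : Q → Prop} {t : Equiv.Perm (Flag Q)}
  {c₀ : Flag Q}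

open scoped Classical in
/-- The `ZMod 2`-valued indicator of a proposition. -/
noncomputable def ind (p : Prop) : ZMod 2 := if p then 1 else 0

theorem ind_of {p : Prop} (h : p) : ind p = 1 := if_pos h

theorem ind_not {p : Prop} (h : ¬ p) : ind p = 0 := if_neg h

theorem ind_congr {p q : Prop} (h : p ↔ q) : ind p = ind q := by rw [propext h]

/-- The track through the flag `c₀`. -/
def Track (t : Equiv.Perm (Flag Q)) (c₀ c : Flag Q) : Prop := DihedralOrbit fSwap t c₀ c

namespace IsTrackInvolution

variable (ht : IsTrackInvolution K DQ QS t)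

include ht

omit ht [Group M] [MulAction M V] [MulAction M E] [MulAction M Q] in
theorem track_swap_iff {c : Flag Q} : Track t c₀ (fSwap c) ↔ Track t c₀ c := by
  refine ⟨fun h => ?_, fun h => h.left fSwap_mul_self⟩
  have := h.left fSwap_mul_self
  rwa [show fSwap (fSwap c) = c from DFunLike.congr_fun (fSwap_mul_self (Q := Q)) c] at this

theorem track_iff {c : Flag Q} : Track t c₀ (t c) ↔ Track t c₀ c := by
  refine ⟨fun h => ?_, fun h => h.right fSwap_mul_self ht.sq⟩
  have := h.right fSwap_mul_self ht.sq
  rwa [show t (t c) = c from DFunLike.congr_fun ht.sq c] at this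

theorem track_induction {p : Flag Q → Prop} (hq : QS c₀.1) (h0 : p c₀)
    (hs : ∀ c, Track t c₀ c → QS c.1 → p c → p (fSwap c))
    (ha : ∀ c, Track t c₀ c → QS c.1 → DQ (K.fEdge c) → p c →
      p (c.1, c.2.1, c.2.2.1, !c.2.2.2))
    (hx : ∀ c c', Track t c₀ c → QS c.1 → ¬ DQ (K.fEdge c) → QS c'.1 → K.fEdge c' = K.fEdge c →
      c'.2.2.2 = c.2.2.2 → p c → p c') {c : Flag Q} (h : Track t c₀ c) : QS c.1 ∧ p c := by
  refine DihedralOrbit.induction (p := fun c => QS c.1 ∧ p c) fSwap_mul_self ht.sq ⟨hq, h0⟩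
    (fun c h ih => ⟨ih.1, hs c h ih.1 ih.2⟩) (fun c h ih => ?_) h
  by_cases hd : DQ (K.fEdge c)
  · rw [ht.along c ih.1 hd]; exact ⟨ih.1, ha c h ih.1 hd ih.2⟩
  · obtain ⟨h1, h2, h3, -⟩ := ht.cross c ih.1 hd
    exact ⟨h1, hx c _ h ih.1 hd h1 h2 h3 ih.2⟩

theorem track_qs (hq : QS c₀.1) {c : Flag Q} (h : Track t c₀ c) : QS c.1 :=
  (ht.track_induction (p := fun _ => True) hq trivial (fun _ _ _ _ => trivial)
    (fun _ _ _ _ _ => trivial) (fun _ _ _ _ _ _ _ _ _ => trivial) h).1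

/-- Flags on the same side of a two-sided edge lie on the same tracks. -/
theorem track_congr {c c' : Flag Q} (hc : QS c.1) (hc' : QS c'.1) (hd : ¬ DQ (K.fEdge c))
    (he : K.fEdge c' = K.fEdge c) (hb : c'.2.2.2 = c.2.2.2) : Track t c₀ c' ↔ Track t c₀ c := by
  obtain ⟨h1, h2, h3, h4⟩ := ht.cross c hc hd
  rcases h4 c' hc' he hb with rfl | rfl
  · rfl
  · exact ht.track_iff

theorem track_along {q : Q} {d α β β' : Bool} (hq : QS q) (hd : DQ (K.side q d α)) :
    Track t c₀ (q, d, α, β) ↔ Track t c₀ (q, d, α, β') := by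
  by_cases h : β = β'
  · rw [h]
  · have h' : β' = !β := by revert h; cases β <;> cases β' <;> simp
    have := ht.along (q, d, α, β) hq hd
    rw [h', ← ht.track_iff (c := (q, d, α, β)), this]

omit ht in
/-- The half-edges crossed by a track. -/
def _root_.AclConstruct.SqComplex.HalfCrossed (K : SqComplex M V E Q) (DQ : E → Prop)
    (t : Equiv.Perm (Flag Q)) (c₀ : Flag Q) (e : E) (β : Bool) : Prop :=
  ¬ DQ e ∧ ∃ c, Track t c₀ c ∧ K.fEdge c = e ∧ c.2.2.2 = β

theorem halfCrossed_iff (hq : QS c₀.1) {c : Flag Q} (hc : QS c.1) :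
    HalfCrossed K DQ t c₀ (K.fEdge c) c.2.2.2 ↔ ¬ DQ (K.fEdge c) ∧ Track t c₀ c := by
  refine ⟨?_, fun h => ⟨h.1, c, h.2, rfl, rfl⟩⟩
  rintro ⟨h1, c', h2, h3, h4⟩
  exact ⟨h1, (ht.track_congr hc (ht.track_qs hq h2) h1 h3 h4).1 h2⟩

theorem exists_heights (hface : ∀ q d α, QS q → ES (K.side q d α)) (hH1 : K.H1 ES QS)
    (hq : QS c₀.1) :
    ∃ (hV : V → ZMod 2) (hE : E → ZMod 2) (hQ : Q → ZMod 2),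
      (∀ e β, ES e → hE e = hV (K.pt e β) + ind (HalfCrossed K DQ t c₀ e β)) ∧
      (∀ c, QS c.1 → hQ c.1 = hE (K.fEdge c) + ind (DQ (K.fEdge c) ∧ Track t c₀ c)) := by
  have two : (2 : ZMod 2) = 0 := rfl
  let r : Q → Bool → Bool → ZMod 2 := fun q d α =>
    ind (DQ (K.side q d α) ∧ Track t c₀ (q, d, α, false))
  have hr : ∀ q d α β, QS q → ind (DQ (K.side q d α) ∧ Track t c₀ (q, d, α, β)) = r q d α := by
    intro q d α β h
    refine ind_congr ?_
    constructor
    · rintro ⟨h1, h2⟩; exact ⟨h1, (ht.track_along h h1).1 h2⟩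
    · rintro ⟨h1, h2⟩; exact ⟨h1, (ht.track_along h h1).1 h2⟩
  have hw : ∀ q d α β, QS q → ind (HalfCrossed K DQ t c₀ (K.side q d α) β) =
      ind (Track t c₀ (q, d, α, β)) + r q d α := by
    intro q d α β h
    rw [← hr q d α β h]
    have := ht.halfCrossed_iff hq (c := (q, d, α, β)) h
    refine (ind_congr this).trans ?_
    change ind (¬ DQ (K.side q d α) ∧ _) = _
    by_cases h1 : DQ (K.side q d α)
    · by_cases h2 : Track t c₀ (q, d, α, β)
      · rw [ind_not (by tauto), ind_of h2, ind_of ⟨h1, h2⟩]; rfl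
      · rw [ind_not (by tauto), ind_not h2, ind_not (by tauto)]; rfl
    · by_cases h2 : Track t c₀ (q, d, α, β)
      · rw [ind_of ⟨h1, h2⟩, ind_of h2, ind_not (by tauto)]; rfl
      · rw [ind_not (by tauto), ind_not h2, ind_not (by tauto)]; rfl
  have hO : ∀ q α β, ind (Track t c₀ (q, true, β, α)) = ind (Track t c₀ (q, false, α, β)) :=
    fun q α β => ind_congr (track_swap_iff (c := (q, false, α, β)))
  obtain ⟨hV, hhV⟩ := hH1 (fun e => ind (HalfCrossed K DQ t c₀ e false) +
    ind (HalfCrossed K DQ t c₀ e true)) (by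
      intro q h
      simp only [hw q _ _ _ h, hO]
      linear_combination (ind (Track t c₀ (q, false, false, false)) +
        ind (Track t c₀ (q, false, false, true)) + ind (Track t c₀ (q, false, true, false)) +
        ind (Track t c₀ (q, false, true, true)) + r q false false + r q false true +
        r q true false + r q true true) * two)
  have hE1 : ∀ e β, ES e → hV (K.pt e false) + ind (HalfCrossed K DQ t c₀ e false) =
      hV (K.pt e β) + ind (HalfCrossed K DQ t c₀ e β) := by
    intro e β he
    have := hhV e he
    cases β
    · rfl
    · linear_combination this + (hV (K.pt e false) -
        ind (HalfCrossed K DQ t c₀ e true)) * two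
  refine ⟨hV, fun e => hV (K.pt e false) + ind (HalfCrossed K DQ t c₀ e false),
    fun q => hV (K.pt (K.side q false false) false) +
      ind (HalfCrossed K DQ t c₀ (K.side q false false) false) + r q false false,
    fun e β he => hE1 e β he, ?_⟩
  rintro ⟨q, d, α, β⟩ h
  change QS q at h
  have key : ∀ α β, hV (K.pt (K.side q false α) false) +
      ind (HalfCrossed K DQ t c₀ (K.side q false α) false) + r q false α =
      hV (K.pt (K.side q true β) false) +
      ind (HalfCrossed K DQ t c₀ (K.side q true β) false) + r q true β := by
    intro α β
    rw [hE1 _ β (hface q _ _ h), hE1 (K.side q true β) α (hface q _ _ h), hw _ _ _ _ h,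
      hw _ _ _ _ h, hO, K.comm]
    linear_combination (r q false α - r q true β) * two
  change _ = hV (K.pt (K.side q d α) false) + ind (HalfCrossed K DQ t c₀ (K.side q d α) false) +
    ind (DQ (K.side q d α) ∧ _)
  rw [hr q d α β h]
  cases d
  · exact (key false false).trans (key α false).symm
  · exact key false α

end IsTrackInvolution
end SqComplex
namespace SqComplex

variable {F : Type*} [Group F]
variable {M V E Q : Type*} [Group M] [MulAction M V] [MulAction M E] [MulAction M Q]
  {K : SqComplex M V E Q} {ES DQ : E → Prop} {QS : Q → Prop} {t : Equiv.Perm (Flag Q)}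
  {c₀ : Flag Q}

theorem IsTrackInvolution.near (ht : IsTrackInvolution K DQ QS t) (hq : QS c₀.1) {c : Flag Q}
    (h : Track t c₀ c) : Relation.ReflTransGen (K.Adj DQ) (K.fVert c₀) (K.fVert c) := by
  refine (ht.track_induction (p := fun c => Relation.ReflTransGen (K.Adj DQ) (K.fVert c₀)
    (K.fVert c)) hq .refl ?_ ?_ ?_ h).2
  · intro c _ _ h; rwa [fVert_fSwap]
  · intro c _ _ hd h
    exact h.tail ⟨K.fEdge c, c.2.2.2, hd, rfl, rfl⟩
  · intro c c' _ _ _ _ he hb h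
    have : K.fVert c' = K.fVert c := by unfold fVert; rw [he, hb]
    rwa [this]

theorem height_eq_of_rtg {hV : V → ZMod 2} {hE : E → ZMod 2} (hDE : ∀ e, DQ e → ES e)
    (h1 : ∀ e β, ES e → hE e = hV (K.pt e β) + ind (HalfCrossed K DQ t c₀ e β)) {x y : V}
    (h : Relation.ReflTransGen (K.Adj DQ) x y) : hV x = hV y := by
  induction h with
  | refl => rfl
  | tail _ h ih =>
    obtain ⟨e, β, he, rfl, rfl⟩ := h
    have e1 := h1 e β (hDE e he)
    have e2 := h1 e (!β) (hDE e he)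
    rw [ind_not (fun h => h.1 he), add_zero] at e1 e2
    rw [ih, ← e1, e2]

/-- The cover relation of the barycentric subdivision. -/
def Cov (K : SqComplex M V E Q) (ES : E → Prop) (QS : Q → Prop) : V ⊕ E ⊕ Q → V ⊕ E ⊕ Q → Prop
  | .inl v, .inr (.inl e) => ES e ∧ ∃ β, v = K.pt e β
  | .inr (.inl e), .inr (.inr q) => QS q ∧ ∃ d α, e = K.side q d α
  | _, _ => False

/-- Adjacency in the barycentric subdivision. -/
def Bary (K : SqComplex M V E Q) (ES : E → Prop) (QS : Q → Prop) (x y : V ⊕ E ⊕ Q) : Prop :=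
  Cov K ES QS x y ∨ Cov K ES QS y x

/-- The pairs of the barycentric subdivision crossed by a track. -/
def TrackWall (K : SqComplex M V E Q) (DQ : E → Prop) (t : Equiv.Perm (Flag Q)) (c₀ : Flag Q) :
    V ⊕ E ⊕ Q → V ⊕ E ⊕ Q → Prop
  | .inl v, .inr (.inl e) => ∃ β, v = K.pt e β ∧ HalfCrossed K DQ t c₀ e β
  | .inr (.inl e), .inr (.inr q) => DQ e ∧ ∃ c, Track t c₀ c ∧ K.fEdge c = e ∧ c.1 = q
  | _, _ => False

theorem rtg_bary_of_adj {S : E → Prop} {R : V ⊕ E ⊕ Q → V ⊕ E ⊕ Q → Prop}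
    (hR : ∀ e β, S e → R (.inl (K.pt e β)) (.inr (.inl e)) ∧ R (.inr (.inl e)) (.inl (K.pt e β)))
    {x y : V} (h : Relation.ReflTransGen (K.Adj S) x y) :
    Relation.ReflTransGen R (.inl x) (.inl y) := by
  induction h with
  | refl => exact .refl
  | tail _ h ih =>
    obtain ⟨e, β, he, rfl, rfl⟩ := h
    exact (ih.tail (hR e β he).1).tail (hR e (!β) he).2

theorem Cov.smul (hES : ∀ (g : M) e, ES (g • e) ↔ ES e)
    (hQS : ∀ (g : M) q, QS (g • q) ↔ QS q) (g : M) :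
    ∀ x y, Cov K ES QS x y → Cov K ES QS (g • x) (g • y)
  | .inl v, .inr (.inl e), ⟨h, β, hv⟩ =>
    ⟨(hES g e).2 h, β, by rw [hv]; exact (K.smul_pt g e β).symm⟩
  | .inr (.inl e), .inr (.inr q), ⟨h, d, α, he⟩ =>
    ⟨(hQS g q).2 h, d, α, by rw [he]; exact (K.smul_side g q d α).symm⟩
  | .inl _, .inl _, h => h.elim
  | .inl _, .inr (.inr _), h => h.elim
  | .inr (.inl _), .inl _, h => h.elim
  | .inr (.inl _), .inr (.inl _), h => h.elim
  | .inr (.inr _), _, h => h.elim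

theorem exists_stepOver_of_track_heights (j : M →* F) (hj : Function.Injective j)
    (hES : ∀ (g : M) e, ES (g • e) ↔ ES e)
    (hDQ : ∀ (g : M) e, DQ (g • e) ↔ DQ e) (hQS : ∀ (g : M) q, QS (g • q) ↔ QS q)
    (hface : ∀ q d α, QS q → ES (K.side q d α)) (hDE : ∀ e, DQ e → ES e)
    (hfree : ∀ (g : M) (q : Q), g • q = q → g = 1) (htf : ∀ g : M, g * g = 1 → g = 1)
    (ht : IsTrackInvolution K DQ QS t) (hq : QS c₀.1) (hd₀ : ¬ DQ (K.fEdge c₀))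
    (hconn : ∀ g : M, Relation.ReflTransGen (K.Adj ES) (K.fVert c₀) (g • K.fVert c₀))
    {hV : V → ZMod 2} {hE : E → ZMod 2} {hQ : Q → ZMod 2}
    (h1 : ∀ e β, ES e → hE e = hV (K.pt e β) + ind (HalfCrossed K DQ t c₀ e β))
    (h2 : ∀ c, QS c.1 → hQ c.1 = hE (K.fEdge c) + ind (DQ (K.fEdge c) ∧ Track t c₀ c)) :
    ∃ (c : M) (P : Subgroup M), StepOver (j c) (P.map j) j.range ∧
      (∀ g : M, Relation.ReflTransGen (K.Adj DQ) (K.fVert c₀) (g • K.fVert c₀) → g ∈ P) ∧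
      ∀ g ∈ P, hV (g • K.fVert c₀) = hV (K.fVert c₀) := by
  set v₀ := K.fVert c₀ with hv₀
  set e₀ := K.fEdge c₀ with he₀
  have hone01 : ∀ x : ZMod 2, x + 1 ≠ x := by decide
  let act : M → Flag Q → Flag Q := fAct
  have hsa : ∀ (g : M) (c : Flag Q), fSwap (act g c) = act g (fSwap c) := fun _ _ => rfl
  -- translates of tracks
  have htrans : ∀ (g : M) (c : Flag Q), Track t c₀ c → Track t c₀ (fAct g c) →
      ∀ c', Track t c₀ c' → Track t c₀ (fAct g c') := by
    intro g c hc hgc c' hc'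
    have h3 : DihedralOrbit fSwap t c c' :=
      (dihedralOrbit_symm fSwap_mul_self ht.sq hc).trans fSwap_mul_self ht.sq hc'
    exact DihedralOrbit.trans fSwap_mul_self ht.sq hgc
      (DihedralOrbit.map_act act fSwap_mul_self ht.sq hsa ht.act g h3)
  have hqs : ∀ c, Track t c₀ c → QS c.1 := fun c hc => ht.track_qs hq hc
  -- half edges crossed by two translates
  have hve : ∀ (g : M) c c', Track t c₀ c → Track t c₀ c' → ¬ DQ (K.fEdge c) →
      K.fEdge c' = g • K.fEdge c → K.fVert c' = g • K.fVert c → Track t c₀ (fAct g c) := by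
    intro g c c' hc hc' hd he hv
    have hb : c'.2.2.2 = (fAct g c).2.2.2 := by
      unfold fVert at hv
      rw [he, ← K.smul_pt] at hv
      exact pt_injective hv
    refine (ht.track_congr (hqs c' hc') ((hQS g _).2 (hqs c hc)) ?_ ?_ hb.symm).2 hc'
    · rw [he, hDQ]; exact hd
    · rw [fEdge_fAct, he]
  let Φ := TrackWall K DQ t c₀
  let H : V ⊕ E ⊕ Q → Prop := fun x => Sum.elim (fun v => hV v ≠ hV v₀)
    (Sum.elim (fun e => hE e ≠ hV v₀) (fun q => hQ q ≠ hV v₀)) x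
  have hnearV : ∀ c, Track t c₀ c → hV (K.fVert c) = hV v₀ := fun c hc =>
    (height_eq_of_rtg hDE h1 (ht.near hq hc)).symm
  have hwall : ∀ e β, HalfCrossed K DQ t c₀ e β → ES e ∧ hV (K.pt e β) = hV v₀ ∧
      hE e = hV v₀ + 1 := by
    rintro e β hw
    obtain ⟨-, c, hc, rfl, rfl⟩ := id hw
    have hes : ES (K.fEdge c) := hface _ _ _ (hqs c hc)
    have h3 := hnearV c hc
    refine ⟨hes, h3, ?_⟩
    rw [h1 _ _ hes, ind_of hw]; exact congrArg (· + 1) h3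
  have hwall2 : ∀ c, Track t c₀ c → DQ (K.fEdge c) → hE (K.fEdge c) = hV v₀ ∧
      hQ c.1 = hV v₀ + 1 := by
    intro c hc hd
    have e1 := h1 (K.fEdge c) c.2.2.2 (hface _ _ _ (hqs c hc))
    rw [ind_not (fun h => h.1 hd), add_zero] at e1
    have e2 := h2 c (hqs c hc)
    rw [ind_of ⟨hd, hc⟩] at e2
    have := hnearV c hc
    exact ⟨e1.trans this, by rw [e2, e1]; exact congrArg (· + 1) this⟩
  have hU1 : ∀ e β, DQ e → Uncrossed M (Bary K ES QS) Φ (.inl (K.pt e β)) (.inr (.inl e)) ∧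
      Uncrossed M (Bary K ES QS) Φ (.inr (.inl e)) (.inl (K.pt e β)) := by
    intro e β hd
    have h3 : ∀ g : M, ¬ Φ (g • .inl (K.pt e β)) (g • .inr (.inl e)) := by
      rintro g ⟨β', -, hw⟩
      exact hw.1 ((hDQ g e).2 hd)
    exact ⟨⟨Or.inl ⟨hDE e hd, β, rfl⟩, fun g => ⟨h3 g, fun h => h.elim⟩⟩,
      ⟨Or.inr ⟨hDE e hd, β, rfl⟩, fun g => ⟨fun h => h.elim, h3 g⟩⟩⟩
  have hU2 : ∀ c, QS c.1 → ¬ DQ (K.fEdge c) →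
      Uncrossed M (Bary K ES QS) Φ (.inr (.inl (K.fEdge c))) (.inr (.inr c.1)) ∧
      Uncrossed M (Bary K ES QS) Φ (.inr (.inr c.1)) (.inr (.inl (K.fEdge c))) := by
    intro c hc hd
    have h3 : ∀ g : M, ¬ Φ (g • .inr (.inl (K.fEdge c))) (g • .inr (.inr c.1)) := by
      rintro g ⟨hw, -⟩
      exact hd ((hDQ g _).1 hw)
    exact ⟨⟨Or.inl ⟨hc, _, _, rfl⟩, fun g => ⟨h3 g, fun h => h.elim⟩⟩,
      ⟨Or.inr ⟨hc, _, _, rfl⟩, fun g => ⟨fun h => h.elim, h3 g⟩⟩⟩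
  have hfar : ∀ c, Track t c₀ c →
      (¬ DQ (K.fEdge c) → Relation.ReflTransGen (Uncrossed M (Bary K ES QS) Φ) (.inr (.inl e₀))
        (.inr (.inl (K.fEdge c)))) ∧
      (DQ (K.fEdge c) → Relation.ReflTransGen (Uncrossed M (Bary K ES QS) Φ) (.inr (.inl e₀))
        (.inr (.inr c.1))) := by
    intro c hc
    refine (ht.track_induction (p := fun c =>
      (¬ DQ (K.fEdge c) → Relation.ReflTransGen (Uncrossed M (Bary K ES QS) Φ) (.inr (.inl e₀))
        (.inr (.inl (K.fEdge c)))) ∧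
      (DQ (K.fEdge c) → Relation.ReflTransGen (Uncrossed M (Bary K ES QS) Φ) (.inr (.inl e₀))
        (.inr (.inr c.1)))) hq ⟨fun _ => .refl, fun h => absurd h hd₀⟩ ?_ ?_ ?_ hc).2
    · intro c hc hqc ih
      have hb : Relation.ReflTransGen (Uncrossed M (Bary K ES QS) Φ) (.inr (.inl e₀))
          (.inr (.inr c.1)) := by
        by_cases hd : DQ (K.fEdge c)
        · exact ih.2 hd
        · exact (ih.1 hd).tail (hU2 c hqc hd).1
      exact ⟨fun hd => hb.tail (hU2 (fSwap c) hqc hd).2, fun _ => hb⟩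
    · intro c hc hqc hd ih
      exact ih
    · intro c c' hc hqc hd hqc' he hb ih
      rw [he]
      exact ⟨ih.1, fun h => absurd h hd⟩
  obtain ⟨z, hz⟩ := exists_zpowers_stabilizer (c₀ := c₀) act fSwap_mul_self ht.sq
    (fun c => Prod.ext (one_smul M c.1) rfl) (fun g h c => Prod.ext (mul_smul g h c.1) rfl)
    (fun g c h => hfree g c.1 (Prod.ext_iff.1 h).1) hsa ht.act htf
  have hself : HalfCrossed K DQ t c₀ e₀ c₀.2.2.2 := ⟨hd₀, c₀, DihedralOrbit.self, rfl, rfl⟩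
  have hΦ : ∀ x y, Φ x y → Bary K ES QS x y ∧ ¬ H x ∧ H y := by
    rintro (v | e | q) (v' | e' | q') h
    · exact h.elim
    · obtain ⟨β, rfl, hw⟩ := h
      obtain ⟨a1, a2, a3⟩ := hwall _ _ hw
      exact ⟨Or.inl ⟨a1, β, rfl⟩, fun h => h a2, fun h => hone01 _ (a3.symm.trans h)⟩
    · exact h.elim
    · exact h.elim
    · exact h.elim
    · obtain ⟨hd, c, hc, rfl, rfl⟩ := h
      obtain ⟨a2, a3⟩ := hwall2 c hc hd
      exact ⟨Or.inl ⟨hqs c hc, _, _, rfl⟩, fun h => h a2, fun h => hone01 _ (a3.symm.trans h)⟩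
    · exact h.elim
    · exact h.elim
    · exact h.elim
  have hcov : ∀ x y, Cov K ES QS x y → ((H x ↔ H y) ∨ Φ x y) := by
    rintro (v | e | q) (v' | e' | q') h
    · exact h.elim
    · obtain ⟨h, β, rfl⟩ := h
      by_cases hw : HalfCrossed K DQ t c₀ e' β
      · exact Or.inr ⟨β, rfl, hw⟩
      · have := h1 e' β h
        rw [ind_not hw, add_zero] at this
        exact Or.inl (not_congr (by rw [this]))
    · exact h.elim
    · exact h.elim
    · exact h.elim
    · obtain ⟨h, d, α, rfl⟩ := h
      by_cases hw : DQ (K.side q' d α) ∧ Track t c₀ (q', d, α, false)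
      · exact Or.inr ⟨hw.1, _, hw.2, rfl, rfl⟩
      · have : hQ q' = hE (K.side q' d α) + ind (DQ (K.side q' d α) ∧
            Track t c₀ (q', d, α, false)) := h2 (q', d, α, false) h
        rw [ind_not hw, add_zero] at this
        exact Or.inl (not_congr (by rw [this]))
    · exact h.elim
    · exact h.elim
    · exact h.elim
  have hΦtype : ∀ (g : M) x y, Φ x y → ¬ Φ (g • y) (g • x) := by
    rintro g (v | e | q) (v' | e' | q') h h' <;> first | exact h.elim | exact h'.elim
  have hH : ∀ x y, Bary K ES QS x y → ¬ H x → H y → Φ x y := by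
    rintro x y (h | h) hx hy
    · rcases hcov x y h with h' | h'
      · exact absurd (h'.2 hy) hx
      · exact h'
    · rcases hcov y x h with h' | h'
      · exact absurd (h'.1 hy) hx
      · exact absurd hy (hΦ _ _ h').2.1
  have hdisj : ∀ (g : M) x y, Φ x y → Φ (g • x) (g • y) →
      ∀ x' y', Φ x' y' → Φ (g • x') (g • y') := by
    intro g x y h h'
    have key : ∃ c, Track t c₀ c ∧ Track t c₀ (fAct g c) := by
      rcases x with (v | e | q) <;> rcases y with (v' | e' | q')
      · exact h.elim
      · obtain ⟨β, rfl, hd, c, hc, rfl, rfl⟩ := h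
        obtain ⟨β', hv, -, c', hc', he, hb⟩ := h'
        refine ⟨c, hc, hve g c c' hc hc' hd he ?_⟩
        unfold fVert; rw [he, hb]; exact hv.symm
      · exact h.elim
      · exact h.elim
      · exact h.elim
      · obtain ⟨hd, c, hc, rfl, rfl⟩ := h
        obtain ⟨-, c', hc', he, hb⟩ := h'
        refine ⟨c, hc, ?_⟩
        obtain ⟨q', d', α', β'⟩ := c'
        obtain ⟨q, d, α, β⟩ := c
        obtain rfl : q' = g • q := hb
        have he' : K.side (g • q) d' α' = K.side (g • q) d α := by
          rw [K.smul_side g q d α]; exact he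
        obtain ⟨rfl, rfl⟩ := K.side_inj _ _ _ _ _ he'
        exact (ht.track_along ((hQS g q).2 (hqs _ hc)) (by
          rw [K.smul_side]; exact (hDQ _ _).2 hd)).1 hc'
      · exact h.elim
      · exact h.elim
      · exact h.elim
    obtain ⟨c, hc, hgc⟩ := key
    rintro (v | e | q) (v' | e' | q') h
    · exact h.elim
    · obtain ⟨β, rfl, hd, c', hc', rfl, rfl⟩ := h
      exact ⟨c'.2.2.2, (K.smul_pt _ _ _).symm, fun h => hd ((hDQ _ _).1 h), fAct g c',
        htrans g c hc hgc c' hc', K.fEdge_fAct _ _, rfl⟩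
    · exact h.elim
    · exact h.elim
    · exact h.elim
    · obtain ⟨hd, c', hc', rfl, rfl⟩ := h
      exact ⟨(hDQ _ _).2 hd, fAct g c', htrans g c hc hgc c' hc', K.fEdge_fAct _ _, rfl⟩
    · exact h.elim
    · exact h.elim
    · exact h.elim
  have hconn' : ∀ g : M, Relation.ReflTransGen (Bary K ES QS) (.inl v₀)
      (g • (.inl v₀ : V ⊕ E ⊕ Q)) := fun g =>
    rtg_bary_of_adj (fun e β he => ⟨Or.inl ⟨he, β, rfl⟩, Or.inr ⟨he, β, rfl⟩⟩) (hconn g)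
  have hnear : ∀ x y, Φ x y →
      Relation.ReflTransGen (Uncrossed M (Bary K ES QS) Φ) (.inl v₀) x ∧
      Relation.ReflTransGen (Uncrossed M (Bary K ES QS) Φ) (.inr (.inl e₀)) y := by
    rintro (v | e | q) (v' | e' | q') h
    · exact h.elim
    · obtain ⟨β, rfl, hd, c, hc, rfl, rfl⟩ := h
      exact ⟨rtg_bary_of_adj hU1 (ht.near hq hc), (hfar c hc).1 hd⟩
    · exact h.elim
    · exact h.elim
    · exact h.elim
    · obtain ⟨hd, c, hc, rfl, rfl⟩ := h
      exact ⟨(rtg_bary_of_adj hU1 (ht.near hq hc)).tail (hU1 _ _ hd).1, (hfar c hc).2 hd⟩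
    · exact h.elim
    · exact h.elim
    · exact h.elim
  have hc : ∀ g : M, Φ (g • (.inl v₀)) (g • (.inr (.inl e₀))) ↔ g ∈ Subgroup.zpowers z := by
    intro g
    rw [← hz g]
    constructor
    · rintro ⟨β, hv, -, c', hc', he, hb⟩
      refine hve g c₀ c' DihedralOrbit.self hc' hd₀ he ?_
      unfold fVert; rw [he, hb]; exact hv.symm
    · intro h
      exact ⟨c₀.2.2.2, (K.smul_pt _ _ _).symm, fun h => hd₀ ((hDQ _ _).1 h), fAct g c₀, h,
        K.fEdge_fAct _ _, rfl⟩
  obtain ⟨P, hP, hstep⟩ := exists_stepOver_of_wall j hj (Bary K ES QS) Φ H (.inl v₀)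
    (.inr (.inl e₀)) z (fun x y h => h.symm)
    (fun g x y h => h.imp (Cov.smul hES hQS g x y) (Cov.smul hES hQS g y x))
    ⟨c₀.2.2.2, rfl, hself⟩ hΦ hH hdisj hΦtype hconn' hnear hc
  refine ⟨z, P, hstep, fun g hg => (hP g).2 (rtg_bary_of_adj hU1 hg), fun g hg => ?_⟩
  have hHeq : ∀ x y, Relation.ReflTransGen (Uncrossed M (Bary K ES QS) Φ) x y →
      (H x ↔ H y) := by
    intro x y h
    induction h with
    | refl => rfl
    | tail _ h ih =>
      rename_i y z _
      refine ih.trans ⟨fun hy => ?_, fun hz => ?_⟩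
      · by_contra hz
        exact (h.2 1).2 (by simpa only [one_smul] using hH _ _ h.1.symm hz hy)
      · by_contra hy
        exact (h.2 1).1 (by simpa only [one_smul] using hH _ _ h.1 hy hz)
  have := (hHeq _ _ ((hP g).1 hg))
  by_contra hne
  exact (this.2 hne) rfl

end SqComplex
namespace SqComplex

variable {F : Type*} [Group F]
variable {M V E Q : Type*} [Group M] [MulAction M V] [MulAction M E] [MulAction M Q]
  {K : SqComplex M V E Q} {ES DQ : E → Prop} {QS : Q → Prop}

theorem rtg_adj_mono {S S' : E → Prop} (h : ∀ e, S e → S' e) {x y : V}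
    (hxy : Relation.ReflTransGen (K.Adj S) x y) : Relation.ReflTransGen (K.Adj S') x y := by
  induction hxy with
  | refl => exact .refl
  | tail _ h' ih =>
    obtain ⟨e, β, he, h1, h2⟩ := h'
    exact ih.tail ⟨e, β, h e he, h1, h2⟩

theorem rtg_adj_symm {S : E → Prop} {x y : V} (h : Relation.ReflTransGen (K.Adj S) x y) :
    Relation.ReflTransGen (K.Adj S) y x :=
  rtg_symm (fun _ _ h => h.symm) h

/-- If the edges of `ES` outside `DQ` are two-sided and `DQ` does not connect the orbit of `x₀`,
then some track yields a splitting over a cyclic subgroup. -/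
theorem exists_stepOver_of_track (j : M →* F) (hj : Function.Injective j)
    (hES : ∀ (g : M) e, ES (g • e) ↔ ES e)
    (hDQ : ∀ (g : M) e, DQ (g • e) ↔ DQ e) (hQS : ∀ (g : M) q, QS (g • q) ↔ QS q)
    (hface : ∀ q d α, QS q → ES (K.side q d α)) (hDE : ∀ e, DQ e → ES e)
    (hfree : ∀ (g : M) (q : Q), g • q = q → g = 1) (htf : ∀ g : M, g * g = 1 → g = 1)
    (htwo : K.TwoSided ES DQ QS) (hH1 : K.H1 ES QS) (x₀ : V)
    (hconn : ∀ g : M, Relation.ReflTransGen (K.Adj ES) x₀ (g • x₀)) (g₀ : M)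
    (hg₀ : ¬ Relation.ReflTransGen (K.Adj DQ) x₀ (g₀ • x₀)) :
    ∃ (c : M) (P : Subgroup M), StepOver (j c) (P.map j) j.range ∧ P ≠ ⊤ ∧
      ∀ g : M, Relation.ReflTransGen (K.Adj DQ) x₀ (g • x₀) → g ∈ P := by
  obtain ⟨t, ht⟩ := exists_flag_involution hDQ hQS hface htwo
  have key : ∀ y, Relation.ReflTransGen (K.Adj ES) x₀ y →
      Relation.ReflTransGen (K.Adj DQ) x₀ y ∨
      ∃ (c₀ : Flag Q) (hV : V → ZMod 2) (hE : E → ZMod 2) (hQ : Q → ZMod 2),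
        QS c₀.1 ∧ ¬ DQ (K.fEdge c₀) ∧ Relation.ReflTransGen (K.Adj DQ) x₀ (K.fVert c₀) ∧
        (∀ e β, ES e → hE e = hV (K.pt e β) + ind (HalfCrossed K DQ t c₀ e β)) ∧
        (∀ c, QS c.1 → hQ c.1 = hE (K.fEdge c) + ind (DQ (K.fEdge c) ∧ Track t c₀ c)) ∧
        hV y ≠ hV (K.fVert c₀) := by
    intro y h
    induction h with
    | refl => exact Or.inl .refl
    | tail _ h ih =>
      obtain ⟨e, β, he, rfl, rfl⟩ := h
      rcases ih with ih | ⟨c₀, hV, hE, hQ, hq, hd, hx, h1, h2, h3⟩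
      · by_cases hd : DQ e
        · exact Or.inl (ih.tail ⟨e, β, hd, rfl, rfl⟩)
        · obtain ⟨x, _, -, hx⟩ := htwo e he hd
          obtain ⟨hq, hs⟩ := (hx x).2 (Or.inl rfl)
          let c₀ : Flag Q := (x.1, x.2.1, x.2.2, β)
          have hce : K.fEdge c₀ = e := hs
          have hcv : K.fVert c₀ = K.pt e β := by unfold fVert; rw [hce]
          obtain ⟨hV, hE, hQ, h1, h2⟩ := ht.exists_heights (c₀ := c₀) hface hH1 hq
          have e1 := h1 e β he
          rw [ind_of ⟨hd, c₀, DihedralOrbit.self, hce, rfl⟩] at e1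
          have e2 := h1 e (!β) he
          by_cases hw : HalfCrossed K DQ t c₀ e (!β)
          · obtain ⟨-, c, hc, h4, h5⟩ := hw
            have := ht.near hq hc
            rw [hcv] at this
            refine Or.inl (ih.trans ?_)
            rwa [show K.fVert c = K.pt e (!β) by unfold fVert; rw [h4, h5] ] at this
          · rw [ind_not hw, add_zero] at e2
            refine Or.inr ⟨c₀, hV, hE, hQ, hq, hce ▸ hd, hcv ▸ ih, h1, h2, ?_⟩
            rw [hcv, ← e2, e1]
            generalize hV (K.pt e β) = x
            revert x; decide
      · by_cases hy : hV (K.pt e (!β)) = hV (K.fVert c₀)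
        · have e1 := h1 e β he
          have e2 := h1 e (!β) he
          by_cases hw : HalfCrossed K DQ t c₀ e (!β)
          · obtain ⟨-, c, hc, h4, h5⟩ := hw
            have := ht.near hq hc
            refine Or.inl (hx.trans ?_)
            rwa [show K.fVert c = K.pt e (!β) by unfold fVert; rw [h4, h5] ] at this
          · exfalso
            by_cases hw' : HalfCrossed K DQ t c₀ e β
            · obtain ⟨-, c, hc, h4, h5⟩ := hw'
              have := height_eq_of_rtg hDE h1 (ht.near hq hc)
              rw [show K.fVert c = K.pt e β by unfold fVert; rw [h4, h5] ] at this
              exact h3 this.symm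
            · rw [ind_not hw, add_zero] at e2
              rw [ind_not hw', add_zero] at e1
              exact h3 (by rw [← hy, ← e1, e2])
        · exact Or.inr ⟨c₀, hV, hE, hQ, hq, hd, hx, h1, h2, hy⟩
  rcases key _ (hconn g₀) with h | ⟨c₀, hV, hE, hQ, hq, hd, hx, h1, h2, h3⟩
  · exact absurd h hg₀
  · have hxg := fun g : M => rtg_adj_smul hDQ g hx
    have hx' := rtg_adj_symm hx
    obtain ⟨c, P, hs, hP, hP'⟩ := exists_stepOver_of_track_heights j hj hES hDQ hQS hface hDE hfree
      htf ht hq hd (fun g => ((rtg_adj_mono hDE hx').trans (hconn g)).trans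
        (rtg_adj_mono hDE (hxg g))) h1 h2
    refine ⟨c, P, hs, ?_, fun g hg => hP g ((hx'.trans hg).trans (hxg g))⟩
    rintro rfl
    exact h3 ((height_eq_of_rtg hDE h1 (hxg g₀)).trans (hP' g₀ trivial))

end SqComplex
namespace SqComplex

variable {F : Type*} [Group F]
variable {M V E Q : Type*} [Group M] [MulAction M V] [MulAction M E] [MulAction M Q]

section Full

variable (K : SqComplex M V E Q)

/-- The squares with all sides in `ES`. -/
def Full (ES : E → Prop) (q : Q) : Prop := ∀ d α, ES (K.side q d α)

/-- `x` is an occurrence of `e` as a side of a full square. -/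
def Dart (ES : E → Prop) (e : E) (x : Q × Bool × Bool) : Prop :=
  K.Full ES x.1 ∧ K.side x.1 x.2.1 x.2.2 = e

/-- Invariant sets of edges containing `Z` that span connected complexes with trivial first
cohomology. -/
structure IsCore (Z ES : E → Prop) (x₀ : V) : Prop where
  inv : ∀ (g : M) e, ES (g • e) ↔ ES e
  sub : ∀ e, Z e → ES e
  conn : ∀ g : M, Relation.ReflTransGen (K.Adj ES) x₀ (g • x₀)
  reach : ∀ e β, ES e → Relation.ReflTransGen (K.Adj ES) x₀ (K.pt e β)
  h1 : K.H1 ES (K.Full ES)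

end Full

variable {K : SqComplex M V E Q} {Z ES : E → Prop} {x₀ : V}

theorem full_smul (hES : ∀ (g : M) e, ES (g • e) ↔ ES e) (g : M) (q : Q) :
    K.Full ES (g • q) ↔ K.Full ES q :=
  forall_congr' fun d => forall_congr' fun α => by rw [K.smul_side, hES]

theorem dart_smul (hES : ∀ (g : M) e, ES (g • e) ↔ ES e) (g : M) {e : E} {x : Q × Bool × Bool}
    (h : K.Dart ES e x) : K.Dart ES (g • e) (g • x.1, x.2) :=
  ⟨(full_smul hES g _).2 h.1, by rw [K.smul_side]; exact congrArg _ h.2⟩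

/-- The opposite corners of a square are joined by its other three sides. -/
theorem rtg_adj_around {S : E → Prop} (q : Q) (d α : Bool)
    (h : ∀ d' α', (d', α') ≠ (d, α) → S (K.side q d' α')) (β : Bool) :
    Relation.ReflTransGen (K.Adj S) (K.pt (K.side q d α) β) (K.pt (K.side q d α) (!β)) := by
  have hcomm : ∀ d α β, K.pt (K.side q d α) β = K.pt (K.side q (!d) β) α := by
    intro d α β
    cases d
    · exact K.comm q α β
    · exact (K.comm q β α).symm
  have s1 : S (K.side q (!d) β) := h _ _ (by cases d <;> simp)
  have s2 : S (K.side q d (!α)) := h _ _ (by cases α <;> simp)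
  have s3 : S (K.side q (!d) (!β)) := h _ _ (by cases d <;> simp)
  have a1 : K.Adj S (K.pt (K.side q d α) β) (K.pt (K.side q (!d) β) (!α)) :=
    ⟨_, α, s1, hcomm d α β, rfl⟩
  have a2 : K.Adj S (K.pt (K.side q (!d) β) (!α)) (K.pt (K.side q d (!α)) (!β)) :=
    ⟨_, β, s2, (hcomm d (!α) β).symm, rfl⟩
  have a3 : K.Adj S (K.pt (K.side q d (!α)) (!β)) (K.pt (K.side q d α) (!β)) :=
    ⟨_, !α, s3, hcomm d (!α) (!β), by rw [Bool.not_not]; exact hcomm d α (!β)⟩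
  exact ((Relation.ReflTransGen.single a1).tail a2).tail a3

theorem IsCore.collapse (hZ : ∀ (g : M) e, Z (g • e) ↔ Z e) (h : K.IsCore Z ES x₀) {e₀ : E} (hz : ¬ Z e₀)
    {x : Q × Bool × Bool} (hx : ∀ y, K.Dart ES e₀ y ↔ y = x) :
    K.IsCore Z (fun e => ES e ∧ ∀ g : M, e ≠ g • e₀) x₀ := by
  classical
  set S : E → Prop := fun e => ES e ∧ ∀ g : M, e ≠ g • e₀ with hS
  -- a full square has at most one side in the orbit
  have hone : ∀ (q : Q) d α d' α' (g g' : M), K.Full ES q → K.side q d α = g • e₀ →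
      K.side q d' α' = g' • e₀ → d = d' ∧ α = α' ∧ (g⁻¹ • q, d, α) = x := by
    intro q d α d' α' g g' hq h1 h2
    have e1 := (hx (g⁻¹ • q, d, α)).1 (by
      have := dart_smul (x := (q, d, α)) h.inv g⁻¹ ⟨hq, h1⟩
      rwa [inv_smul_smul] at this)
    have e2 := (hx (g'⁻¹ • q, d', α')).1 (by
      have := dart_smul (x := (q, d', α')) h.inv g'⁻¹ ⟨hq, h2⟩
      rwa [inv_smul_smul] at this)
    have e3 := e1.trans e2.symm
    simp only [Prod.mk.injEq] at e3
    exact ⟨e3.2.1, e3.2.2, e1⟩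
  have hside : ∀ (q : Q) d α (g : M), K.Full ES q → K.side q d α = g • e₀ →
      ∀ d' α', (d', α') ≠ (d, α) → S (K.side q d' α') := by
    intro q d α g hq h1 d' α' hne
    refine ⟨hq _ _, fun g' h2 => hne ?_⟩
    obtain ⟨rfl, rfl, -⟩ := hone q d α d' α' g g' hq h1 h2
    rfl
  have hxx := (hx x).2 rfl
  have hpath : ∀ {y z}, Relation.ReflTransGen (K.Adj ES) y z →
      Relation.ReflTransGen (K.Adj S) y z := by
    intro y z hyz
    induction hyz with
    | refl => exact .refl
    | tail _ hs ih =>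
      refine ih.trans ?_
      obtain ⟨e, β, he, rfl, rfl⟩ := hs
      by_cases hR : ∃ g : M, e = g • e₀
      · obtain ⟨g, rfl⟩ := hR
        obtain ⟨hq, hs⟩ := dart_smul h.inv g hxx
        rw [← hs]
        exact rtg_adj_around _ _ _ (hside _ _ _ g hq hs) β
      · exact .single ⟨e, β, ⟨he, fun g hg => hR ⟨g, hg⟩⟩, rfl, rfl⟩
  refine ⟨?_, ?_, fun g => hpath (h.conn g), fun e β he => hpath (h.reach e β he.1), ?_⟩
  · intro g e
    refine and_congr (h.inv g e) ⟨fun h' g' hg => ?_, fun h' g' hg => ?_⟩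
    · exact h' (g * g') (by rw [hg, mul_smul])
    · exact h' (g⁻¹ * g') (by rw [mul_smul, ← hg, inv_smul_smul])
  · intro e he
    refine ⟨h.sub e he, fun g hg => hz ((hZ g e₀).1 (hg ▸ he))⟩
  · intro c hc
    -- the value forced on the removed edges
    let c0 : E → ZMod 2 := fun e => if ∃ g : M, e = g • e₀ then 0 else c e
    let s : Q → ZMod 2 := fun q => c0 (K.side q false false) + c0 (K.side q false true) +
      (c0 (K.side q true false) + c0 (K.side q true true))
    let c' : E → ZMod 2 := fun e =>
      if hR : ∃ g : M, e = g • e₀ then s (hR.choose • x.1) else c e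
    have c0R : ∀ e (g : M), e = g • e₀ → c0 e = 0 := fun e g hg => if_pos ⟨g, hg⟩
    have c0S : ∀ e, S e → c0 e = c e := fun e he => if_neg fun ⟨g, hg⟩ => he.2 g hg
    have cS : ∀ e, S e → c' e = c0 e := fun e he => by
      rw [c0S e he]; exact dif_neg fun ⟨g, hg⟩ => he.2 g hg
    have cR : ∀ q d α (g : M), K.Full ES q → K.side q d α = g • e₀ →
        c' (K.side q d α) = s q := by
      intro q d α g hq hg
      have hR : ∃ g : M, K.side q d α = g • e₀ := ⟨g, hg⟩
      have e1 : c' (K.side q d α) = s (hR.choose • x.1) := dif_pos hR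
      rw [e1]
      obtain ⟨-, -, h3⟩ := hone q d α d α _ _ hq hR.choose_spec hR.choose_spec
      rw [← h3, smul_inv_smul]
    obtain ⟨hh, hhh⟩ := h.h1 c' (fun q hq => by
      by_cases hR : ∃ d α, ∃ g : M, K.side q d α = g • e₀
      · obtain ⟨d, α, g, hg⟩ := hR
        have hs' := hside q d α g hq hg
        have e1 := cR q d α g hq hg
        have e2 := c0R _ g hg
        have e3 : ∀ d' α', (d', α') ≠ (d, α) → c' (K.side q d' α') = c0 (K.side q d' α') :=
          fun d' α' hne => cS _ (hs' d' α' hne)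
        have two : ∀ y : ZMod 2, y + y = 0 := by decide
        simp only [s] at e1
        cases d <;> cases α
        · rw [e1, e3 false true (by simp), e3 true false (by simp), e3 true true (by simp), e2]
          generalize c0 (K.side q false true) = a1
          generalize c0 (K.side q true false) = a2
          generalize c0 (K.side q true true) = a3
          revert a1 a2 a3; decide
        · rw [e1, e3 false false (by simp), e3 true false (by simp), e3 true true (by simp), e2]
          generalize c0 (K.side q false false) = a1
          generalize c0 (K.side q true false) = a2
          generalize c0 (K.side q true true) = a3
          revert a1 a2 a3; decide
        · rw [e1, e3 false true (by simp), e3 false false (by simp), e3 true true (by simp), e2]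
          generalize c0 (K.side q false true) = a1
          generalize c0 (K.side q false false) = a2
          generalize c0 (K.side q true true) = a3
          revert a1 a2 a3; decide
        · rw [e1, e3 false true (by simp), e3 true false (by simp), e3 false false (by simp), e2]
          generalize c0 (K.side q false true) = a1
          generalize c0 (K.side q true false) = a2
          generalize c0 (K.side q false false) = a3
          revert a1 a2 a3; decide
      · have hSS : K.Full S q := fun d α => ⟨hq d α, fun g hg => hR ⟨d, α, g, hg⟩⟩
        have e3 : ∀ d α, c' (K.side q d α) = c (K.side q d α) := fun d α => by
          rw [cS _ (hSS d α), c0S _ (hSS d α)]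
        rw [e3, e3, e3, e3]
        exact hc q hSS)
    exact ⟨hh, fun e he => by rw [← hhh e he.1, cS e he, c0S e he]⟩

theorem adj_h1 {S : E → Prop} {hgt : V → ZMod 2} {e₁ : E}
    (hh : ∀ e, S e → ind (e = e₁) = hgt (K.pt e false) + hgt (K.pt e true)) {e : E} (he : S e)
    (β : Bool) : hgt (K.pt e (!β)) = hgt (K.pt e β) + ind (e = e₁) := by
  have := hh e he
  cases β <;> rw [this] <;> simp only [Bool.not_false, Bool.not_true] <;>
    generalize hgt (K.pt e false) = a <;> generalize hgt (K.pt e true) = b <;> revert a b <;>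
    decide

/-- An edge in no square whose orbit separates the orbit of the base point gives a free
splitting. -/
theorem IsCore.exists_stepOver (j : M →* F) (hj : Function.Injective j)
    (hfreeV : ∀ (g : M) (v : V), g • v = v → g = 1) (htf : ∀ g : M, g * g = 1 → g = 1)
    (h : K.IsCore Z ES x₀) {e₀ : E} (he₀ : ES e₀) (hx : ∀ y, ¬ K.Dart ES e₀ y) {g₀ : M}
    (hg₀ : ¬ Relation.ReflTransGen (K.Adj fun e => ES e ∧ ∀ g : M, e ≠ g • e₀) x₀ (g₀ • x₀)) :
    ∃ P : Subgroup M, StepOver (j 1) (P.map j) j.range ∧ P ≠ ⊤ ∧ ∀ g : M,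
      Relation.ReflTransGen (K.Adj fun e => ES e ∧ ∀ g : M, e ≠ g • e₀) x₀ (g • x₀) →
      g ∈ P := by
  set S : E → Prop := fun e => ES e ∧ ∀ g : M, e ≠ g • e₀ with hS
  have hSinv : ∀ (g : M) e, S (g • e) ↔ S e := by
    intro g e
    refine and_congr (h.inv g e) ⟨fun h' g' hg => ?_, fun h' g' hg => ?_⟩
    · exact h' (g * g') (by rw [hg, mul_smul])
    · exact h' (g⁻¹ * g') (by rw [mul_smul, ← hg, inv_smul_smul])
  obtain ⟨g₁, β, hb⟩ : ∃ (g₁ : M) (β : Bool),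
      Relation.ReflTransGen (K.Adj S) x₀ (K.pt (g₁ • e₀) β) := by
    by_contra! hcon
    refine hg₀ ?_
    have : ∀ y, Relation.ReflTransGen (K.Adj ES) x₀ y → Relation.ReflTransGen (K.Adj S) x₀ y := by
      intro y hy
      induction hy with
      | refl => exact .refl
      | tail _ hs ih =>
        obtain ⟨e, β, he, rfl, rfl⟩ := hs
        by_cases hR : ∃ g : M, e = g • e₀
        · obtain ⟨g, rfl⟩ := hR
          exact absurd ih (hcon g β)
        · exact ih.tail ⟨e, β, ⟨he, fun g hg => hR ⟨g, hg⟩⟩, rfl, rfl⟩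
    exact this _ (h.conn g₀)
  set e₁ := g₁ • e₀ with he₁
  set a := K.pt e₁ β with ha
  set b := K.pt e₁ (!β) with hb'
  have hES₁ : ES e₁ := (h.inv _ _).2 he₀
  obtain ⟨hgt, hh⟩ := h.h1 (fun e => ind (e = e₁)) (fun q hq => by
    have : ∀ d α, ind (K.side q d α = e₁) = 0 := fun d α => ind_not fun he => by
      have := dart_smul (x := (q, d, α)) h.inv g₁⁻¹ ⟨hq, he⟩
      rw [inv_smul_smul] at this
      exact hx _ this
    simp only [this]; rfl)
  have hstep := fun e he β => adj_h1 (K := K) hh (e := e) he β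
  have hone01 : ∀ x : ZMod 2, x + 1 ≠ x := by decide
  have hgab : hgt b ≠ hgt a := by
    rw [hb', hstep e₁ hES₁ β, ind_of rfl]; exact hone01 _
  have hab : a ≠ b := fun h => hgab (congrArg hgt h).symm
  have hcross : ∀ e β', ES e → hgt (K.pt e (!β')) ≠ hgt (K.pt e β') → e = e₁ := by
    intro e β' he hne
    by_contra hcon
    exact hne (by rw [hstep e he β', ind_not hcon, add_zero])
  let Φ : V → V → Prop := fun x y => x = a ∧ y = b
  have hunc : ∀ x y, Uncrossed M (K.Adj ES) Φ x y ↔ K.Adj S x y := by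
    intro x y
    constructor
    · rintro ⟨⟨e, β', he, rfl, rfl⟩, h2⟩
      refine ⟨e, β', ⟨he, fun g hg => ?_⟩, rfl, rfl⟩
      have h3 := h2 (g₁ * g⁻¹)
      have h4 : (g₁ * g⁻¹) • e = e₁ := by rw [hg, mul_smul, inv_smul_smul]
      rw [← K.smul_pt, ← K.smul_pt, h4] at h3
      by_cases hbb : β' = β
      · subst hbb; exact h3.1 ⟨rfl, rfl⟩
      · have : β' = !β := by revert hbb; cases β' <;> cases β <;> simp
        subst this
        exact h3.2 ⟨by rw [Bool.not_not], rfl⟩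
    · rintro ⟨e, β', ⟨he, hne⟩, rfl, rfl⟩
      refine ⟨⟨e, β', he, rfl, rfl⟩, fun g => ?_⟩
      have h3 : g • e ≠ e₁ := fun h3 => hne (g⁻¹ * g₁) (by
        rw [mul_smul, ← he₁, ← h3, inv_smul_smul])
      have h4 : hgt (K.pt (g • e) (!β')) = hgt (K.pt (g • e) β') := by
        by_contra hcon
        exact h3 (hcross _ _ ((h.inv g e).2 he) hcon)
      rw [K.smul_pt, K.smul_pt] at h4
      constructor
      · rintro ⟨h5, h6⟩; rw [h5, h6] at h4; exact hgab h4
      · rintro ⟨h5, h6⟩; rw [h5, h6] at h4; exact hgab h4.symm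
  have hfix : ∀ g : M, g • a = a → g = 1 := fun g => hfreeV g a
  have hxS : ∀ g : M, Relation.ReflTransGen (K.Adj S) (g • x₀) (g • a) :=
    fun g => rtg_adj_smul hSinv g hb
  obtain ⟨P, hP, hst⟩ := exists_stepOver_of_wall j hj (K.Adj ES) Φ (fun x => hgt x ≠ hgt a) a b 1
    (fun _ _ h => h.symm) (fun g _ _ hxy => hxy.smul h.inv g) ⟨rfl, rfl⟩
    (by rintro x y ⟨rfl, rfl⟩; exact ⟨⟨e₁, β, hES₁, rfl, rfl⟩, fun h => h rfl, hgab⟩)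
    (by
      rintro x y ⟨e, β', he, rfl, rfl⟩ h1 h2
      have h1' := not_not.1 h1
      obtain rfl := hcross e β' he (by rw [h1']; exact h2)
      by_cases hbb : β' = β
      · subst hbb; exact ⟨rfl, rfl⟩
      · have : β' = !β := by revert hbb; cases β' <;> cases β <;> simp
        subst this
        exact absurd h1' hgab)
    (by
      rintro g x y ⟨rfl, rfl⟩ ⟨h1, -⟩ x' y' h2
      obtain rfl := hfix g h1
      rwa [one_smul, one_smul])
    (by
      rintro g x y ⟨rfl, rfl⟩ ⟨h1, h2⟩
      have := htf g (hfix _ (by rw [mul_smul, h2, h1]))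
      subst this
      rw [one_smul] at h1
      exact hab h1.symm)
    (fun g => ((rtg_adj_symm (h.reach e₁ β hES₁)).trans (h.conn g)).trans
      (rtg_adj_smul h.inv g (h.reach e₁ β hES₁)))
    (by rintro x y ⟨rfl, rfl⟩; exact ⟨.refl, .refl⟩)
    (by
      intro g
      rw [Subgroup.zpowers_one_eq_bot, Subgroup.mem_bot]
      refine ⟨fun h => hfix g h.1, ?_⟩
      rintro rfl
      exact ⟨one_smul _ _, one_smul _ _⟩)
  have hUS : Uncrossed M (K.Adj ES) Φ = K.Adj S := by
    funext x y; exact propext (hunc x y)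
  rw [hUS] at hP
  refine ⟨P, hst, ?_, fun g hg => (hP g).2 (((rtg_adj_symm hb).trans hg).trans (hxS g))⟩
  rintro rfl
  exact hg₀ ((hb.trans ((hP g₀).1 trivial)).trans (rtg_adj_symm (hxS g₀)))

/-- Restrict to the component of the base point after deleting the orbit of an edge in no
square. -/
theorem IsCore.component (hZ : ∀ (g : M) e, Z (g • e) ↔ Z e)
    (hZc : ∀ e β, Z e → ∃ g : M, Relation.ReflTransGen (K.Adj Z) (g • x₀) (K.pt e β))
    (h : K.IsCore Z ES x₀) {e₀ : E} (hz : ¬ Z e₀) (hx : ∀ y, ¬ K.Dart ES e₀ y)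
    (hconn : ∀ g : M,
      Relation.ReflTransGen (K.Adj fun e => ES e ∧ ∀ g : M, e ≠ g • e₀) x₀ (g • x₀)) :
    K.IsCore Z (fun e => (ES e ∧ ∀ g : M, e ≠ g • e₀) ∧ ∀ β,
      Relation.ReflTransGen (K.Adj fun e => ES e ∧ ∀ g : M, e ≠ g • e₀) x₀ (K.pt e β)) x₀ := by
  classical
  set S : E → Prop := fun e => ES e ∧ ∀ g : M, e ≠ g • e₀ with hS
  have hSinv : ∀ (g : M) e, S (g • e) ↔ S e := by
    intro g e
    refine and_congr (h.inv g e) ⟨fun h' g' hg => ?_, fun h' g' hg => ?_⟩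
    · exact h' (g * g') (by rw [hg, mul_smul])
    · exact h' (g⁻¹ * g') (by rw [mul_smul, ← hg, inv_smul_smul])
  set S' : E → Prop := fun e => S e ∧ ∀ β, Relation.ReflTransGen (K.Adj S) x₀ (K.pt e β) with hS'
  have hZS : ∀ e, Z e → S e := fun e he =>
    ⟨h.sub e he, fun g hg => hz ((hZ g e₀).1 (hg ▸ he))⟩
  have hpath : ∀ y, Relation.ReflTransGen (K.Adj S) x₀ y →
      Relation.ReflTransGen (K.Adj S') x₀ y := by
    intro y hy
    induction hy with
    | refl => exact .refl
    | tail h1 hs ih =>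
      obtain ⟨e, β, he, rfl, rfl⟩ := hs
      refine ih.tail ⟨e, β, ⟨he, fun β' => ?_⟩, rfl, rfl⟩
      by_cases hbb : β' = β
      · subst hbb; exact h1
      · have : β' = !β := by revert hbb; cases β' <;> cases β <;> simp
        subst this
        exact h1.tail ⟨e, β, he, rfl, rfl⟩
  have hother : ∀ e β, S e → Relation.ReflTransGen (K.Adj S) x₀ (K.pt e β) → S' e := by
    intro e β he h1
    refine ⟨he, fun β' => ?_⟩
    by_cases hbb : β' = β
    · subst hbb; exact h1
    · have : β' = !β := by revert hbb; cases β' <;> cases β <;> simp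
      subst this
      exact h1.tail ⟨e, β, he, rfl, rfl⟩
  refine ⟨?_, ?_, fun g => hpath _ (hconn g), fun e β he => hpath _ (he.2 β), ?_⟩
  · have one : ∀ (g : M) e, S' e → S' (g • e) := by
      intro g e he
      refine ⟨(hSinv g e).2 he.1, fun β => ?_⟩
      rw [K.smul_pt]
      exact (hconn g).trans (rtg_adj_smul hSinv g (he.2 β))
    intro g e
    refine ⟨fun he => ?_, one g e⟩
    have := one g⁻¹ _ he
    rwa [inv_smul_smul] at this
  · intro e he
    refine ⟨hZS e he, fun β => ?_⟩
    obtain ⟨g, hg⟩ := hZc e β he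
    exact (hconn g).trans (rtg_adj_mono hZS hg)
  · intro c hc
    obtain ⟨hh, hhh⟩ := h.h1 (fun e => if S' e then c e else 0) (fun q hq => by
      have hfull : K.Full S q := fun d α => ⟨hq d α, fun g hg => by
        have := dart_smul (x := (q, d, α)) h.inv g⁻¹ ⟨hq, hg⟩
        rw [inv_smul_smul] at this
        exact hx _ this⟩
      by_cases hR : ∃ d α, S' (K.side q d α)
      · obtain ⟨d, α, hs⟩ := hR
        have hlev : ∀ d α, S' (K.side q d α) → ∀ β, S' (K.side q (!d) β) := by
          intro d α hs β
          refine hother _ α (hfull _ _) ?_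
          have := hs.2 β
          cases d
          · rwa [K.comm] at this
          · rwa [← K.comm] at this
        have hall : K.Full S' q := by
          have h1 := hlev d α hs
          have h2 := hlev (!d) α (h1 α)
          rw [Bool.not_not] at h2
          intro d' α'
          by_cases hd : d' = d
          · subst hd; exact h2 α'
          · have : d' = !d := by revert hd; cases d' <;> cases d <;> simp
            subst this
            exact h1 α'
        rw [if_pos (hall _ _), if_pos (hall _ _), if_pos (hall _ _), if_pos (hall _ _)]
        exact hc q hall
      · push Not at hR
        rw [if_neg (hR _ _), if_neg (hR _ _), if_neg (hR _ _), if_neg (hR _ _)]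
        rfl)
    exact ⟨hh, fun e he => by rw [← hhh e he.1.1, if_pos he]⟩

/-- The edges of a core that are special or do not lie in exactly two squares. -/
def Branch (K : SqComplex M V E Q) (Z ES : E → Prop) (e : E) : Prop :=
  ES e ∧ (Z e ∨ ¬ ∃ x y : Q × Bool × Bool, x ≠ y ∧ ∀ z, K.Dart ES e z ↔ z = x ∨ z = y)

theorem IsCore.minimal_of_rigid (j : M →* F) (hj : Function.Injective j)
    (hfreeV : ∀ (g : M) (v : V), g • v = v → g = 1)
    (hfree : ∀ (g : M) (q : Q), g • q = q → g = 1) (htf : ∀ g : M, g * g = 1 → g = 1)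
    (hZ : ∀ (g : M) e, Z (g • e) ↔ Z e)
    (hZc : ∀ e β, Z e → ∃ g : M, Relation.ReflTransGen (K.Adj Z) (g • x₀) (K.pt e β))
    (hrig : ∀ (c : M) (P : Subgroup M), StepOver (j c) (P.map j) j.range →
      (∀ g : M, Relation.ReflTransGen (K.Adj Z) x₀ (g • x₀) → g ∈ P) → P = ⊤)
    (h : K.IsCore Z ES x₀)
    (hmin : ∀ ES', K.IsCore Z ES' x₀ → (∀ e, ES' e → ES e) → ∀ e, ES e → ES' e) :
    (∀ e, ES e → ¬ Z e → ∃ x y, x ≠ y ∧ K.Dart ES e x ∧ K.Dart ES e y) ∧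
    ∀ g : M, Relation.ReflTransGen (K.Adj (K.Branch Z ES)) x₀ (g • x₀) := by
  have hZS : ∀ e₀, ¬ Z e₀ → ∀ e, Z e → ES e ∧ ∀ g : M, e ≠ g • e₀ := fun e₀ hz e he =>
    ⟨h.sub e he, fun g hg => hz ((hZ g e₀).1 (hg ▸ he))⟩
  refine ⟨fun e he hz => ?_, ?_⟩
  · obtain ⟨x, hx⟩ : ∃ x, K.Dart ES e x := by
      by_contra! hx
      have hconn : ∀ g : M, Relation.ReflTransGen
          (K.Adj fun e' => ES e' ∧ ∀ g : M, e' ≠ g • e) x₀ (g • x₀) := by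
        by_contra! hcon
        obtain ⟨g₀, hg₀⟩ := hcon
        obtain ⟨P, h1, h2, h3⟩ := h.exists_stepOver j hj hfreeV htf he hx hg₀
        exact h2 (hrig _ P h1 fun g hg => h3 g (rtg_adj_mono (hZS e hz) hg))
      exact (hmin _ (h.component hZ hZc hz hx hconn) (fun e' he' => he'.1.1) e he).1.2 1
        (one_smul M e).symm
    by_contra! hcon
    have hu : ∀ y, K.Dart ES e y ↔ y = x := by
      intro y
      refine ⟨fun hy => ?_, fun hy => hy ▸ hx⟩
      by_contra hne
      exact hcon y x hne hy hx
    exact (hmin _ (h.collapse hZ hz hu) (fun e' he' => he'.1) e he).2 1 (one_smul M e).symm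
  · by_contra! hcon
    obtain ⟨g₀, hg₀⟩ := hcon
    have hBinv : ∀ (g : M) e, K.Branch Z ES e → K.Branch Z ES (g • e) := by
      intro g e he
      refine ⟨(h.inv g e).2 he.1, he.2.imp (hZ g e).2 fun h1 h2 => h1 ?_⟩
      obtain ⟨x, y, hxy, hz⟩ := h2
      refine ⟨(g⁻¹ • x.1, x.2), (g⁻¹ • y.1, y.2), fun hne => hxy ?_, fun z => ?_⟩
      · obtain ⟨h3, h4⟩ := Prod.ext_iff.1 hne
        exact Prod.ext (smul_left_cancel _ h3) h4
      · have h3 : K.Dart ES e z ↔ K.Dart ES (g • e) (g • z.1, z.2) := by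
          refine ⟨fun h => dart_smul ‹K.IsCore Z ES x₀›.inv g h, fun h3 => ?_⟩
          have := dart_smul h.inv g⁻¹ h3
          rwa [inv_smul_smul, inv_smul_smul] at this
        rw [h3, hz]
        refine or_congr ?_ ?_
        · constructor
          · rintro rfl; simp
          · rintro rfl; simp
        · constructor
          · rintro rfl; simp
          · rintro rfl; simp
    obtain ⟨c, P, h1, h2, h3⟩ := exists_stepOver_of_track j hj (DQ := K.Branch Z ES) h.inv
      (fun g e => ⟨fun he => by have := hBinv g⁻¹ _ he; rwa [inv_smul_smul] at this, hBinv g e⟩)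
      (full_smul h.inv) (fun q d α hq => hq d α) (fun e he => he.1) hfree htf
      (fun e he hd => by
        by_contra hcon
        exact hd ⟨he, Or.inr hcon⟩) h.h1 x₀ h.conn g₀ hg₀
    exact h2 (hrig c P h1 fun g hg => h3 g (rtg_adj_mono
      (fun e he => ⟨h.sub e he, Or.inl he⟩) hg))

end SqComplex
namespace FreeWord

variable {α : Type*} [DecidableEq α]

/-- The element of a free group given by a letter. -/
def letter (s : α × Bool) : FreeGroup α := FreeGroup.mk [s]

omit [DecidableEq α] in
theorem letter_true (i : α) : letter (i, true) = FreeGroup.of i := rfl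

omit [DecidableEq α] in
theorem letter_inv (s : α × Bool) : (letter s)⁻¹ = letter (s.1, !s.2) := by
  simp [letter, FreeGroup.inv_mk, FreeGroup.invRev]

omit [DecidableEq α] in
theorem letter_false (i : α) : letter (i, false) = (FreeGroup.of i)⁻¹ := by
  rw [← letter_true, letter_inv]; rfl

theorem toWord_mul_letter (g : FreeGroup α) (s : α × Bool) :
    (∃ w, g.toWord = w ++ [(s.1, !s.2)] ∧ (g * letter s).toWord = w) ∨
      (g * letter s).toWord = g.toWord ++ [s] := by
  have hg : FreeGroup.IsReduced g.toWord := FreeGroup.isReduced_toWord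
  have hmul : g * letter s = FreeGroup.mk (g.toWord ++ [s]) := by
    conv_lhs => rw [← FreeGroup.mk_toWord (x := g)]
    rw [letter, FreeGroup.mul_mk]
  rcases List.eq_nil_or_concat g.toWord with h | ⟨w, a, h⟩ <;>
    try rw [List.concat_eq_append] at h
  · right
    rw [hmul, FreeGroup.toWord_mk, h]
    rfl
  · by_cases ha : a = (s.1, !s.2)
    · left
      refine ⟨w, by rw [h, ha], ?_⟩
      have hw : FreeGroup.IsReduced w := by
        rw [h] at hg
        exact (List.isChain_append.1 hg).1
      have : g * letter s = FreeGroup.mk w := by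
        rw [hmul, h, ha]
        apply FreeGroup.Red.exact.2
        refine ⟨w, ?_, .refl⟩
        refine Relation.ReflTransGen.single ?_
        have := FreeGroup.Red.Step.not (L₁ := w) (L₂ := ([] : List (α × Bool))) (x := s.1) (b := !s.2)
        simpa using this
      rw [this, FreeGroup.toWord_mk, hw.reduce_eq]
    · right
      rw [hmul, FreeGroup.toWord_mk]
      refine FreeGroup.IsReduced.reduce_eq ?_
      refine List.isChain_append.2 ⟨hg, by simp, ?_⟩
      intro x hx y hy h1
      rw [h] at hx
      simp at hx hy
      subst hx; subst hy
      by_contra h2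
      exact ha (Prod.ext h1 (by revert h2; cases a.2 <;> cases s.2 <;> simp))

theorem norm_mul_letter (g : FreeGroup α) (s : α × Bool) :
    (g * letter s).norm = g.norm + 1 ∨ (g * letter s).norm + 1 = g.norm := by
  rcases toWord_mul_letter g s with ⟨w, h1, h2⟩ | h
  · right; simp [FreeGroup.norm, h1, h2]
  · left; simp [FreeGroup.norm, h]

theorem letter_unique {g : FreeGroup α} {s s' : α × Bool} (h : (g * letter s).norm + 1 = g.norm)
    (h' : (g * letter s').norm + 1 = g.norm) : s = s' := by
  have key : ∀ s : α × Bool, (g * letter s).norm + 1 = g.norm →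
      ∃ w, g.toWord = w ++ [(s.1, !s.2)] := by
    intro s hs
    rcases toWord_mul_letter g s with ⟨w, h1, -⟩ | h2
    · exact ⟨w, h1⟩
    · simp only [FreeGroup.norm, h2, List.length_append, List.length_singleton] at hs
      omega
  obtain ⟨w, hw⟩ := key s h
  obtain ⟨w', hw'⟩ := key s' h'
  have := List.append_inj_right' (hw.symm.trans hw') rfl
  simp at this
  exact Prod.ext this.1 this.2

theorem exists_letter {g : FreeGroup α} (h : g ≠ 1) :
    ∃ s : α × Bool, (g * letter s).norm + 1 = g.norm := by
  rcases List.eq_nil_or_concat g.toWord with h1 | ⟨w, a, h1⟩ <;>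
    try rw [List.concat_eq_append] at h1
  · exact absurd (FreeGroup.toWord_eq_nil_iff.1 h1) h
  · refine ⟨(a.1, !a.2), ?_⟩
    rcases toWord_mul_letter g (a.1, !a.2) with ⟨w', h2, h3⟩ | h2
    · simp [FreeGroup.norm, h2, h3]
    · exfalso
      have hr : FreeGroup.IsReduced (g * letter (a.1, !a.2)).toWord := FreeGroup.isReduced_toWord
      rw [h2, h1] at hr
      have := (List.isChain_append.1 hr).2.2 a (by simp) (a.1, !a.2) (by simp) rfl
      revert this; cases a.2 <;> simp

theorem norm_letter (s : α × Bool) : (letter s).norm = 1 := by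
  have := norm_mul_letter 1 s
  simp at this; exact this

theorem norm_inv_mul_comm (p q : FreeGroup α) : (p⁻¹ * q).norm = (q⁻¹ * p).norm := by
  rw [← FreeGroup.norm_inv_eq]; simp

/-- `p` is a prefix of `w`. -/
def Prefix (p w : FreeGroup α) : Prop := w.norm = p.norm + (p⁻¹ * w).norm

theorem Prefix.refl (w : FreeGroup α) : Prefix w w := by simp [Prefix]

theorem prefix_one_left (w : FreeGroup α) : Prefix 1 w := by simp [Prefix]

theorem norm_le_add (p w : FreeGroup α) : w.norm ≤ p.norm + (p⁻¹ * w).norm := by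
  have := FreeGroup.norm_mul_le p (p⁻¹ * w)
  rwa [mul_inv_cancel_left] at this

theorem Prefix.norm_le {p w : FreeGroup α} (h : Prefix p w) : p.norm ≤ w.norm := by
  unfold Prefix at h; omega

theorem Prefix.eq_of_norm_le {p w : FreeGroup α} (h : Prefix p w) (h' : w.norm ≤ p.norm) :
    p = w := by
  unfold Prefix at h
  have : (p⁻¹ * w).norm = 0 := by omega
  rw [FreeGroup.norm_eq_zero] at this
  exact (inv_mul_eq_one.1 this)

theorem Prefix.mul_letter {p w : FreeGroup α} (h : Prefix p w) {s : α × Bool}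
    (hs : (p * letter s).norm + 1 = p.norm) : Prefix (p * letter s) w := by
  have h1 := norm_le_add (p * letter s) w
  have h2 := FreeGroup.norm_mul_le (letter s)⁻¹ (p⁻¹ * w)
  rw [FreeGroup.norm_inv_eq, norm_letter] at h2
  rw [show (p * letter s)⁻¹ * w = (letter s)⁻¹ * (p⁻¹ * w) by group] at h1
  unfold Prefix at h ⊢
  rw [show (p * letter s)⁻¹ * w = (letter s)⁻¹ * (p⁻¹ * w) by group]
  omega

theorem Prefix.exists_letter {p w : FreeGroup α} (h : Prefix p w) (hne : p ≠ w) :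
    ∃ s : α × Bool, (w * letter s).norm + 1 = w.norm ∧ Prefix p (w * letter s) := by
  obtain ⟨s, hs⟩ := FreeWord.exists_letter (g := p⁻¹ * w) (fun h => hne (inv_mul_eq_one.1 h))
  have h1 := norm_le_add p (w * letter s)
  have h2 := norm_mul_letter w s
  rw [mul_assoc] at hs
  unfold Prefix at h ⊢
  exact ⟨s, by omega, by omega⟩

theorem Prefix.drop_letter {p w : FreeGroup α} (h : Prefix p w) (hne : p ≠ w) {s : α × Bool}
    (hs : (w * letter s).norm + 1 = w.norm) : Prefix p (w * letter s) := by
  obtain ⟨s', h1, h2⟩ := h.exists_letter hne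
  rwa [letter_unique hs h1]

/-- Prefixes of a word are at distance the difference of their lengths. -/
theorem Prefix.norm_inv_mul {p q w : FreeGroup α} (hp : Prefix p w) (hq : Prefix q w)
    (h : p.norm ≤ q.norm) : Prefix p q := by
  induction hn : w.norm using Nat.strong_induction_on generalizing w with
  | _ n ih =>
    by_cases h1 : q = w
    · rwa [h1]
    · by_cases h2 : p = w
      · have := hq.eq_of_norm_le (h2 ▸ h)
        exact absurd this h1
      · obtain ⟨s, hs, hq'⟩ := hq.exists_letter h1
        exact ih (w * letter s).norm (by omega) (hp.drop_letter h2 hs) hq' rfl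

theorem Prefix.trans {p q w : FreeGroup α} (hp : Prefix p q) (hq : Prefix q w) : Prefix p w := by
  have h1 := FreeGroup.norm_mul_le (p⁻¹ * q) (q⁻¹ * w)
  rw [show p⁻¹ * q * (q⁻¹ * w) = p⁻¹ * w by group] at h1
  have h2 := norm_le_add p w
  unfold Prefix at *
  omega

/-- Extending a suffix that cancels nothing. -/
theorem norm_eq_of_extend {w τ : FreeGroup α} {s : α × Bool}
    (hs : (τ * letter s).norm + 1 = τ.norm) (h : (w * τ * letter s).norm = (w * τ).norm + 1) :
    w.norm = (w * τ).norm + τ.norm := by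
  induction hn : τ.norm using Nat.strong_induction_on generalizing τ s with
  | _ n ih =>
    by_cases h1 : τ * letter s = 1
    · have hw : w * τ * letter s = w := by rw [mul_assoc, h1, mul_one]
      rw [h1] at hs
      rw [hw] at h
      simp at hs
      omega
    · obtain ⟨s', hs'⟩ := exists_letter h1
      have hne : s' ≠ (s.1, !s.2) := by
        rintro rfl
        rw [← letter_inv, mul_inv_cancel_right] at hs'
        omega
      have h2 : (w * (τ * letter s) * letter s').norm = (w * (τ * letter s)).norm + 1 := by
        rcases norm_mul_letter (w * (τ * letter s)) s' with h3 | h3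
        · exact h3
        · exfalso
          refine hne (letter_unique h3 ?_)
          rw [← letter_inv, ← mul_assoc, mul_inv_cancel_right, h]
      have h3 := ih _ (by omega) hs' h2 rfl
      rw [← mul_assoc] at h3
      omega

/-- Sets closed under prefixes. -/
def PrefixClosed (D : FreeGroup α → Prop) : Prop :=
  ∀ p s, D p → (p * letter s).norm + 1 = p.norm → D (p * letter s)

theorem PrefixClosed.of_prefix_of {D : FreeGroup α → Prop} (hD : PrefixClosed D) {p w : FreeGroup α}
    (hw : D w) (h : Prefix p w) : D p := by
  induction hn : w.norm using Nat.strong_induction_on generalizing w with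
  | _ n ih =>
    by_cases h1 : p = w
    · rwa [h1]
    · obtain ⟨s, hs, h'⟩ := h.exists_letter h1
      exact ih _ (by omega) (hD w s hw hs) h' rfl

theorem PrefixClosed.inter_translate {D : FreeGroup α → Prop} (hD : PrefixClosed D)
    {u : FreeGroup α} (hu : D u⁻¹) : PrefixClosed fun p => D p ∧ D (u⁻¹ * p) := by
  rintro p s ⟨h1, h2⟩ hs
  refine ⟨hD p s h1 hs, ?_⟩
  rw [← mul_assoc]
  rcases norm_mul_letter (u⁻¹ * p) s with h | h
  · have h3 := norm_eq_of_extend hs h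
    refine hD.of_prefix_of hu ?_
    unfold Prefix
    rw [show (u⁻¹ * p * letter s)⁻¹ * u⁻¹ = (p * letter s)⁻¹ by group]
    have h4 := FreeGroup.norm_inv_eq (x := p * letter s)
    omega
  · exact hD _ s h2 h

/-- Induction along prefixes. -/
theorem PrefixClosed.induction {D : FreeGroup α → Prop} (hD : PrefixClosed D)
    {P : FreeGroup α → Prop} (h1 : P 1)
    (h : ∀ p s, D p → D (p * letter s) → P (p * letter s) → P p) {p : FreeGroup α} (hp : D p) :
    P p := by
  induction hn : p.norm using Nat.strong_induction_on generalizing p with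
  | _ n ih =>
    by_cases h2 : p = 1
    · rwa [h2]
    · obtain ⟨s, hs⟩ := exists_letter h2
      have h3 := hD p s hp hs
      exact h p s hp h3 (ih _ (by omega) h3 rfl)

omit [DecidableEq α] in
/-- Every `ZMod 2`-cochain on the Cayley tree of a free group is a coboundary. -/
theorem exists_primitive (κ : FreeGroup α → α → ZMod 2) :
    ∃ θ : FreeGroup α → ZMod 2, ∀ g a, θ (g * FreeGroup.of a) = θ g + κ g a := by
  let σ : α → Equiv.Perm (FreeGroup α × ZMod 2) := fun a =>
    { toFun := fun x => (x.1 * FreeGroup.of a, x.2 + κ x.1 a)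
      invFun := fun x => (x.1 * (FreeGroup.of a)⁻¹, x.2 - κ (x.1 * (FreeGroup.of a)⁻¹) a)
      left_inv := fun x => by simp
      right_inv := fun x => by simp }
  let Ψ : FreeGroup α →* Equiv.Perm (FreeGroup α × ZMod 2) := FreeGroup.lift fun a => (σ a)⁻¹
  have hstep : ∀ g a, Ψ (g * FreeGroup.of a)⁻¹ = σ a * Ψ g⁻¹ := by
    intro g a
    rw [mul_inv_rev, map_mul, map_inv]
    simp [Ψ]
  have hfst : ∀ g : FreeGroup α, ∀ x, (Ψ g⁻¹ x).1 = x.1 * g := by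
    intro g
    induction g using FreeGroup.induction_on with
    | C1 => intro x; simp
    | of a => intro x; rw [← one_mul (FreeGroup.of a : FreeGroup α), hstep]; simp [σ]
    | inv_of a h =>
      intro x
      have : Ψ (FreeGroup.of a)⁻¹⁻¹ = (σ a)⁻¹ := by simp [Ψ]
      change (Ψ (FreeGroup.of a)⁻¹⁻¹ x).1 = x.1 * (FreeGroup.of a)⁻¹
      rw [this]; rfl
    | mul g h hg hh =>
      intro x
      rw [mul_inv_rev, map_mul, Equiv.Perm.mul_apply, hh, hg, mul_assoc]
  refine ⟨fun g => (Ψ g⁻¹ (1, 0)).2, fun g a => ?_⟩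
  change (Ψ (g * FreeGroup.of a)⁻¹ (1, 0)).2 = _
  rw [hstep, Equiv.Perm.mul_apply]
  change _ + κ (Ψ g⁻¹ (1, 0)).1 a = _
  rw [hfst, one_mul]

theorem finite_ball [Finite α] (r : ℕ) : {g : FreeGroup α | g.norm ≤ r}.Finite := by
  have : {l : List (α × Bool) | l.length ≤ r}.Finite := List.finite_length_le _ r
  exact Set.Finite.of_injOn (f := FreeGroup.toWord) (fun g hg => hg)
    FreeGroup.toWord_injective.injOn this

omit [DecidableEq α] in
theorem mul_self_eq_one {g : FreeGroup α} (h : g * g = 1) : g = 1 := by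
  classical
  by_contra hne
  exact hne (by simpa using (pow_eq_one_iff_left (n := 2) (by norm_num)).1 (by rwa [pow_two]))

end FreeWord

/-- Pairs with the left translation action on the first coordinate. -/
@[ext]
structure Tr (M L : Type*) where
  g : M
  l : L

instance (M L : Type*) [Group M] : MulAction M (Tr M L) where
  smul h x := ⟨h * x.g, x.l⟩
  one_smul x := Tr.ext (one_mul x.g) rfl
  mul_smul a b x := Tr.ext (mul_assoc a b x.g) rfl

theorem Tr.smul_mk {M L : Type*} [Group M] (h g : M) (l : L) :
    h • (⟨g, l⟩ : Tr M L) = ⟨h * g, l⟩ := rfl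

theorem Tr.smul_eq {M L : Type*} [Group M] (h : M) (x : Tr M L) :
    h • x = ⟨h * x.g, x.l⟩ := rfl

theorem Tr.eq_one_of_smul_eq {M L : Type*} [Group M] {h : M} {x : Tr M L} (hx : h • x = x) :
    h = 1 := by
  have := congrArg Tr.g hx
  simpa [Tr.smul_eq] using this

open FreeWord SqComplex

variable {α β : Type*}

/-- Edges of the quotient complex. -/
abbrev LEdge (α β : Type*) := FreeGroup β × (β ⊕ α)

/-- Squares of the quotient complex. -/
abbrev LSquare (α β : Type*) := FreeGroup β × α × β

/-- The product of the Cayley trees of two free groups, in coordinates twisted by a homomorphism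
`f`, with the action of the first group. -/
def prodComplex (f : FreeGroup α →* FreeGroup β) :
    SqComplex (FreeGroup α) (Tr (FreeGroup α) (FreeGroup β)) (Tr (FreeGroup α) (LEdge α β))
      (Tr (FreeGroup α) (LSquare α β)) where
  side q d ε := match d, ε with
    | false, false => ⟨q.g, (q.l.1, .inl q.l.2.2)⟩
    | false, true => ⟨q.g * FreeGroup.of q.l.2.1,
        ((f (FreeGroup.of q.l.2.1))⁻¹ * q.l.1, .inl q.l.2.2)⟩
    | true, false => ⟨q.g, (q.l.1, .inr q.l.2.1)⟩
    | true, true => ⟨q.g, (q.l.1 * FreeGroup.of q.l.2.2, .inr q.l.2.1)⟩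
  pt e ε := match e.l.2, ε with
    | .inl _, false => ⟨e.g, e.l.1⟩
    | .inl b, true => ⟨e.g, e.l.1 * FreeGroup.of b⟩
    | .inr _, false => ⟨e.g, e.l.1⟩
    | .inr i, true => ⟨e.g * FreeGroup.of i, (f (FreeGroup.of i))⁻¹ * e.l.1⟩
  comm q ε ε' := by cases ε <;> cases ε' <;> simp [mul_assoc]
  smul_side g q d ε := by cases d <;> cases ε <;> simp [Tr.smul_eq, mul_assoc]
  smul_pt g e ε := by
    obtain ⟨h, τ, b | i⟩ := e <;> cases ε <;> simp [Tr.smul_eq, mul_assoc]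
  pt_ne e := by
    obtain ⟨h, τ, b | i⟩ := e <;> simp
  side_inj q d ε d' ε' := by
    cases d <;> cases ε <;> cases d' <;> cases ε' <;> simp

variable (f : FreeGroup α →* FreeGroup β)

/-- The invariant set of edges given by a set of local edges. -/
def liftEdges (S : Set (LEdge α β)) (e : Tr (FreeGroup α) (LEdge α β)) : Prop := e.l ∈ S

theorem liftEdges_smul (S : Set (LEdge α β)) (g : FreeGroup α)
    (e : Tr (FreeGroup α) (LEdge α β)) : liftEdges S (g • e) ↔ liftEdges S e := Iff.rfl

/-- Local edges spanned by a set of vertices. -/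
def span (D : FreeGroup β → Prop) : Set (LEdge α β) :=
  {l | D l.1 ∧ match l.2 with
    | .inl b => D (l.1 * FreeGroup.of b)
    | .inr i => D ((f (FreeGroup.of i))⁻¹ * l.1)}

variable [DecidableEq β]

omit [DecidableEq β] in
theorem adj_horizontal {S : Set (LEdge α β)} (g : FreeGroup α) (τ : FreeGroup β) (b : β)
    (h : (τ, .inl b) ∈ S) : (prodComplex f).Adj (liftEdges S) ⟨g, τ⟩ ⟨g, τ * FreeGroup.of b⟩ :=
  ⟨⟨g, (τ, .inl b)⟩, false, h, rfl, rfl⟩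

omit [DecidableEq β] in
theorem adj_vertical {S : Set (LEdge α β)} (g : FreeGroup α) (τ : FreeGroup β) (i : α)
    (h : (τ, .inr i) ∈ S) : (prodComplex f).Adj (liftEdges S) ⟨g, τ⟩
      ⟨g * FreeGroup.of i, (f (FreeGroup.of i))⁻¹ * τ⟩ :=
  ⟨⟨g, (τ, .inr i)⟩, false, h, rfl, rfl⟩

/-- Prefix-closed sets are horizontally connected. -/
theorem rtg_horizontal {S : Set (LEdge α β)} {D : FreeGroup β → Prop} (hD : PrefixClosed D)
    (hS : ∀ τ b, D τ → D (τ * FreeGroup.of b) → (τ, .inl b) ∈ S) (g : FreeGroup α)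
    {p : FreeGroup β} (hp : D p) :
    Relation.ReflTransGen ((prodComplex f).Adj (liftEdges S)) ⟨g, 1⟩ ⟨g, p⟩ := by
  refine hD.induction (P := fun p =>
    Relation.ReflTransGen ((prodComplex f).Adj (liftEdges S)) ⟨g, 1⟩ ⟨g, p⟩) .refl ?_ hp
  rintro p ⟨b, _ | _⟩ h1 h2 h3
  · refine h3.tail ?_
    rw [letter_false] at *
    have := adj_horizontal f g (p * (FreeGroup.of b)⁻¹) b (hS _ _ h2 (by simpa using h1))
    simpa using this
  · refine h3.tail ?_
    rw [letter_true] at *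
    exact (adj_horizontal f g p b (hS _ _ h1 h2)).symm

theorem isCore_span {D : FreeGroup β → Prop} (hD : PrefixClosed D) (h1 : D 1)
    (hu : ∀ i, D (f (FreeGroup.of i))) (hu' : ∀ i, D (f (FreeGroup.of i))⁻¹)
    {Z : Set (LEdge α β)} (hZ : Z ⊆ span f D) :
    (prodComplex f).IsCore (liftEdges Z) (liftEdges (span f D)) ⟨1, 1⟩ := by
  have hhor := fun g p (hp : D p) => rtg_horizontal f (S := span f D) hD
    (fun τ b h h' => ⟨h, h'⟩) g hp
  have hgen : ∀ g i, Relation.ReflTransGen ((prodComplex f).Adj (liftEdges (span f D)))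
      ⟨g, 1⟩ ⟨g * FreeGroup.of i, 1⟩ := by
    intro g i
    refine (hhor g _ (hu i)).tail ?_
    have := adj_vertical f (S := span f D) g (f (FreeGroup.of i)) i ⟨hu i, by simpa using h1⟩
    simpa using this
  have hall : ∀ g h, Relation.ReflTransGen ((prodComplex f).Adj (liftEdges (span f D)))
      ⟨h, 1⟩ ⟨h * g, 1⟩ := by
    intro g
    induction g using FreeGroup.induction_on with
    | C1 => intro h; rw [mul_one]
    | of i => exact fun h => hgen h i
    | inv_of i _ =>
      intro h
      have := hgen (h * (FreeGroup.of i)⁻¹) i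
      rw [inv_mul_cancel_right] at this
      exact rtg_adj_symm this
    | mul a b ha hb =>
      intro h
      rw [← mul_assoc]
      exact (ha h).trans (hb _)
  have hvert : ∀ g p, D p → Relation.ReflTransGen ((prodComplex f).Adj (liftEdges (span f D)))
      ⟨1, 1⟩ ⟨g, p⟩ := by
    intro g p hp
    have := hall g 1
    rw [one_mul] at this
    exact this.trans (hhor g p hp)
  refine ⟨liftEdges_smul _, fun e he => hZ he, fun g => hvert _ _ h1, ?_, ?_⟩
  · rintro ⟨g, τ, b | i⟩ ε ⟨h2, h3⟩ <;> cases ε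
    · exact hvert _ _ h2
    · exact hvert _ _ h3
    · exact hvert _ _ h2
    · exact hvert _ _ h3
  · intro c hc
    classical
    have two : ∀ x : ZMod 2, x + x = 0 := by decide
    choose θ hθ using fun g : FreeGroup α => exists_primitive (α := β) fun τ b =>
      if D τ ∧ D (τ * FreeGroup.of b) then c ⟨g, (τ, .inl b)⟩ else 0
    have hθ' : ∀ g τ b, D τ → D (τ * FreeGroup.of b) →
        θ g (τ * FreeGroup.of b) = θ g τ + c ⟨g, (τ, .inl b)⟩ := by
      intro g τ b h h'
      rw [hθ, if_pos ⟨h, h'⟩]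
    let u : α → FreeGroup β := fun i => f (FreeGroup.of i)
    let δ : FreeGroup α → α → FreeGroup β → ZMod 2 := fun g i τ =>
      c ⟨g, (τ, .inr i)⟩ + θ g τ + θ (g * FreeGroup.of i) ((u i)⁻¹ * τ)
    have hstep : ∀ g i τ b, D τ → D (τ * FreeGroup.of b) → D ((u i)⁻¹ * τ) →
        D ((u i)⁻¹ * (τ * FreeGroup.of b)) → δ g i (τ * FreeGroup.of b) = δ g i τ := by
      intro g i τ b d1 d2 d3 d4
      have d4' := d4
      rw [← mul_assoc] at d4'
      have e1 := hc ⟨g, (τ, i, b)⟩ (by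
        intro d ε
        cases d <;> cases ε
        · exact ⟨d1, d2⟩
        · exact ⟨d3, d4'⟩
        · exact ⟨d1, d3⟩
        · exact ⟨d2, d4⟩)
      have e2 := hθ' g τ b d1 d2
      have e3 := hθ' (g * FreeGroup.of i) ((u i)⁻¹ * τ) b d3 d4'
      change c ⟨g, (τ, .inl b)⟩ + c ⟨g * FreeGroup.of i, ((u i)⁻¹ * τ, .inl b)⟩ +
        (c ⟨g, (τ, .inr i)⟩ + c ⟨g, (τ * FreeGroup.of b, .inr i)⟩) = 0 at e1
      simp only [δ]
      rw [← mul_assoc, e2, e3]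
      generalize c ⟨g, (τ, .inl b)⟩ = a1 at *
      generalize c ⟨g * FreeGroup.of i, ((u i)⁻¹ * τ, .inl b)⟩ = a2 at *
      generalize c ⟨g, (τ, .inr i)⟩ = a3 at *
      generalize c ⟨g, (τ * FreeGroup.of b, .inr i)⟩ = a4 at *
      linear_combination e1 - two a3
    have hconst : ∀ g i τ, D τ → D ((u i)⁻¹ * τ) → δ g i τ = δ g i 1 := by
      intro g i τ h2 h3
      refine (hD.inter_translate (hu' i)).induction (P := fun τ => δ g i τ = δ g i 1) rfl ?_
        ⟨h2, h3⟩
      rintro p ⟨b, _ | _⟩ ⟨d1, d2⟩ ⟨d3, d4⟩ ih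
      · rw [letter_false] at *
        have := hstep g i (p * (FreeGroup.of b)⁻¹) b d3 (by simpa using d1) d4
          (by simpa using d2)
        rw [inv_mul_cancel_right] at this
        rw [this, ih]
      · rw [letter_true] at *
        rw [← hstep g i p b d1 d3 d2 d4, ih]
    obtain ⟨ψ, hψ⟩ := exists_primitive fun g i => δ g i 1
    refine ⟨fun v => θ v.g v.l + ψ v.g, ?_⟩
    rintro ⟨g, τ, b | i⟩ ⟨h2, h3⟩
    · change c _ = θ g τ + ψ g + (θ g (τ * FreeGroup.of b) + ψ g)
      rw [hθ' g τ b h2 h3]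
      linear_combination - two (θ g τ) - two (ψ g)
    · change c _ = θ g τ + ψ g + (θ (g * FreeGroup.of i) ((u i)⁻¹ * τ) + ψ (g * FreeGroup.of i))
      rw [hψ, ← hconst g i τ h2 h3]
      simp only [δ]
      linear_combination - two (ψ g) - two (θ g τ) - two (θ (g * FreeGroup.of i) ((u i)⁻¹ * τ))

open FreeWord SqComplex

variable {α β : Type*} [DecidableEq α] [DecidableEq β] (f : FreeGroup α →* FreeGroup β)

/-- Prefixes of images of elements of a ball. -/
def ballPrefixes (ρ : ℕ) (p : FreeGroup β) : Prop := ∃ g : FreeGroup α, g.norm ≤ ρ ∧ Prefix p (f g)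

/-- Local edges of the tracks of the elements of `Kw`. -/
def trackEdges (Kw : Set (FreeGroup α)) : Set (LEdge α β) :=
  {l | match l.2 with
    | .inl b => ∃ k ∈ Kw, Prefix l.1 (f k⁻¹) ∧ Prefix (l.1 * FreeGroup.of b) (f k⁻¹)
    | .inr i => ∃ k ∈ Kw, ∃ g, Prefix g k ∧ Prefix (g * FreeGroup.of i) k ∧ l.1 = (f g)⁻¹}

theorem prefixClosed_prefixes {γ : Type*} [DecidableEq γ] (w : FreeGroup γ) :
    PrefixClosed fun p => Prefix p w := fun _ _ h hs => h.mul_letter hs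

theorem prefixClosed_ballPrefixes (ρ : ℕ) : PrefixClosed (ballPrefixes f ρ) := by
  rintro p s ⟨g, hg, h⟩ hs
  exact ⟨g, hg, h.mul_letter hs⟩

variable {f}

theorem ballPrefixes_apply {ρ : ℕ} {g : FreeGroup α} (h : g.norm ≤ ρ) : ballPrefixes f ρ (f g) :=
  ⟨g, h, Prefix.refl _⟩

theorem trackEdges_subset_span {Kw : Set (FreeGroup α)} {ρ : ℕ} (hK : ∀ k ∈ Kw, k.norm ≤ ρ) :
    trackEdges f Kw ⊆ span f (ballPrefixes f ρ) := by
  rintro ⟨τ, b | i⟩ hl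
  · obtain ⟨k, hk, h1, h2⟩ := hl
    have := hK k hk
    rw [← FreeGroup.norm_inv_eq] at this
    exact ⟨⟨_, this, h1⟩, ⟨_, this, h2⟩⟩
  · obtain ⟨k, hk, g, h1, h2, h3⟩ := hl
    have h3 : τ = (f g)⁻¹ := h3
    have := hK k hk
    subst h3
    refine ⟨?_, ?_⟩
    · change ballPrefixes f ρ (f g)⁻¹
      rw [← map_inv]
      refine ballPrefixes_apply ?_
      rw [FreeGroup.norm_inv_eq]; exact h1.norm_le.trans this
    · change ballPrefixes f ρ ((f (FreeGroup.of i))⁻¹ * (f g)⁻¹)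
      rw [← mul_inv_rev, ← map_mul, ← map_inv]
      refine ballPrefixes_apply ?_
      rw [FreeGroup.norm_inv_eq]; exact h2.norm_le.trans this

theorem rtg_track_vertical {Kw : Set (FreeGroup α)} {k g : FreeGroup α} (hk : k ∈ Kw)
    (hg : Prefix g k) :
    Relation.ReflTransGen ((prodComplex f).Adj (liftEdges (trackEdges f Kw))) ⟨1, 1⟩
      ⟨g, (f g)⁻¹⟩ := by
  refine (prefixClosed_prefixes k).induction (P := fun g =>
    Relation.ReflTransGen ((prodComplex f).Adj (liftEdges (trackEdges f Kw))) ⟨1, 1⟩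
      ⟨g, (f g)⁻¹⟩) ?_ ?_ hg
  · rw [map_one, inv_one]
  · rintro p ⟨b, _ | _⟩ h1 h2 h3
    · rw [letter_false] at *
      refine h3.tail ?_
      have := adj_vertical f (S := trackEdges f Kw) (p * (FreeGroup.of b)⁻¹)
        (f (p * (FreeGroup.of b)⁻¹))⁻¹ b ⟨k, hk, _, h2, by simpa using h1, rfl⟩
      simpa using this
    · rw [letter_true] at *
      refine h3.tail ?_
      have := adj_vertical f (S := trackEdges f Kw) p (f p)⁻¹ b ⟨k, hk, _, h1, h2, rfl⟩
      have := this.symm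
      simpa using this

theorem rtg_track_horizontal {Kw : Set (FreeGroup α)} {k : FreeGroup α} (hk : k ∈ Kw)
    {p : FreeGroup β} (hp : Prefix p (f k⁻¹)) (g : FreeGroup α) :
    Relation.ReflTransGen ((prodComplex f).Adj (liftEdges (trackEdges f Kw))) ⟨g, 1⟩ ⟨g, p⟩ :=
  rtg_horizontal f (prefixClosed_prefixes (f k⁻¹)) (fun τ b h h' => show (τ, .inl b) ∈ trackEdges f Kw from ⟨k, hk, h, h'⟩) g hp

theorem rtg_track {Kw : Set (FreeGroup α)} {k : FreeGroup α} (hk : k ∈ Kw) :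
    Relation.ReflTransGen ((prodComplex f).Adj (liftEdges (trackEdges f Kw))) ⟨1, 1⟩ ⟨k, 1⟩ := by
  refine (rtg_track_vertical hk (Prefix.refl k)).trans (rtg_adj_symm ?_)
  rw [← map_inv]
  exact rtg_track_horizontal hk (Prefix.refl _) k

theorem rtg_track_pt {Kw : Set (FreeGroup α)} (e : Tr (FreeGroup α) (LEdge α β)) (ε : Bool)
    (he : liftEdges (trackEdges f Kw) e) : ∃ g : FreeGroup α,
    Relation.ReflTransGen ((prodComplex f).Adj (liftEdges (trackEdges f Kw)))
      (g • (⟨1, 1⟩ : Tr (FreeGroup α) (FreeGroup β))) ((prodComplex f).pt e ε) := by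
  obtain ⟨h, τ, b | i⟩ := e
  · obtain ⟨k, hk, h1, h2⟩ := he
    refine ⟨h, ?_⟩
    rw [Tr.smul_mk, mul_one]
    cases ε
    · exact rtg_track_horizontal hk h1 h
    · exact rtg_track_horizontal hk h2 h
  · obtain ⟨k, hk, g, h1, h2, h3⟩ := he
    have h3 : τ = (f g)⁻¹ := h3
    subst h3
    refine ⟨h * g⁻¹, ?_⟩
    cases ε
    · have := rtg_adj_smul (liftEdges_smul _) (h * g⁻¹) (rtg_track_vertical (f := f) hk h1)
      simp only [Tr.smul_mk, inv_mul_cancel_right] at this ⊢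
      exact this
    · have := rtg_adj_smul (liftEdges_smul _) (h * g⁻¹) (rtg_track_vertical (f := f) hk h2)
      simp only [Tr.smul_mk] at this ⊢
      rw [← mul_assoc, inv_mul_cancel_right, map_mul, mul_inv_rev] at this
      exact this

section Finite

variable [Finite α]

theorem finite_ballPrefixes (f : FreeGroup α →* FreeGroup β) {ρ lam : ℕ}
    (hl : ∀ i, (f (FreeGroup.of i)).norm ≤ lam) :
    {p | ballPrefixes f ρ p}.Finite ∧
      {p | ballPrefixes f ρ p}.ncard ≤ {g : FreeGroup α | g.norm ≤ ρ}.ncard * (ρ * lam + 1) := by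
  have hn : ∀ g : FreeGroup α, (f g).norm ≤ g.norm * lam := by
    intro g
    induction h : g.norm using Nat.strong_induction_on generalizing g with
    | _ n ih =>
      by_cases h1 : g = 1
      · subst h1; simp
      · obtain ⟨s, hs⟩ := exists_letter h1
        have h2 := ih _ (by omega) (g * letter s) rfl
        have h3 := FreeGroup.norm_mul_le (f (g * letter s)) (f (letter s)⁻¹)
        rw [← map_mul, mul_inv_cancel_right, map_inv, FreeGroup.norm_inv_eq] at h3
        have h4 : (f (letter s)).norm ≤ lam := by
          obtain ⟨i, _ | _⟩ := s
          · rw [letter_false, map_inv, FreeGroup.norm_inv_eq]; exact hl i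
          · exact hl i
        have h5 : n = (g * letter s).norm + 1 := by omega
        rw [h5, add_mul, one_mul]
        omega
  choose! σ h1 h2 using fun p (hp : ballPrefixes f ρ p) => hp
  have hfin : ({g : FreeGroup α | g.norm ≤ ρ} ×ˢ Set.Iio (ρ * lam + 1)).Finite :=
    (finite_ball ρ).prod (Set.finite_Iio _)
  have hmap : ∀ p ∈ {p | ballPrefixes f ρ p}, (σ p, p.norm) ∈
      ({g : FreeGroup α | g.norm ≤ ρ} ×ˢ Set.Iio (ρ * lam + 1)) := by
    intro p hp
    refine ⟨h1 p hp, ?_⟩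
    have := (h2 p hp).norm_le
    have := hn (σ p)
    have := Nat.mul_le_mul_right lam (h1 p hp)
    simp only [Set.mem_Iio]
    omega
  have hinj : Set.InjOn (fun p => (σ p, p.norm)) {p | ballPrefixes f ρ p} := by
    intro p hp q hq h
    simp only [Prod.mk.injEq] at h
    have hp' := h2 p hp
    have hq' := h2 q hq
    rw [← h.1] at hq'
    exact (hp'.norm_inv_mul hq' h.2.le).eq_of_norm_le h.2.ge
  refine ⟨Set.Finite.of_injOn hmap hinj hfin, ?_⟩
  refine (Set.ncard_le_ncard_of_injOn _ hmap hinj hfin).trans_eq ?_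
  rw [Set.ncard_prod, Set.ncard_eq_toFinset_card' (Set.Iio _)]
  simp

omit [DecidableEq α] [DecidableEq β] in
theorem finite_span [Finite β] {D : FreeGroup β → Prop} (hD : {p | D p}.Finite) :
    (span f D).Finite :=
  (hD.prod (Set.finite_univ (α := β ⊕ α))).subset fun _ hl => ⟨hl.1, trivial⟩

/-- Special edges, and edges not lying in exactly two squares, of a minimal core. -/
theorem exists_minimal_core [Finite β] {F : Type*} [Group F] (j : FreeGroup α →* F)
    (hj : Function.Injective j) {Kw : Set (FreeGroup α)} {ρ lam : ℕ} (hρ : 1 ≤ ρ)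
    (hK : ∀ k ∈ Kw, k.norm ≤ ρ)
    (hrig : ∀ (c : FreeGroup α) (P : Subgroup (FreeGroup α)), StepOver (j c) (P.map j) j.range → (∀ k ∈ Kw, k ∈ P) → P = ⊤)
    (hl : ∀ i, (f (FreeGroup.of i)).norm ≤ lam) :
    ∃ EL ⊆ span f (ballPrefixes f ρ), trackEdges f Kw ⊆ EL ∧
      (∀ e, liftEdges EL e → ¬ liftEdges (trackEdges f Kw) e → ∃ x y, x ≠ y ∧
        (prodComplex f).Dart (liftEdges EL) e x ∧ (prodComplex f).Dart (liftEdges EL) e y) ∧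
      ∀ g : FreeGroup α, Relation.ReflTransGen ((prodComplex f).Adj
        ((prodComplex f).Branch (liftEdges (trackEdges f Kw)) (liftEdges EL))) ⟨1, 1⟩ ⟨g, 1⟩ := by
  have hZ := trackEdges_subset_span (f := f) hK
  have hcore := isCore_span f (prefixClosed_ballPrefixes f ρ) ⟨1, by simp, prefix_one_left _⟩
    (fun i => ballPrefixes_apply (by rw [FreeGroup.norm_of]; exact hρ))
    (fun i => by
      rw [← map_inv]
      exact ballPrefixes_apply (by rw [FreeGroup.norm_inv_eq, FreeGroup.norm_of]; exact hρ)) hZ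
  have hfin : {E | E ⊆ span f (ballPrefixes f ρ) ∧ (prodComplex f).IsCore
      (liftEdges (trackEdges f Kw)) (liftEdges E) ⟨1, 1⟩}.Finite :=
    (finite_span (finite_ballPrefixes f hl).1).finite_subsets.subset fun _ h => h.1
  obtain ⟨EL, hEL⟩ := hfin.exists_minimal ⟨_, subset_rfl, hcore⟩
  obtain ⟨h1, h2⟩ := hEL.prop
  have := h2.minimal_of_rigid j hj (fun g v h => Tr.eq_one_of_smul_eq h)
    (fun g v h => Tr.eq_one_of_smul_eq h) (fun g => mul_self_eq_one)
    (liftEdges_smul _) (fun e ε h => rtg_track_pt e ε h) (fun c P hs hP => hrig c P hs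
      fun k hk => hP k (by
        rw [Tr.smul_mk, mul_one]
        exact rtg_track hk)) (by
      intro ES' hES' hsub e he
      have hlift : ∀ e, ES' e ↔ liftEdges {l | ES' ⟨1, l⟩} e := by
        rintro ⟨g, l⟩
        have := hES'.inv g ⟨1, l⟩
        rw [Tr.smul_mk, mul_one] at this
        exact this
      have heq : ES' = liftEdges {l | ES' ⟨1, l⟩} := funext fun e => propext (hlift e)
      have hle : {l | ES' ⟨1, l⟩} ⊆ EL := fun l hl => hsub ⟨1, l⟩ hl
      have := hEL.le_of_le (y := {l | ES' ⟨1, l⟩}) ⟨hle.trans h1, heq ▸ hES'⟩ hle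
      exact (hlift e).2 (this he))
  refine ⟨EL, h1, fun l hl => h2.sub ⟨1, l⟩ hl, this.1, fun g => ?_⟩
  have := this.2 g
  rwa [Tr.smul_mk, mul_one] at this

end Finite

open FreeWord SqComplex

variable {α β : Type*} [DecidableEq α] [DecidableEq β] {f : FreeGroup α →* FreeGroup β}

/-- The number of vertical edges of a finite set of local edges. -/
def numVert (E : Finset (LEdge α β)) : ℕ := (E.filter fun l => l.2.isRight = true).card

/-- The number of horizontal edges of a finite set of local edges. -/
def numHor (E : Finset (LEdge α β)) : ℕ := (E.filter fun l => l.2.isLeft = true).card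

variable (f) in
/-- The elements moving the base vertex close to the vertices over `τ`. -/
def Near (a b : ℕ) (τ : FreeGroup β) (g : FreeGroup α) : Prop := g.norm ≤ a ∧ (f g * τ).norm ≤ b

theorem Near.mono {a a' b b' : ℕ} {τ : FreeGroup β} {g : FreeGroup α} (h : Near f a b τ g)
    (ha : a ≤ a') (hb : b ≤ b') : Near f a' b' τ g := ⟨h.1.trans ha, h.2.trans hb⟩

theorem near_step (e : Tr (FreeGroup α) (LEdge α β)) (ε : Bool) {a b : ℕ} {x : FreeGroup α}
    (hx : Near f a b ((prodComplex f).pt e ε).l x) :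
    Near f (a + if e.l.2.isRight = true then 1 else 0) (b + if e.l.2.isLeft = true then 1 else 0)
      ((prodComplex f).pt e !ε).l
      (x * (((prodComplex f).pt e ε).g⁻¹ * ((prodComplex f).pt e !ε).g)) := by
  obtain ⟨h, τ, c | i⟩ := e
  · have h1 : ∀ y : FreeGroup β, (y * FreeGroup.of c).norm ≤ y.norm + 1 := fun y =>
      (FreeGroup.norm_mul_le _ _).trans (by rw [FreeGroup.norm_of])
    have h2 : ∀ y : FreeGroup β, y.norm ≤ (y * FreeGroup.of c).norm + 1 := fun y => by
      have := FreeGroup.norm_mul_le (y * FreeGroup.of c) (FreeGroup.of c)⁻¹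
      rwa [mul_inv_cancel_right, FreeGroup.norm_inv_eq, FreeGroup.norm_of] at this
    obtain ⟨h3, h4⟩ := hx
    cases ε
    · change (f x * τ).norm ≤ b at h4
      refine ⟨?_, ?_⟩
      · change (x * (h⁻¹ * h)).norm ≤ a + 0
        simpa using h3
      · change (f (x * (h⁻¹ * h)) * (τ * FreeGroup.of c)).norm ≤ b + 1
        rw [inv_mul_cancel, mul_one, ← mul_assoc]
        exact (h1 _).trans (by omega)
    · change (f x * (τ * FreeGroup.of c)).norm ≤ b at h4
      refine ⟨?_, ?_⟩
      · change (x * (h⁻¹ * h)).norm ≤ a + 0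
        simpa using h3
      · change (f (x * (h⁻¹ * h)) * τ).norm ≤ b + 1
        rw [inv_mul_cancel, mul_one]
        rw [← mul_assoc] at h4
        exact (h2 _).trans (by omega)
  · obtain ⟨h3, h4⟩ := hx
    cases ε
    · change (f x * τ).norm ≤ b at h4
      refine ⟨?_, ?_⟩
      · change (x * (h⁻¹ * (h * FreeGroup.of i))).norm ≤ a + 1
        rw [inv_mul_cancel_left]
        exact (FreeGroup.norm_mul_le _ _).trans (by rw [FreeGroup.norm_of]; omega)
      · change (f (x * (h⁻¹ * (h * FreeGroup.of i))) * ((f (FreeGroup.of i))⁻¹ * τ)).norm ≤ b + 0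
        rw [inv_mul_cancel_left, map_mul]
        simpa [mul_assoc] using h4
    · change (f x * ((f (FreeGroup.of i))⁻¹ * τ)).norm ≤ b at h4
      refine ⟨?_, ?_⟩
      · change (x * ((h * FreeGroup.of i)⁻¹ * h)).norm ≤ a + 1
        rw [mul_inv_rev, inv_mul_cancel_right]
        exact (FreeGroup.norm_mul_le _ _).trans (by
          rw [FreeGroup.norm_inv_eq, FreeGroup.norm_of]; omega)
      · change (f (x * ((h * FreeGroup.of i)⁻¹ * h)) * τ).norm ≤ b + 0
        rw [mul_inv_rev, inv_mul_cancel_right, map_mul, map_inv, mul_assoc]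
        exact h4

omit [DecidableEq α] [DecidableEq β] in
theorem pt_l (f : FreeGroup α →* FreeGroup β) (e : Tr (FreeGroup α) (LEdge α β)) (ε : Bool) :
    ((prodComplex f).pt e ε).l = ((prodComplex f).pt ⟨1, e.l⟩ ε).l := by
  obtain ⟨h, τ, b | i⟩ := e <;> cases ε <;> rfl

theorem numVert_insert {E : Finset (LEdge α β)} {l : LEdge α β} (h : l ∉ E) :
    numVert (insert l E) = numVert E + if l.2.isRight = true then 1 else 0 := by
  unfold numVert
  rw [Finset.filter_insert]
  split_ifs
  · rw [Finset.card_insert_of_notMem (by simp [h])]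
  · rfl

theorem numHor_insert {E : Finset (LEdge α β)} {l : LEdge α β} (h : l ∉ E) :
    numHor (insert l E) = numHor E + if l.2.isLeft = true then 1 else 0 := by
  unfold numHor
  rw [Finset.filter_insert]
  split_ifs
  · rw [Finset.card_insert_of_notMem (by simp [h])]
  · rfl

/-- Every vertex reachable along the edges of `E` is near the base vertex. -/
theorem exists_near (E : Finset (LEdge α β)) {v : Tr (FreeGroup α) (FreeGroup β)}
    (hv : Relation.ReflTransGen ((prodComplex f).Adj (liftEdges ↑E)) ⟨1, 1⟩ v) :
    ∃ g, Near f (numVert E) (numHor E) v.l g := by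
  let S : Finset (LEdge α β) → FreeGroup β → Prop := fun E' τ =>
    τ = 1 ∨ ∃ l ∈ E', ∃ ε, τ = ((prodComplex f).pt ⟨1, l⟩ ε).l
  let Q : Finset (LEdge α β) → Prop := fun E' => ∀ τ, S E' τ →
    ∃ g, Near f (numVert E') (numHor E') τ g
  have hfin : {E' | E' ⊆ E ∧ Q E'}.Finite :=
    (Finset.finite_toSet E.powerset).subset fun E' h => Finset.mem_powerset.2 h.1
  obtain ⟨E', hE'⟩ := hfin.exists_maximal ⟨∅, Finset.empty_subset _, by
    rintro τ (rfl | ⟨l, hl, -⟩)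
    · exact ⟨1, by simp, by simp⟩
    · simp at hl⟩
  obtain ⟨h1, h2⟩ := hE'.prop
  have hS : S E' v.l := by
    induction hv with
    | refl => exact Or.inl rfl
    | tail _ hadj ih =>
      obtain ⟨e, ε, he, rfl, rfl⟩ := hadj
      by_contra hcon
      have hl : e.l ∉ E' := fun hl => hcon (Or.inr ⟨e.l, hl, !ε, pt_l f e _⟩)
      refine hl (hE'.le_of_ge (y := insert e.l E') ⟨Finset.insert_subset he h1, ?_⟩
        (Finset.subset_insert _ _) (Finset.mem_insert_self _ _))
      have hold : ∀ τ, S E' τ → ∃ g, Near f (numVert (insert e.l E')) (numHor (insert e.l E')) τ g := by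
        intro τ hτ
        obtain ⟨g, hg⟩ := h2 τ hτ
        refine ⟨g, hg.mono ?_ ?_⟩
        · rw [numVert_insert hl]; omega
        · rw [numHor_insert hl]; omega
      rintro τ (rfl | ⟨l, hl', ε', rfl⟩)
      · exact hold _ (Or.inl rfl)
      · rcases Finset.mem_insert.1 hl' with rfl | hl'
        · rw [← pt_l]
          by_cases hε : ε' = ε
          · rw [hε]; exact hold _ ih
          · rw [show ε' = !ε by revert hε; cases ε <;> cases ε' <;> simp]
            obtain ⟨x, hx⟩ := h2 _ ih
            refine ⟨_, (near_step e ε hx).mono ?_ ?_⟩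
            · rw [numVert_insert hl]
            · rw [numHor_insert hl]
        · exact hold _ (Or.inr ⟨l, hl', ε', rfl⟩)
  obtain ⟨g, hg⟩ := h2 _ hS
  exact ⟨g, hg.mono (Finset.card_le_card (Finset.filter_subset_filter _ h1))
    (Finset.card_le_card (Finset.filter_subset_filter _ h1))⟩

/-- If a finite set of local edges spans a connected graph, then the elements with small
displacements generate. -/
theorem closure_eq_top (E : Finset (LEdge α β))
    (hconn : ∀ g : FreeGroup α, Relation.ReflTransGen ((prodComplex f).Adj (liftEdges ↑E))
      ⟨1, 1⟩ ⟨g, 1⟩) :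
    Subgroup.closure {w : FreeGroup α | w.norm ≤ 2 * numVert E + 1 ∧
      (f w).norm ≤ 2 * numHor E + 1} = ⊤ := by
  set W := {w : FreeGroup α | w.norm ≤ 2 * numVert E + 1 ∧ (f w).norm ≤ 2 * numHor E + 1}
  have key : ∀ v, Relation.ReflTransGen ((prodComplex f).Adj (liftEdges ↑E)) ⟨1, 1⟩ v →
      ∃ x, Near f (numVert E) (numHor E) v.l x ∧ v.g * x⁻¹ ∈ Subgroup.closure W := by
    intro v hv
    induction hv with
    | refl => exact ⟨1, ⟨by simp, by simp⟩, by simp [one_mem]⟩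
    | tail hp hadj ih =>
      obtain ⟨y, hy⟩ := exists_near E (hp.tail hadj)
      obtain ⟨e, ε, he, rfl, rfl⟩ := hadj
      obtain ⟨x, hx, hx'⟩ := ih
      refine ⟨y, hy, ?_⟩
      have h1 := near_step e ε hx
      set s := ((prodComplex f).pt e ε).g⁻¹ * ((prodComplex f).pt e !ε).g with hs
      have h2 : x * s * y⁻¹ ∈ Subgroup.closure W := by
        refine Subgroup.subset_closure ⟨?_, ?_⟩
        · have h3 := FreeGroup.norm_mul_le (x * s) y⁻¹
          have h4 := h1.1
          have h5 := hy.1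
          rw [FreeGroup.norm_inv_eq] at h3
          split_ifs at h4 <;> omega
        · have h3 := FreeGroup.norm_mul_le (f (x * s) * ((prodComplex f).pt e !ε).l)
            (f y * ((prodComplex f).pt e !ε).l)⁻¹
          have h4 := h1.2
          have h5 := hy.2
          rw [FreeGroup.norm_inv_eq] at h3
          rw [show f (x * s) * ((prodComplex f).pt e !ε).l * (f y * ((prodComplex f).pt e !ε).l)⁻¹
            = f (x * s * y⁻¹) by rw [map_mul f (x * s), map_inv]; group] at h3
          split_ifs at h4 <;> omega
      have h3 := mul_mem hx' h2
      rwa [show ((prodComplex f).pt e ε).g * x⁻¹ * (x * s * y⁻¹) =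
        ((prodComplex f).pt e !ε).g * y⁻¹ by rw [hs]; group] at h3
  refine (Subgroup.eq_top_iff' _).2 fun g => ?_
  obtain ⟨x, hx, hx'⟩ := key _ (hconn g)
  have h1 : x ∈ W := by
    obtain ⟨h1, h2⟩ := hx
    rw [mul_one] at h2
    exact ⟨by omega, by omega⟩
  have := mul_mem hx' (Subgroup.subset_closure h1)
  rwa [inv_mul_cancel_right] at this

open FreeWord SqComplex

variable {α β : Type*} [DecidableEq α] [DecidableEq β] (f : FreeGroup α →* FreeGroup β)

/-- The occurrence of a horizontal edge as a side of a square in the direction of a letter. -/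
def horDart (g : FreeGroup α) (v : FreeGroup β × β) :
    α × Bool → Tr (FreeGroup α) (LSquare α β) × Bool × Bool
  | (i, true) => (⟨g, (v.1, i, v.2)⟩, false, false)
  | (i, false) => (⟨g * (FreeGroup.of i)⁻¹, (f (FreeGroup.of i) * v.1, i, v.2)⟩, false, true)

/-- The occurrence of a vertical edge as a side of a square in the direction of a letter. -/
def vertDart (g : FreeGroup α) (v : FreeGroup β × α) :
    β × Bool → Tr (FreeGroup α) (LSquare α β) × Bool × Bool
  | (b, true) => (⟨g, (v.1, v.2, b)⟩, true, false)
  | (b, false) => (⟨g, (v.1 * (FreeGroup.of b)⁻¹, v.2, b)⟩, true, true)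

/-- The local square is full. -/
def LFull (EL : Set (LEdge α β)) (q : LSquare α β) : Prop :=
  (prodComplex f).Full (liftEdges EL) ⟨1, q⟩

/-- The letters along which a horizontal edge may be moved. -/
def HorAllowed (EL : Set (LEdge α β)) (v : FreeGroup β × β) (s : α × Bool) : Prop :=
  LFull f EL (horDart f 1 v s).1.l

/-- The letters along which a vertical edge may be moved. -/
def VertAllowed (EL : Set (LEdge α β)) (v : FreeGroup β × α) (s : β × Bool) : Prop :=
  LFull f EL (vertDart 1 v s).1.l

variable {f}

omit [DecidableEq α] [DecidableEq β] in
theorem full_iff_lFull {EL : Set (LEdge α β)} (q : Tr (FreeGroup α) (LSquare α β)) :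
    (prodComplex f).Full (liftEdges EL) q ↔ LFull f EL q.l := by
  have := full_smul (K := prodComplex f) (liftEdges_smul EL) q.g ⟨1, q.l⟩
  rwa [Tr.smul_mk, mul_one] at this

omit [DecidableEq α] [DecidableEq β] in
theorem horDart_injective (g : FreeGroup α) (v : FreeGroup β × β) :
    Function.Injective (horDart f g v) := by
  rintro ⟨i, _ | _⟩ ⟨i', _ | _⟩ h <;> simp [horDart] at h ⊢
  · exact h.2.2
  · exact h

omit [DecidableEq α] [DecidableEq β] in
theorem vertDart_injective (g : FreeGroup α) (v : FreeGroup β × α) :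
    Function.Injective (vertDart g v) := by
  rintro ⟨i, _ | _⟩ ⟨i', _ | _⟩ h <;> simp [vertDart] at h ⊢
  · exact h.2
  · exact h

omit [DecidableEq α] [DecidableEq β] in
theorem dart_hor_iff {EL : Set (LEdge α β)} (g : FreeGroup α) (v : FreeGroup β × β)
    (x : Tr (FreeGroup α) (LSquare α β) × Bool × Bool) :
    (prodComplex f).Dart (liftEdges EL) ⟨g, (v.1, .inl v.2)⟩ x ↔
      ∃ s, HorAllowed f EL v s ∧ x = horDart f g v s := by
  obtain ⟨τ, b⟩ := v
  constructor
  · rintro ⟨h1, h2⟩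
    rw [full_iff_lFull] at h1
    obtain ⟨⟨h, τ', i, b'⟩, d, ε⟩ := x
    cases d <;> cases ε
    · simp only [prodComplex, Tr.mk.injEq, Prod.mk.injEq, Sum.inl.injEq] at h2
      obtain ⟨rfl, rfl, rfl⟩ := h2
      exact ⟨(i, true), h1, rfl⟩
    · simp only [prodComplex, Tr.mk.injEq, Prod.mk.injEq, Sum.inl.injEq] at h2
      obtain ⟨rfl, rfl, rfl⟩ := h2
      refine ⟨(i, false), ?_, ?_⟩
      · simpa [HorAllowed, horDart] using h1
      · simp [horDart]
    · simp [prodComplex] at h2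
    · simp [prodComplex] at h2
  · rintro ⟨⟨i, _ | _⟩, h1, rfl⟩
    · exact ⟨(full_iff_lFull _).2 h1, by simp [horDart, prodComplex]⟩
    · exact ⟨(full_iff_lFull _).2 h1, rfl⟩

omit [DecidableEq α] [DecidableEq β] in
theorem dart_vert_iff {EL : Set (LEdge α β)} (g : FreeGroup α) (v : FreeGroup β × α)
    (x : Tr (FreeGroup α) (LSquare α β) × Bool × Bool) :
    (prodComplex f).Dart (liftEdges EL) ⟨g, (v.1, .inr v.2)⟩ x ↔
      ∃ s, VertAllowed f EL v s ∧ x = vertDart g v s := by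
  obtain ⟨τ, b⟩ := v
  constructor
  · rintro ⟨h1, h2⟩
    rw [full_iff_lFull] at h1
    obtain ⟨⟨h, τ', i, b'⟩, d, ε⟩ := x
    cases d <;> cases ε
    · simp [prodComplex] at h2
    · simp [prodComplex] at h2
    · simp only [prodComplex, Tr.mk.injEq, Prod.mk.injEq, Sum.inr.injEq] at h2
      obtain ⟨rfl, rfl, rfl⟩ := h2
      exact ⟨(b', true), h1, rfl⟩
    · simp only [prodComplex, Tr.mk.injEq, Prod.mk.injEq, Sum.inr.injEq] at h2
      obtain ⟨rfl, rfl, rfl⟩ := h2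
      refine ⟨(b', false), ?_, ?_⟩
      · simpa [VertAllowed, vertDart] using h1
      · simp [vertDart]
  · rintro ⟨⟨i, _ | _⟩, h1, rfl⟩
    · exact ⟨(full_iff_lFull _).2 h1, by simp [vertDart, prodComplex]⟩
    · exact ⟨(full_iff_lFull _).2 h1, rfl⟩

omit [DecidableEq α] [DecidableEq β] in
theorem lFull_iff {EL : Set (LEdge α β)} {τ : FreeGroup β} {i : α} {b : β} :
    LFull f EL (τ, i, b) ↔ ((τ, .inl b) ∈ EL ∧ ((f (FreeGroup.of i))⁻¹ * τ, .inl b) ∈ EL) ∧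
      (τ, .inr i) ∈ EL ∧ (τ * FreeGroup.of b, .inr i) ∈ EL := by
  constructor
  · intro h
    exact ⟨⟨h false false, h false true⟩, h true false, h true true⟩
  · rintro ⟨⟨h1, h2⟩, h3, h4⟩ (_ | _) (_ | _)
    exacts [h1, h2, h3, h4]

omit [DecidableEq α] [DecidableEq β] in
theorem HorAllowed.move {EL : Set (LEdge α β)} {v : FreeGroup β × β} {s : α × Bool}
    (h : HorAllowed f EL v s) : (v.1, .inl v.2) ∈ EL ∧
      HorAllowed f EL ((f (letter s))⁻¹ * v.1, v.2) (s.1, !s.2) := by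
  obtain ⟨τ, b⟩ := v
  obtain ⟨i, _ | _⟩ := s
  · refine ⟨?_, ?_⟩
    · simpa using (lFull_iff.1 h).1.2
    · rw [letter_false, map_inv, inv_inv]; exact h
  · refine ⟨(lFull_iff.1 h).1.1, ?_⟩
    rw [letter_true]
    simpa [HorAllowed, horDart] using h

omit [DecidableEq α] [DecidableEq β] in
theorem VertAllowed.move {EL : Set (LEdge α β)} {v : FreeGroup β × α} {s : β × Bool}
    (h : VertAllowed f EL v s) : (v.1 * letter s, .inr v.2) ∈ EL := by
  obtain ⟨τ, i⟩ := v
  obtain ⟨b, _ | _⟩ := s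
  · rw [letter_false]; exact (lFull_iff.1 h).2.1
  · rw [letter_true]; exact (lFull_iff.1 h).2.2

theorem two_le_card_of_param {ι X : Type*} [Fintype ι] {d : ι → X}
    {A : ι → Prop} [DecidablePred A] {P : X → Prop} (hP : ∀ x, P x ↔ ∃ s, A s ∧ x = d s)
    (h : ∃ x y, x ≠ y ∧ P x ∧ P y) : 2 ≤ (Finset.univ.filter A).card := by
  obtain ⟨x, y, hxy, hx, hy⟩ := h
  obtain ⟨s, hs, rfl⟩ := (hP _).1 hx
  obtain ⟨t, ht, rfl⟩ := (hP _).1 hy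
  exact Finset.one_lt_card.2 ⟨s, by simpa using hs, t, by simpa using ht, fun h => hxy (by rw [h])⟩

theorem exists_of_card_eq_two {ι X : Type*} [Fintype ι] {d : ι → X} (hd : Function.Injective d)
    {A : ι → Prop} [DecidablePred A] {P : X → Prop} (hP : ∀ x, P x ↔ ∃ s, A s ∧ x = d s)
    (h : (Finset.univ.filter A).card = 2) : ∃ x y, x ≠ y ∧ ∀ z, P z ↔ z = x ∨ z = y := by
  classical
  obtain ⟨s, t, hst, h⟩ := Finset.card_eq_two.1 h
  have hA : ∀ u, A u ↔ u = s ∨ u = t := fun u => by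
    have : u ∈ Finset.univ.filter A ↔ u ∈ ({s, t} : Finset ι) := by rw [h]
    simpa using this
  refine ⟨d s, d t, fun h => hst (hd h), fun z => ?_⟩
  rw [hP]
  constructor
  · rintro ⟨u, hu, rfl⟩
    rcases (hA u).1 hu with rfl | rfl
    exacts [Or.inl rfl, Or.inr rfl]
  · rintro (rfl | rfl)
    · exact ⟨s, (hA s).2 (Or.inl rfl), rfl⟩
    · exact ⟨t, (hA t).2 (Or.inr rfl), rfl⟩

/-- The vertical edges of a finite set of local edges. -/
noncomputable def vertEdges (E : Finset (LEdge α β)) : Finset (FreeGroup β × α) :=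
  E.preimage (fun v => (v.1, .inr v.2)) fun a _ b _ h => by
    simp only [Prod.mk.injEq, Sum.inr.injEq] at h; exact Prod.ext h.1 h.2

/-- The horizontal edges of a finite set of local edges. -/
noncomputable def horEdges (E : Finset (LEdge α β)) : Finset (FreeGroup β × β) :=
  E.preimage (fun v => (v.1, .inl v.2)) fun a _ b _ h => by
    simp only [Prod.mk.injEq, Sum.inl.injEq] at h; exact Prod.ext h.1 h.2

omit [DecidableEq α] [DecidableEq β] in
theorem mem_vertEdges {E : Finset (LEdge α β)} {v : FreeGroup β × α} :
    v ∈ vertEdges E ↔ (v.1, .inr v.2) ∈ E := Finset.mem_preimage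

omit [DecidableEq α] [DecidableEq β] in
theorem mem_horEdges {E : Finset (LEdge α β)} {v : FreeGroup β × β} :
    v ∈ horEdges E ↔ (v.1, .inl v.2) ∈ E := Finset.mem_preimage

theorem numVert_le (E : Finset (LEdge α β)) : numVert E ≤ (vertEdges E).card := by
  refine (Finset.card_le_card ?_).trans (Finset.card_image_le (s := vertEdges E)
    (f := fun v => ((v.1, .inr v.2) : LEdge α β)))
  rintro ⟨τ, b | i⟩ h
  · simp at h
  · exact Finset.mem_image.2 ⟨(τ, i), mem_vertEdges.2 (by simpa using h), rfl⟩

theorem numHor_le (E : Finset (LEdge α β)) : numHor E ≤ (horEdges E).card := by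
  refine (Finset.card_le_card ?_).trans (Finset.card_image_le (s := horEdges E)
    (f := fun v => ((v.1, .inl v.2) : LEdge α β)))
  rintro ⟨τ, b | i⟩ h
  · exact Finset.mem_image.2 ⟨(τ, b), mem_horEdges.2 (by simpa using h), rfl⟩
  · simp at h

section Vertical

variable [Fintype β]

open Classical in
/-- The degrees of the vertical edges sum up to at most twice their number. -/
theorem sum_vert_le (EL : Finset (LEdge α β)) :
    ∑ v ∈ vertEdges EL, (Finset.univ.filter (VertAllowed f ↑EL v)).card ≤
      2 * (vertEdges EL).card := by
  rw [← Finset.card_sigma]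
  set X := (vertEdges EL).sigma fun v => Finset.univ.filter (VertAllowed f ↑EL v)
  have hX : ∀ x ∈ X, (x.1.1, .inr x.1.2) ∈ EL ∧ VertAllowed f ↑EL x.1 x.2 := fun x hx => by
    simpa [X, mem_vertEdges] using hx
  let p : (Σ _ : FreeGroup β × α, β × Bool) → Prop := fun x =>
    (x.1.1 * letter x.2).norm + 1 = x.1.1.norm
  rw [← Finset.card_filter_add_card_filter_not p, two_mul]
  refine add_le_add ?_ ?_
  · refine Finset.card_le_card_of_injOn (fun x => x.1) ?_ ?_
    · intro x hx
      exact mem_vertEdges.2 (hX x (Finset.mem_filter.1 hx).1).1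
    · rintro ⟨v, s⟩ hx ⟨v', s'⟩ hy h
      have h : v = v' := h
      subst h
      have h1 := (Finset.mem_filter.1 hx).2
      have h2 := (Finset.mem_filter.1 hy).2
      have h3 : s = s' := letter_unique h1 h2
      rw [h3]
  · refine Finset.card_le_card_of_injOn (fun x => (x.1.1 * letter x.2, x.1.2)) ?_ ?_
    · intro x hx
      exact mem_vertEdges.2 (hX x (Finset.mem_filter.1 hx).1).2.move
    · have hk : ∀ (τ : FreeGroup β) (s : β × Bool), ¬ (τ * letter s).norm + 1 = τ.norm →
          (τ * letter s * letter (s.1, !s.2)).norm + 1 = (τ * letter s).norm := by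
        intro τ s h
        rw [← letter_inv, mul_inv_cancel_right]
        rcases norm_mul_letter τ s with h' | h'
        · exact h'.symm
        · exact absurd h' h
      rintro ⟨⟨τ, i⟩, s⟩ hx ⟨⟨τ', i'⟩, s'⟩ hy h
      obtain ⟨h, h'⟩ := Prod.mk.inj h
      have h : τ * letter s = τ' * letter s' := h
      have h' : i = i' := h'
      subst h'
      have h1 := hk _ _ (Finset.mem_filter.1 hx).2
      have h2 := hk _ _ (Finset.mem_filter.1 hy).2
      rw [← h] at h2
      have h3 := letter_unique h1 h2
      have h4 : s = s' := by
        simp only [Prod.mk.injEq, Bool.not_inj_iff] at h3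
        exact Prod.ext h3.1 h3.2
      subst h4
      have h5 : τ = τ' := mul_right_cancel h
      rw [h5]

open Classical in
theorem card_vert_branch_le (EL Z : Finset (LEdge α β))
    (htwo : ∀ v ∈ vertEdges EL, v ∉ vertEdges Z →
      2 ≤ (Finset.univ.filter (VertAllowed f ↑EL v)).card) :
    ((vertEdges EL).filter fun v => v ∈ vertEdges Z ∨
      (Finset.univ.filter (VertAllowed f ↑EL v)).card ≠ 2).card ≤ 3 * (vertEdges Z).card := by
  have h1 := sum_vert_le (f := f) EL
  have h2 : ∑ v ∈ vertEdges EL, (2 + if v ∈ vertEdges Z ∨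
      (Finset.univ.filter (VertAllowed f ↑EL v)).card ≠ 2 then 1 else 0) ≤
      ∑ v ∈ vertEdges EL, ((Finset.univ.filter (VertAllowed f ↑EL v)).card +
        3 * if v ∈ vertEdges Z then 1 else 0) := by
    refine Finset.sum_le_sum fun v hv => ?_
    by_cases hz : v ∈ vertEdges Z
    · rw [if_pos (Or.inl hz), if_pos hz]; omega
    · have := htwo v hv hz
      rw [if_neg hz]
      split_ifs with h
      · have := h.resolve_left hz
        omega
      · omega
  rw [Finset.sum_add_distrib, Finset.sum_add_distrib, Finset.sum_const, ← Finset.mul_sum,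
    ← Finset.card_filter, ← Finset.card_filter, smul_eq_mul] at h2
  have h3 : ((vertEdges EL).filter (· ∈ vertEdges Z)).card ≤ (vertEdges Z).card :=
    Finset.card_le_card fun v hv => (Finset.mem_filter.1 hv).2
  omega

end Vertical

section Growth

variable {X V : Type*} [Fintype X] [DecidableEq X] [DecidableEq V] (o : X → V)
  (inv : Equiv.Perm X)

/-- The other darts at the origin of a dart. -/
def siblings (x : X) : Finset X := Finset.univ.filter fun y => o y = o x ∧ y ≠ x

/-- The number of nonbacktracking paths of length `r` continuing the inverse of a dart; paths
end at dead ends. -/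
def pathCount : ℕ → X → ℕ
  | 0, _ => 1
  | r + 1, x => if siblings o x = ∅ then 1 else ∑ y ∈ siblings o x, pathCount r (inv y)

theorem one_le_pathCount (r : ℕ) (x : X) : 1 ≤ pathCount o inv r x := by
  induction r generalizing x with
  | zero => exact le_rfl
  | succ r ih =>
    rw [pathCount]
    split_ifs with h
    · exact le_rfl
    · obtain ⟨y, hy⟩ := Finset.nonempty_iff_ne_empty.2 h
      exact (ih (inv y)).trans (Finset.single_le_sum (f := fun y => pathCount o inv r (inv y))
        (fun _ _ => Nat.zero_le _) hy)

theorem sum_log_le {ι : Type*} (s : Finset ι) (hs : s.Nonempty) (c : ι → ℝ)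
    (hc : ∀ i ∈ s, 0 < c i) :
    ∑ i ∈ s, Real.log (c i) + s.card * Real.log s.card ≤ s.card * Real.log (∑ i ∈ s, c i) := by
  have hk : (0 : ℝ) < s.card := by exact_mod_cast hs.card_pos
  have hS : 0 < ∑ i ∈ s, c i := Finset.sum_pos hc hs
  set S := ∑ i ∈ s, c i
  have h1 : ∀ i ∈ s, Real.log (c i) ≤ Real.log (S / s.card) + (c i / (S / s.card) - 1) := by
    intro i hi
    have hm : 0 < S / s.card := div_pos hS hk
    have := Real.log_le_sub_one_of_pos (div_pos (hc i hi) hm)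
    rw [Real.log_div (hc i hi).ne' hm.ne'] at this
    linarith
  have h2 := Finset.sum_le_sum h1
  rw [Finset.sum_add_distrib, Finset.sum_const, Finset.sum_sub_distrib, ← Finset.sum_div,
    Finset.sum_const, nsmul_eq_mul, nsmul_eq_mul, Real.log_div hS.ne' hk.ne'] at h2
  have h3 : (∑ i ∈ s, c i) / (S / s.card) = s.card := by
    change S / (S / s.card) = s.card
    field_simp
  rw [h3] at h2
  linarith

theorem card_siblings (x : X) :
    (siblings o x).card + 1 = (Finset.univ.filter fun y => o y = o x).card := by
  rw [← Finset.card_erase_add_one (s := Finset.univ.filter fun y => o y = o x) (a := x) (by simp)]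
  congr 2
  ext y
  simp [siblings, and_comm]

theorem sum_siblings (x : X) (g : X → ℝ) :
    ∑ y ∈ siblings o x, g y = ∑ y with o y = o x, g y - g x := by
  rw [eq_sub_iff_add_eq, ← Finset.sum_erase_add (Finset.univ.filter fun y => o y = o x) g
    (a := x) (by simp)]
  congr 2
  ext y
  simp [siblings, and_comm]

theorem fiber_growth {r P : ℕ} (hP : ∀ x, pathCount o inv r x ≤ P) (v : V) (z : Prop) [Decidable z]
    (hz : (Finset.univ.filter fun y => o y = v).card = 1 → z) :
    ∑ x with o x = v, Real.log (pathCount o inv r (inv x)) +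
      (if 3 ≤ (Finset.univ.filter fun y => o y = v).card then 1 else 0) ≤
    ∑ x with o x = v, Real.log (pathCount o inv (r + 1) x) + (if z then Real.log P else 0) := by
  set d := (Finset.univ.filter fun y => o y = v).card with hd
  have hpos : ∀ r x, (0 : ℝ) < pathCount o inv r x := fun r x => by
    exact_mod_cast one_le_pathCount o inv r x
  have hlogP : 0 ≤ Real.log P := Real.log_natCast_nonneg P
  have hif : (0 : ℝ) ≤ if z then Real.log P else 0 := by split_ifs <;> simp [hlogP]
  have hnn : ∀ r x, 0 ≤ Real.log (pathCount o inv r x) := fun r x => Real.log_natCast_nonneg _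
  rcases Nat.lt_or_ge d 2 with h2 | h2
  · rw [if_neg (by omega), add_zero]
    have hsum : 0 ≤ ∑ x with o x = v, Real.log (pathCount o inv (r + 1) x) :=
      Finset.sum_nonneg fun x _ => hnn _ x
    rcases Nat.lt_or_ge d 1 with h1 | h1
    · have : (Finset.univ.filter fun y => o y = v) = ∅ := Finset.card_eq_zero.1 (by omega)
      rw [this]
      simpa using hif
    · rw [if_pos (hz (by omega))]
      obtain ⟨a, ha⟩ := Finset.card_eq_one.1 (show (Finset.univ.filter fun y => o y = v).card = 1 by
        omega)
      rw [ha, Finset.sum_singleton, Finset.sum_singleton]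
      have : Real.log (pathCount o inv r (inv a)) ≤ Real.log P :=
        Real.log_le_log (hpos _ _) (by exact_mod_cast hP _)
      have := hnn (r + 1) a
      linarith
  · have hx : ∀ x ∈ Finset.univ.filter fun y => o y = v,
        (∑ y with o y = v, Real.log (pathCount o inv r (inv y)) -
          Real.log (pathCount o inv r (inv x))) + ((d : ℝ) - 1) * Real.log ((d : ℝ) - 1) ≤
        ((d : ℝ) - 1) * Real.log (pathCount o inv (r + 1) x) := by
      intro x hx
      have hx : o x = v := (Finset.mem_filter.1 hx).2
      have hc := card_siblings o x
      rw [hx, ← hd] at hc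
      have hne : (siblings o x).Nonempty := Finset.card_pos.1 (by omega)
      have h3 := sum_log_le (siblings o x) hne (fun y => (pathCount o inv r (inv y) : ℝ))
        (fun _ _ => hpos _ _)
      rw [sum_siblings o x (fun y => Real.log (pathCount o inv r (inv y))), hx] at h3
      have h4 : ((siblings o x).card : ℝ) = (d : ℝ) - 1 := by
        rw [← hc]; push_cast; ring
      rw [h4] at h3
      rw [pathCount, if_neg hne.ne_empty]
      push_cast
      exact h3
    have h5 := Finset.sum_le_sum hx
    rw [← Finset.mul_sum, Finset.sum_add_distrib, Finset.sum_sub_distrib, Finset.sum_const,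
      Finset.sum_const, nsmul_eq_mul, nsmul_eq_mul, ← hd] at h5
    set A := ∑ y with o y = v, Real.log (pathCount o inv r (inv y))
    set B := ∑ y with o y = v, Real.log (pathCount o inv (r + 1) y)
    have hd2 : (2 : ℝ) ≤ d := by exact_mod_cast h2
    have h6 : ((d : ℝ) - 1) * (A + d * Real.log ((d : ℝ) - 1)) ≤ ((d : ℝ) - 1) * B := by
      linarith
    have h7 := le_of_mul_le_mul_left h6 (by linarith)
    have h8 : (if 3 ≤ d then (1 : ℝ) else 0) ≤ d * Real.log ((d : ℝ) - 1) := by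
      split_ifs with h
      · have hd3 : (3 : ℝ) ≤ d := by exact_mod_cast h
        have h9 : Real.log 2 ≤ Real.log ((d : ℝ) - 1) := Real.log_le_log (by norm_num) (by linarith)
        have h10 := Real.log_two_gt_d9
        nlinarith
      · exact mul_nonneg (by linarith) (Real.log_nonneg (by linarith))
    linarith

/-- Polynomially growing trees have few branch points. -/
theorem growth {r₀ P : ℕ} (hP : ∀ r ≤ r₀, ∀ x, pathCount o inv r x ≤ P) (VF Zf : Finset V)
    (ho : ∀ x, o x ∈ VF)
    (hz : ∀ v ∈ VF, (Finset.univ.filter fun y => o y = v).card = 1 → v ∈ Zf) :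
    (r₀ : ℝ) * (VF.filter fun v => 3 ≤ (Finset.univ.filter fun y => o y = v).card).card ≤
      (Fintype.card X + r₀ * Zf.card) * Real.log P := by
  set b := (VF.filter fun v => 3 ≤ (Finset.univ.filter fun y => o y = v).card).card
  have hlogP : 0 ≤ Real.log P := Real.log_natCast_nonneg P
  have hstep : ∀ r ≤ r₀, ∑ x, Real.log (pathCount o inv r x) + b ≤
      ∑ x, Real.log (pathCount o inv (r + 1) x) + Zf.card * Real.log P := by
    intro r hr
    have h1 := Finset.sum_le_sum fun v (hv : v ∈ VF) =>
      fiber_growth o inv (hP r hr) v (v ∈ Zf) (hz v hv)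
    rw [Finset.sum_add_distrib, Finset.sum_add_distrib,
      Finset.sum_fiberwise_of_maps_to (fun x _ => ho x),
      Finset.sum_fiberwise_of_maps_to (fun x _ => ho x),
      Equiv.sum_comp inv (fun x => Real.log (pathCount o inv r x)), Finset.sum_boole,
      ← Finset.sum_filter, Finset.sum_const, nsmul_eq_mul] at h1
    have h2 : (((VF.filter (· ∈ Zf)).card : ℕ) : ℝ) ≤ Zf.card := by
      exact_mod_cast Finset.card_le_card fun v hv => (Finset.mem_filter.1 hv).2
    have h3 := mul_le_mul_of_nonneg_right h2 hlogP
    change _ + (b : ℝ) ≤ _ at h1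
    linarith
  have hind : ∀ r ≤ r₀, (r : ℝ) * b ≤ ∑ x, Real.log (pathCount o inv r x) +
      r * (Zf.card * Real.log P) := by
    intro r
    induction r with
    | zero => intro _; simp [pathCount]
    | succ r ih =>
      intro hr
      have h1 := ih (by omega)
      have h2 := hstep r (by omega)
      push_cast
      linarith
  have h1 := hind r₀ le_rfl
  have h2 : ∑ x, Real.log (pathCount o inv r₀ x) ≤ Fintype.card X * Real.log P := by
    have := Finset.sum_le_card_nsmul Finset.univ (fun x => Real.log (pathCount o inv r₀ x))
      (Real.log P) (fun x _ => Real.log_le_log (by exact_mod_cast one_le_pathCount o inv r₀ x)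
        (by exact_mod_cast hP r₀ le_rfl x))
    rwa [nsmul_eq_mul, Finset.card_univ] at this
  linarith

end Growth

open FreeWord SqComplex

section Affine

theorem exists_affine {X : Type*} (S : Set X) (h h' : X → ℤ)
    (hiso : ∀ x ∈ S, ∀ y ∈ S, |h x - h y| = |h' x - h' y|) :
    ∃ ε c : ℤ, (ε = 1 ∨ ε = -1) ∧ ∀ x ∈ S, h' x = ε * h x + c := by
  rcases S.eq_empty_or_nonempty with rfl | ⟨x₀, h0⟩
  · exact ⟨1, 0, Or.inl rfl, by simp⟩
  by_cases hp : ∀ x ∈ S, h' x - h' x₀ = h x - h x₀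
  · exact ⟨1, h' x₀ - h x₀, Or.inl rfl, fun x hx => by have := hp x hx; linarith⟩
  · push Not at hp
    obtain ⟨x₁, h1, hne⟩ := hp
    refine ⟨-1, h' x₀ + h x₀, Or.inr rfl, fun x hx => ?_⟩
    have e1 := hiso x₁ h1 x₀ h0
    have e2 := hiso x hx x₀ h0
    have e3 := hiso x hx x₁ h1
    rw [abs_eq_abs] at e1 e2 e3
    omega

variable {β : Type*} [DecidableEq β]

theorem Prefix.natAbs_sub {p q w : FreeGroup β} (hp : Prefix p w) (hq : Prefix q w) :
    ((p⁻¹ * q).norm : ℤ) = |(p.norm : ℤ) - q.norm| := by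
  rcases le_total p.norm q.norm with h | h
  · have h1 := hp.norm_inv_mul hq h
    unfold Prefix at h1
    rw [abs_of_nonpos (by omega)]; omega
  · have h1 := hq.norm_inv_mul hp h
    unfold Prefix at h1
    rw [norm_inv_mul_comm, abs_of_nonneg (by omega)]; omega

theorem Prefix.eq_of_norm_eq {p q w : FreeGroup β} (hp : Prefix p w) (hq : Prefix q w)
    (h : p.norm = q.norm) : p = q := (hp.norm_inv_mul hq h.le).eq_of_norm_le h.ge

theorem exists_affine_norm (u w w' : FreeGroup β) : ∃ ε c : ℤ, (ε = 1 ∨ ε = -1) ∧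
    ∀ τ : FreeGroup β, Prefix τ w → Prefix (u * τ) w' → ((u * τ).norm : ℤ) = ε * τ.norm + c := by
  obtain ⟨ε, c, hε, h⟩ := exists_affine {τ : FreeGroup β | Prefix τ w ∧ Prefix (u * τ) w'}
    (fun τ => τ.norm) (fun τ => (u * τ).norm) (fun x hx y hy => by
      rw [← Prefix.natAbs_sub hx.1 hy.1, ← Prefix.natAbs_sub hx.2 hy.2]
      congr 2
      group)
  exact ⟨ε, c, hε, fun τ h1 h2 => h τ ⟨h1, h2⟩⟩

end Affine

section Paths

variable {α β : Type*} [DecidableEq α] [DecidableEq β] (f : FreeGroup α →* FreeGroup β)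

/-- The positions of a horizontal edge together with a letter along which it may be moved. -/
abbrev HDart (EL : Set (LEdge α β)) : Type _ :=
  {x : (FreeGroup β × β) × (α × Bool) // HorAllowed f EL x.1 x.2}

variable {f} in
/-- Moving a horizontal edge. -/
def HDart.flip {EL : Set (LEdge α β)} (x : HDart f EL) : HDart f EL :=
  ⟨(((f (letter x.1.2))⁻¹ * x.1.1.1, x.1.1.2), (x.1.2.1, !x.1.2.2)), x.2.move.2⟩

omit [DecidableEq α] [DecidableEq β] in
theorem HDart.flip_involutive (EL : Set (LEdge α β)) :
    Function.Involutive (HDart.flip (f := f) (EL := EL)) := by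
  rintro ⟨⟨⟨τ, b⟩, ⟨i, s⟩⟩, h⟩
  refine Subtype.ext ?_
  simp only [HDart.flip]
  rw [← letter_inv (i, s), map_inv]
  simp

/-- The involution on the darts of the horizontal edges. -/
def flipPerm (EL : Set (LEdge α β)) : Equiv.Perm (HDart f EL) :=
  (HDart.flip_involutive f EL).toPerm

variable {f}

variable {EL : Set (LEdge α β)} [Fintype (HDart f EL)] [DecidableEq (HDart f EL)]

/-- The elements along which paths are counted. -/
theorem exists_path_elements {κ : Type*} (D : FreeGroup β → Prop)
    (hD : ∀ v, v ∈ EL → D v.1) (c : κ → ℤ)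
    (hc : ∀ (s : α × Bool) τ, D τ → D ((f (letter s))⁻¹ * τ) → ∃ (ε : ℤ) (k : κ), (ε = 1 ∨ ε = -1) ∧
      (((f (letter s))⁻¹ * τ).norm : ℤ) = ε * τ.norm + c k) [Fintype κ] (r : ℕ) (x : HDart f EL) :
    ∃ W : Finset (FreeGroup α), pathCount (fun y : HDart f EL => y.1.1) (flipPerm f EL) r x ≤ W.card ∧
      ∀ u ∈ W, u.norm ≤ r ∧ ((letter x.1.2)⁻¹ * u).norm = u.norm + 1 ∧
        D ((f u)⁻¹ * x.1.1.1) ∧ ∃ (ε : ℤ) (n : κ → ℤ), (ε = 1 ∨ ε = -1) ∧ (∀ k, |n k| ≤ r) ∧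
          (((f u)⁻¹ * x.1.1.1).norm : ℤ) = ε * x.1.1.1.norm + ∑ k, n k * c k := by
  classical
  have hbase : ∀ (r : ℕ) (x : HDart f EL), ∃ W : Finset (FreeGroup α), 1 ≤ W.card ∧
      ∀ u ∈ W, u.norm ≤ r ∧ ((letter x.1.2)⁻¹ * u).norm = u.norm + 1 ∧
        D ((f u)⁻¹ * x.1.1.1) ∧ ∃ (ε : ℤ) (n : κ → ℤ), (ε = 1 ∨ ε = -1) ∧ (∀ k, |n k| ≤ r) ∧
          (((f u)⁻¹ * x.1.1.1).norm : ℤ) = ε * x.1.1.1.norm + ∑ k, n k * c k := by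
    intro r x
    refine ⟨{1}, by simp, fun u hu => ?_⟩
    obtain rfl := Finset.mem_singleton.1 hu
    refine ⟨by simp, by rw [mul_one, FreeGroup.norm_inv_eq, norm_letter]; simp, ?_,
      1, 0, Or.inl rfl, by simp, by simp⟩
    simpa using hD _ x.2.move.1
  induction r generalizing x with
  | zero => exact hbase 0 x
  | succ r ih =>
    rw [pathCount]
    split_ifs with h
    · exact hbase _ x
    choose W hW1 hW2 using ih
    refine ⟨(siblings (fun y : HDart f EL => y.1.1) x).biUnion fun y =>
      (W (flipPerm f EL y)).image (letter y.1.2 * ·), ?_, ?_⟩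
    · rw [Finset.card_biUnion]
      · refine Finset.sum_le_sum fun y _ => ?_
        rw [Finset.card_image_of_injective _ (mul_right_injective _)]
        exact hW1 _
      · intro y hy z hz hyz
        refine Finset.disjoint_left.2 fun u hu hu' => hyz ?_
        obtain ⟨a, ha, rfl⟩ := Finset.mem_image.1 hu
        obtain ⟨b, hb, hab⟩ := Finset.mem_image.1 hu'
        have h1 := (hW2 _ a ha).2.1
        have h2 := (hW2 _ b hb).2.1
        change ((letter (y.1.2.1, !y.1.2.2))⁻¹ * a).norm = a.norm + 1 at h1
        change ((letter (z.1.2.1, !z.1.2.2))⁻¹ * b).norm = b.norm + 1 at h2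
        rw [← letter_inv, inv_inv] at h1 h2
        change letter z.1.2 * b = letter y.1.2 * a at hab
        rw [hab] at h2
        have h3 : y.1.2 = z.1.2 := by
          refine letter_unique (g := (letter y.1.2 * a)⁻¹) ?_ ?_
          · rw [show (letter y.1.2 * a)⁻¹ * letter y.1.2 = a⁻¹ by group, FreeGroup.norm_inv_eq,
              FreeGroup.norm_inv_eq, h1]
          · rw [← hab, show (letter z.1.2 * b)⁻¹ * letter z.1.2 = b⁻¹ by group,
              FreeGroup.norm_inv_eq, FreeGroup.norm_inv_eq, hab, h2]
        have h4 : y.1.1 = x.1.1 := (Finset.mem_filter.1 hy).2.1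
        have h5 : z.1.1 = x.1.1 := (Finset.mem_filter.1 hz).2.1
        exact Subtype.ext (Prod.ext (h4.trans h5.symm) h3)
    · intro u hu
      obtain ⟨y, hy, hu⟩ := Finset.mem_biUnion.1 hu
      obtain ⟨a, ha, rfl⟩ := Finset.mem_image.1 hu
      obtain ⟨h1, h2, h3, ε, n, hε, hn, h4⟩ := hW2 _ a ha
      have hy1 : y.1.1 = x.1.1 := (Finset.mem_filter.1 hy).2.1
      have hy2 : y ≠ x := (Finset.mem_filter.1 hy).2.2
      have hy3 : y.1.2 ≠ x.1.2 := fun h => hy2 (Subtype.ext (Prod.ext hy1 h))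
      change ((letter (y.1.2.1, !y.1.2.2))⁻¹ * a).norm = a.norm + 1 at h2
      rw [← letter_inv, inv_inv] at h2
      change D ((f a)⁻¹ * ((f (letter y.1.2))⁻¹ * y.1.1.1)) at h3
      change (((f a)⁻¹ * ((f (letter y.1.2))⁻¹ * y.1.1.1)).norm : ℤ) =
        ε * ((f (letter y.1.2))⁻¹ * y.1.1.1).norm + _ at h4
      have h5 : (f (letter y.1.2 * a))⁻¹ * x.1.1.1 =
          (f a)⁻¹ * ((f (letter y.1.2))⁻¹ * y.1.1.1) := by
        rw [map_mul, mul_inv_rev, mul_assoc, hy1]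
      have h6 := y.2.move
      obtain ⟨ε', k₀, hε', hk⟩ := hc y.1.2 y.1.1.1 (hD _ h6.1) (hD _ h6.2.move.1)
      refine ⟨by omega, ?_, by rw [h5]; exact h3, ε * ε', n + Pi.single k₀ ε, ?_, ?_, ?_⟩
      · have h7 := norm_mul_letter (letter y.1.2 * a)⁻¹ x.1.2
        rw [← FreeGroup.norm_inv_eq, mul_inv_rev, inv_inv, FreeGroup.norm_inv_eq] at h7
        refine h7.resolve_right fun h8 => hy3 ?_
        refine letter_unique (g := (letter y.1.2 * a)⁻¹) ?_ ?_
        · rw [show (letter y.1.2 * a)⁻¹ * letter y.1.2 = a⁻¹ by group, FreeGroup.norm_inv_eq,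
            FreeGroup.norm_inv_eq, h2]
        · rw [← FreeGroup.norm_inv_eq, mul_inv_rev, inv_inv, FreeGroup.norm_inv_eq]
          exact h8
      · rcases hε with rfl | rfl <;> rcases hε' with rfl | rfl <;> simp
      · intro k
        refine (abs_add_le _ _).trans ?_
        push_cast
        refine add_le_add (hn k) ?_
        rw [Pi.single_apply]
        split_ifs
        · rcases hε with rfl | rfl <;> simp
        · simp
      · rw [h5, h4, hk, hy1]
        simp only [Pi.add_apply, add_mul, Finset.sum_add_distrib, Pi.single_apply, ite_mul,
          zero_mul, Finset.sum_ite_eq', Finset.mem_univ, if_true]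
        ring

/-- Paths in a prefix tree are determined by few data. -/
theorem pathCount_le [Finite α] {ρ R : ℕ} (hD : ∀ v, v ∈ EL → ballPrefixes f ρ v.1)
    (hf : ∀ g : FreeGroup α, g.norm ≤ 2 * R → f g = 1 → g = 1) {m : ℕ}
    (hm : {g : FreeGroup α | g.norm ≤ ρ}.ncard = m) (r : ℕ) (hr : r ≤ R) (x : HDart f EL) :
    pathCount (fun y : HDart f EL => y.1.1) (flipPerm f EL) r x ≤
      m * (2 * (2 * r + 1) ^ (2 * Nat.card α * m * m)) := by
  classical
  have := Fintype.ofFinite α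
  set B := {g : FreeGroup α | g.norm ≤ ρ} with hB
  have hBf : B.Finite := finite_ball ρ
  have : Fintype B := hBf.fintype
  have hBc : Fintype.card B = m := by rw [← hm, Set.ncard_eq_toFinset_card', Set.toFinset_card]
  choose ε₀ c₀ hε₀ hc₀ using fun κ : (α × Bool) × B × B =>
    exists_affine_norm (f (letter κ.1))⁻¹ (f κ.2.1) (f κ.2.2)
  obtain ⟨W, hW, hW'⟩ := exists_path_elements (f := f) (EL := EL) (ballPrefixes f ρ) hD c₀
    (fun s τ h1 h2 => by
      obtain ⟨g, hg, h1⟩ := h1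
      obtain ⟨g', hg', h2⟩ := h2
      exact ⟨ε₀ (s, ⟨g, hg⟩, ⟨g', hg'⟩), (s, ⟨g, hg⟩, ⟨g', hg'⟩), hε₀ _,
        hc₀ (s, ⟨g, hg⟩, ⟨g', hg'⟩) τ h1 h2⟩) r x
  refine hW.trans ?_
  let I : Finset ℤ := Finset.Icc (-(r : ℤ)) r
  let N : Finset ℤ := (({1, -1} : Finset ℤ) ×ˢ Fintype.piFinset fun _ : (α × Bool) × B × B => I).image
    fun y => y.1 * x.1.1.1.norm + ∑ k, y.2 k * c₀ k
  have hN : N.card ≤ 2 * (2 * r + 1) ^ (2 * Nat.card α * m * m) := by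
    refine Finset.card_image_le.trans ?_
    rw [Finset.card_product, Fintype.card_piFinset, Finset.prod_const, Finset.card_univ]
    refine Nat.mul_le_mul (by simp) (le_of_eq ?_)
    congr 1
    · simp [I]; omega
    · simp only [Fintype.card_prod, hBc, Nat.card_eq_fintype_card, Fintype.card_bool]
      ring
  have key : ∀ u ∈ W, ∃ g : B, Prefix ((f u)⁻¹ * x.1.1.1) (f g) := fun u hu => by
    obtain ⟨g, hg, h⟩ := (hW' u hu).2.2.1
    exact ⟨⟨g, hg⟩, h⟩
  have : Nonempty B := ⟨⟨1, by simp [hB]⟩⟩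
  choose! σ hσ using key
  refine (Finset.card_le_card_of_injOn (t := (Finset.univ : Finset B) ×ˢ N)
    (fun u => (σ u, (((f u)⁻¹ * x.1.1.1).norm : ℤ))) ?_ ?_).trans ?_
  · intro u hu
    obtain ⟨ε, n, hε, hn, h⟩ := (hW' u hu).2.2.2
    refine Finset.mem_coe.2 (Finset.mem_product.2 ⟨Finset.mem_univ _, Finset.mem_image.2
      ⟨(ε, n), ?_, h.symm⟩⟩)
    refine Finset.mem_product.2 ⟨by simpa using hε, Fintype.mem_piFinset.2 fun k => ?_⟩
    exact Finset.mem_Icc.2 (abs_le.1 (hn k))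
  · intro u hu u' hu' h
    obtain ⟨h1, h2⟩ := Prod.mk.inj h
    have h3 := hσ u hu
    have h4 := hσ u' hu'
    rw [← h1] at h4
    have h5 := Prefix.eq_of_norm_eq h3 h4 (by exact_mod_cast h2)
    have h6 : f u = f u' := inv_injective (mul_right_cancel h5)
    have h7 := FreeGroup.norm_mul_le u⁻¹ u'
    rw [FreeGroup.norm_inv_eq] at h7
    have h8 := (hW' u hu).1
    have h9 := (hW' u' hu').1
    refine inv_mul_eq_one.1 (hf (u⁻¹ * u') (by omega) ?_)
    rw [map_mul, map_inv, h6, inv_mul_cancel]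
  · rw [Finset.card_product, Finset.card_univ, hBc]
    exact Nat.mul_le_mul_left _ hN

end Paths

open FreeWord SqComplex

variable {α β : Type*} [DecidableEq α] [DecidableEq β] {f : FreeGroup α →* FreeGroup β}

/-- A bound for the number of paths of length at most `R` between prefixes of the images of `m`
elements of a free group of rank `n`. -/
def pathBound (n m R : ℕ) : ℕ := m * (2 * (2 * R + 1) ^ (2 * n * m * m))

open Classical in
theorem card_hor_branch_le [Fintype α] {ρ R : ℕ} (EL Z : Finset (LEdge α β))
    (hD : ∀ v, v ∈ EL → ballPrefixes f ρ v.1)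
    (hf : ∀ g : FreeGroup α, g.norm ≤ 2 * R → f g = 1 → g = 1)
    (htwo : ∀ v ∈ horEdges EL, v ∉ horEdges Z →
      2 ≤ (Finset.univ.filter (HorAllowed f ↑EL v)).card) :
    (R : ℝ) * ((horEdges EL).filter fun v =>
        3 ≤ (Finset.univ.filter (HorAllowed f ↑EL v)).card).card ≤
      ((2 * Nat.card α * (horEdges EL).card : ℕ) + R * (horEdges Z).card) *
        Real.log (pathBound (Nat.card α) {g : FreeGroup α | g.norm ≤ ρ}.ncard R) := by
  have hinj : Function.Injective fun x : HDart f (EL : Set (LEdge α β)) =>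
      ((⟨x.1.1, mem_horEdges.2 (Finset.mem_coe.1 x.2.move.1)⟩, x.1.2) :
        ↥(horEdges EL) × (α × Bool)) := by
    intro x y h
    obtain ⟨h1, h2⟩ := Prod.mk.inj h
    exact Subtype.ext (Prod.ext (Subtype.mk.inj h1) h2)
  have : Fintype (HDart f (EL : Set (LEdge α β))) := Fintype.ofInjective _ hinj
  have hcard : Fintype.card (HDart f (EL : Set (LEdge α β))) ≤
      2 * Nat.card α * (horEdges EL).card := by
    refine (Fintype.card_le_of_injective _ hinj).trans (le_of_eq ?_)
    simp only [Fintype.card_prod, Fintype.card_coe, Fintype.card_bool, Nat.card_eq_fintype_card]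
    ring
  have hfib : ∀ v : FreeGroup β × β, (Finset.univ.filter fun y : HDart f (EL : Set (LEdge α β)) =>
      y.1.1 = v).card = (Finset.univ.filter (HorAllowed f (EL : Set (LEdge α β)) v)).card := by
    intro v
    refine Finset.card_bij (fun y _ => y.1.2) ?_ ?_ ?_
    · intro y hy
      obtain rfl := (Finset.mem_filter.1 hy).2
      exact Finset.mem_filter.2 ⟨Finset.mem_univ _, y.2⟩
    · intro y hy z hz h
      exact Subtype.ext (Prod.ext ((Finset.mem_filter.1 hy).2.trans
        (Finset.mem_filter.1 hz).2.symm) h)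
    · intro s hs
      exact ⟨⟨(v, s), (Finset.mem_filter.1 hs).2⟩, by simp, rfl⟩
  have h := growth (fun y : HDart f (EL : Set (LEdge α β)) => y.1.1) (flipPerm f EL)
    (r₀ := R) (P := pathBound (Nat.card α) {g : FreeGroup α | g.norm ≤ ρ}.ncard R)
    (fun r hr x => (pathCount_le hD hf rfl r hr x).trans ?_) (horEdges EL) (horEdges Z)
    (fun x => mem_horEdges.2 (Finset.mem_coe.1 x.2.move.1)) (fun v hv h => ?_)
  · simp only [hfib] at h
    refine h.trans (mul_le_mul_of_nonneg_right ?_ (Real.log_natCast_nonneg _))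
    gcongr
  · unfold pathBound
    gcongr
  · by_contra hz
    have := htwo v hv hz
    rw [hfib] at h
    omega

open Classical in
/-- The branching edges of a minimal core. -/
theorem exists_branch_set [Fintype α] [Fintype β] {F : Type*} [Group F] (j : FreeGroup α →* F)
    (hj : Function.Injective j) {Kw : Set (FreeGroup α)} {ρ lam R : ℕ} (hρ : 1 ≤ ρ)
    (hK : ∀ k ∈ Kw, k.norm ≤ ρ)
    (hrig : ∀ (c : FreeGroup α) (P : Subgroup (FreeGroup α)), StepOver (j c) (P.map j) j.range →
      (∀ k ∈ Kw, k ∈ P) → P = ⊤)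
    (hl : ∀ i, (f (FreeGroup.of i)).norm ≤ lam)
    (hf : ∀ g : FreeGroup α, g.norm ≤ 2 * R → f g = 1 → g = 1) (Z : Finset (LEdge α β))
    (hZ : (Z : Set (LEdge α β)) = trackEdges f Kw) :
    ∃ b : ℕ, (R : ℝ) * b ≤ ((2 * Nat.card α * (Nat.card β *
        ({g : FreeGroup α | g.norm ≤ ρ}.ncard * (ρ * lam + 1))) : ℕ) + R * (horEdges Z).card) *
        Real.log (pathBound (Nat.card α) {g : FreeGroup α | g.norm ≤ ρ}.ncard R) ∧
      Subgroup.closure {w : FreeGroup α | w.norm ≤ 2 * (3 * (vertEdges Z).card) + 1 ∧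
        (f w).norm ≤ 2 * ((horEdges Z).card + b) + 1} = ⊤ := by
  obtain ⟨EL', hsub, hZEL, htwo, hconn⟩ := exists_minimal_core j hj hρ hK hrig hl
  obtain ⟨hDf, hDc⟩ := finite_ballPrefixes f hl (ρ := ρ)
  obtain ⟨EL, rfl⟩ : ∃ EL : Finset (LEdge α β), (EL : Set (LEdge α β)) = EL' :=
    ⟨((finite_span hDf).subset hsub).toFinset, Set.Finite.coe_toFinset _⟩
  rw [← hZ] at hZEL htwo hconn
  have hhor : ∀ v ∈ horEdges EL, v ∉ horEdges Z →
      2 ≤ (Finset.univ.filter (HorAllowed f ↑EL v)).card := fun v hv hz =>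
    two_le_card_of_param (dart_hor_iff 1 v) (htwo ⟨1, (v.1, .inl v.2)⟩
      (Finset.mem_coe.2 (mem_horEdges.1 hv)) fun h => hz (mem_horEdges.2 (Finset.mem_coe.1 h)))
  have hvert : ∀ v ∈ vertEdges EL, v ∉ vertEdges Z →
      2 ≤ (Finset.univ.filter (VertAllowed f ↑EL v)).card := fun v hv hz =>
    two_le_card_of_param (dart_vert_iff 1 v) (htwo ⟨1, (v.1, .inr v.2)⟩
      (Finset.mem_coe.2 (mem_vertEdges.1 hv)) fun h => hz (mem_vertEdges.2 (Finset.mem_coe.1 h)))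
  have h1 := card_hor_branch_le (ρ := ρ) (R := R) EL Z (fun v hv => (hsub hv).1) hf hhor
  have h2 := card_vert_branch_le EL Z hvert
  set b := ((horEdges EL).filter fun v =>
        3 ≤ (Finset.univ.filter (HorAllowed f ↑EL v)).card).card
  refine ⟨b, h1.trans (mul_le_mul_of_nonneg_right ?_ (Real.log_natCast_nonneg _)), ?_⟩
  · have h3 : (horEdges EL).card ≤ Nat.card β *
        ({g : FreeGroup α | g.norm ≤ ρ}.ncard * (ρ * lam + 1)) := by
      have h4 : (horEdges EL).card ≤ (hDf.toFinset ×ˢ (Finset.univ : Finset β)).card := by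
        refine Finset.card_le_card fun v hv => Finset.mem_product.2 ⟨?_, Finset.mem_univ _⟩
        exact hDf.mem_toFinset.2 (hsub (mem_horEdges.1 hv)).1
      rw [Finset.card_product, ← Set.ncard_eq_toFinset_card _ hDf, Finset.card_univ,
        ← Nat.card_eq_fintype_card, mul_comm] at h4
      exact h4.trans (Nat.mul_le_mul_left _ hDc)
    gcongr
  · let E : Finset (LEdge α β) := EL.filter fun l => l ∈ Z ∨ match l.2 with
      | .inl b => (Finset.univ.filter (HorAllowed f ↑EL (l.1, b))).card ≠ 2
      | .inr i => (Finset.univ.filter (VertAllowed f ↑EL (l.1, i))).card ≠ 2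
    have hbr : ∀ e, (prodComplex f).Branch (liftEdges ↑Z) (liftEdges ↑EL) e → liftEdges ↑E e := by
      rintro ⟨g, τ, c | i⟩ ⟨he, h⟩
      · refine Finset.mem_coe.2 (Finset.mem_filter.2 ⟨he, h.imp (fun h => h) fun h h' => h ?_⟩)
        exact exists_of_card_eq_two (horDart_injective g (τ, c)) (dart_hor_iff g (τ, c)) h'
      · refine Finset.mem_coe.2 (Finset.mem_filter.2 ⟨he, h.imp (fun h => h) fun h h' => h ?_⟩)
        exact exists_of_card_eq_two (vertDart_injective g (τ, i)) (dart_vert_iff g (τ, i)) h'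
    have hE := closure_eq_top E fun g => rtg_adj_mono hbr (hconn g)
    have hv : numVert E ≤ 3 * (vertEdges Z).card := by
      refine (numVert_le E).trans ((Finset.card_le_card fun v hv => ?_).trans h2)
      have hv := Finset.mem_filter.1 (mem_vertEdges.1 hv)
      exact Finset.mem_filter.2 ⟨mem_vertEdges.2 hv.1, hv.2.imp (fun h => mem_vertEdges.2 h) id⟩
    have hh : numHor E ≤ (horEdges Z).card + b := by
      refine (numHor_le E).trans ((Finset.card_le_card (t := horEdges Z ∪ _) fun v hv => ?_).trans
        (Finset.card_union_le _ _))
      have hv := Finset.mem_filter.1 (mem_horEdges.1 hv)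
      by_cases hz : v ∈ horEdges Z
      · exact Finset.mem_union_left _ hz
      · have hv1 := mem_horEdges.2 hv.1
        refine Finset.mem_union_right _ (Finset.mem_filter.2 ⟨hv1, ?_⟩)
        have h4 : (Finset.univ.filter (HorAllowed f ↑EL v)).card ≠ 2 :=
          hv.2.resolve_left fun h => hz (mem_horEdges.2 h)
        have h5 := hhor v hv1 hz
        omega
    rw [← top_le_iff, ← hE]
    refine Subgroup.closure_mono fun w hw => ⟨?_, ?_⟩
    · exact hw.1.trans (by omega)
    · exact hw.2.trans (by omega)

open FreeWord SqComplex

section Bounds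

variable {α β : Type*} [DecidableEq α] [DecidableEq β]

/-- Generating sets in a ball control the images of the basis uniformly. -/
theorem exists_generation_bound [Finite α] (q : ℕ) : ∃ r : ℕ, ∀ S : Set (FreeGroup α),
    (∀ g ∈ S, g.norm ≤ q) → Subgroup.closure S = ⊤ → ∀ (f : FreeGroup α →* FreeGroup β) (b : ℕ),
      (∀ g ∈ S, (f g).norm ≤ b) → ∀ i, (f (FreeGroup.of i)).norm ≤ r * b := by
  have h1 : ∀ (S : Set (FreeGroup α)) (g : FreeGroup α), g ∈ Subgroup.closure S →
      ∃ r : ℕ, ∀ (f : FreeGroup α →* FreeGroup β) (b : ℕ),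
        (∀ g ∈ S, (f g).norm ≤ b) → (f g).norm ≤ r * b := by
    intro S g hg
    induction hg using Subgroup.closure_induction with
    | mem x hx => exact ⟨1, fun f b h => by simpa using h x hx⟩
    | one => exact ⟨0, fun f b h => by simp⟩
    | mul x y hx hy h1 h2 =>
      obtain ⟨r, h1⟩ := h1
      obtain ⟨r', h2⟩ := h2
      refine ⟨r + r', fun f b h => ?_⟩
      rw [map_mul, add_mul]
      exact (FreeGroup.norm_mul_le _ _).trans (add_le_add (h1 f b h) (h2 f b h))
    | inv x hx h1 =>
      obtain ⟨r, h1⟩ := h1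
      refine ⟨r, fun f b h => ?_⟩
      rw [map_inv, FreeGroup.norm_inv_eq]
      exact h1 f b h
  have h2 : ∀ S ∈ {S : Set (FreeGroup α) | S ⊆ {g | g.norm ≤ q}}, ∀ᶠ r : ℕ in atTop,
      Subgroup.closure S = ⊤ → ∀ (f : FreeGroup α →* FreeGroup β) (b : ℕ),
        (∀ g ∈ S, (f g).norm ≤ b) → ∀ i, (f (FreeGroup.of i)).norm ≤ r * b := by
    intro S _
    by_cases hS : Subgroup.closure S = ⊤
    · have h3 : ∀ i : α, ∀ᶠ r : ℕ in atTop, ∀ (f : FreeGroup α →* FreeGroup β) (b : ℕ),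
          (∀ g ∈ S, (f g).norm ≤ b) → (f (FreeGroup.of i)).norm ≤ r * b := by
        intro i
        obtain ⟨r, hr⟩ := h1 S (FreeGroup.of i) (hS ▸ Subgroup.mem_top _)
        filter_upwards [eventually_ge_atTop r] with r' hr' f b h
        exact (hr f b h).trans (Nat.mul_le_mul_right _ hr')
      filter_upwards [eventually_all.2 h3] with r hr _ f b h i
      exact hr i f b h
    · exact .of_forall fun r h => absurd h hS
  obtain ⟨r, hr⟩ := (((finite_ball (α := α) q).finite_subsets.eventually_all).2 h2).exists
  exact ⟨r, fun S hS => hr S hS⟩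

theorem eventually_mul_log_pathBound_le (A : ℝ) (n m : ℕ) :
    ∀ᶠ R : ℕ in atTop, A * Real.log (pathBound n m R) ≤ 1 / 2 * R := by
  have h0 : Tendsto (fun R : ℕ => (2 * R + 1 : ℝ)) atTop atTop :=
    tendsto_atTop_add_const_right _ _ (tendsto_natCast_atTop_atTop.const_mul_atTop two_pos)
  have hc : ∀ c : ℝ, (fun _ : ℕ => c) =o[atTop] fun R : ℕ => (R : ℝ) := fun c =>
    (Asymptotics.isLittleO_const_id_atTop c).comp_tendsto tendsto_natCast_atTop_atTop
  have h1 : (fun R : ℕ => Real.log (2 * R + 1)) =o[atTop] fun R : ℕ => (R : ℝ) := by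
    refine (Real.isLittleO_log_id_atTop.comp_tendsto h0).trans_isBigO ?_
    exact ((Asymptotics.isBigO_refl _ _).const_mul_left 2).add (hc 1).isBigO
  have h2 : (fun R : ℕ => A * Real.log (pathBound n m R)) =o[atTop] fun R : ℕ => (R : ℝ) := by
    refine Asymptotics.IsLittleO.const_mul_left ?_ A
    rcases Nat.eq_zero_or_pos m with rfl | hm
    · simp only [pathBound, zero_mul, Nat.cast_zero, Real.log_zero]
      exact Asymptotics.isLittleO_zero _ _
    · have h3 : ∀ R : ℕ, Real.log (pathBound n m R) =
          Real.log (m * 2) + (2 * n * m * m : ℕ) * Real.log (2 * R + 1) := by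
        intro R
        have hm' : (m : ℝ) ≠ 0 := by positivity
        have hR : ((2 * R + 1 : ℝ)) ≠ 0 := by positivity
        rw [← Real.log_pow, ← Real.log_mul (by positivity) (by positivity)]
        congr 1
        unfold pathBound
        push_cast
        ring
      simp only [h3]
      exact (hc _).add (h1.const_mul_left _)
  filter_upwards [h2.bound (show (0 : ℝ) < 1 / 2 by norm_num)] with R hR
  rw [Real.norm_natCast] at hR
  exact (le_abs_self _).trans hR

variable {f : FreeGroup α →* FreeGroup β}

theorem card_vert_track_le [Finite α] {Kw : Set (FreeGroup α)} {ρ : ℕ}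
    (hK : ∀ k ∈ Kw, k.norm ≤ ρ) (Z : Finset (LEdge α β)) (hZ : (Z : Set _) = trackEdges f Kw) :
    (vertEdges Z).card ≤ {g : FreeGroup α | g.norm ≤ ρ}.ncard * Nat.card α := by
  have := Fintype.ofFinite α
  have hB := finite_ball (α := α) ρ
  rw [Set.ncard_eq_toFinset_card _ hB, Nat.card_eq_fintype_card, ← Finset.card_univ,
    ← Finset.card_product]
  refine (Finset.card_le_card fun v hv => ?_).trans
    (Finset.card_image_le (f := fun x : FreeGroup α × α => ((f x.1)⁻¹, x.2)))
  have h : (v.1, Sum.inr v.2) ∈ (Z : Set (LEdge α β)) := Finset.mem_coe.2 (mem_vertEdges.1 hv)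
  rw [hZ] at h
  obtain ⟨k, hk, g, hg, -, h⟩ := h
  exact Finset.mem_image.2 ⟨(g, v.2), Finset.mem_product.2
    ⟨hB.mem_toFinset.2 (hg.norm_le.trans (hK k hk)), Finset.mem_univ _⟩, Prod.ext h.symm rfl⟩

theorem card_hor_track_le [Finite β] {Kw : Set (FreeGroup α)} (hKf : Kw.Finite) {C : ℕ}
    (hC : ∀ k ∈ Kw, (f k).norm ≤ C) (Z : Finset (LEdge α β)) (hZ : (Z : Set _) = trackEdges f Kw) :
    (horEdges Z).card ≤ Kw.ncard * ((C + 1) * Nat.card β) := by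
  have := Fintype.ofFinite β
  have key : ∀ v ∈ horEdges Z, ∃ k ∈ Kw, Prefix v.1 (f k⁻¹) := by
    intro v hv
    have h : (v.1, Sum.inl v.2) ∈ (Z : Set (LEdge α β)) := Finset.mem_coe.2 (mem_horEdges.1 hv)
    rw [hZ] at h
    obtain ⟨k, hk, h, -⟩ := h
    exact ⟨k, hk, h⟩
  choose! σ hσ hσ' using key
  rw [Set.ncard_eq_toFinset_card _ hKf, Nat.card_eq_fintype_card, ← Finset.card_univ,
    ← Finset.card_range (C + 1), ← Finset.card_product, ← Finset.card_product]
  refine Finset.card_le_card_of_injOn (fun v => (σ v, v.1.norm, v.2)) ?_ ?_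
  · intro v hv
    have h := (hσ' v hv).norm_le
    rw [map_inv, FreeGroup.norm_inv_eq] at h
    have := h.trans (hC _ (hσ v hv))
    simp only [Finset.coe_product, Set.mem_prod, Finset.mem_coe, Finset.mem_range,
      Finset.mem_univ, and_true]
    exact ⟨hKf.mem_toFinset.2 (hσ v hv), by omega⟩
  · intro v hv w hw h
    simp only [Prod.mk.injEq] at h
    have h1 := hσ' v hv
    have h2 := hσ' w hw
    rw [← h.1] at h2
    exact Prod.ext (Prefix.eq_of_norm_eq h1 h2 h.2.1) h.2.2

end Bounds

/-- Homomorphisms that are injective on a large ball are bounded by their values on a set relative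
to which the group is rigid. -/
theorem exists_norm_bound {α β : Type*} [DecidableEq α] [DecidableEq β] [Finite α] [Finite β]
    {F : Type*} [Group F] (j : FreeGroup α →* F)
    (hj : Function.Injective j) {Kw : Set (FreeGroup α)} (hKf : Kw.Finite)
    (hrig : ∀ (c : FreeGroup α) (P : Subgroup (FreeGroup α)), StepOver (j c) (P.map j) j.range →
      (∀ k ∈ Kw, k ∈ P) → P = ⊤) :
    ∃ R : ℕ, ∀ C : ℕ, ∃ Λ : ℕ, ∀ f : FreeGroup α →* FreeGroup β, (∀ k ∈ Kw, (f k).norm ≤ C) →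
      (∀ g : FreeGroup α, g.norm ≤ R → f g = 1 → g = 1) → ∀ i, (f (FreeGroup.of i)).norm ≤ Λ := by
  have := Fintype.ofFinite α
  have := Fintype.ofFinite β
  obtain ⟨ρ, hρ, hK⟩ : ∃ ρ : ℕ, 1 ≤ ρ ∧ ∀ k ∈ Kw, k.norm ≤ ρ := by
    have h : ∀ᶠ ρ : ℕ in atTop, ∀ k ∈ Kw, k.norm ≤ ρ :=
      (hKf.eventually_all).2 fun k _ => eventually_ge_atTop _
    exact ((eventually_ge_atTop 1).and h).exists
  set m := {g : FreeGroup α | g.norm ≤ ρ}.ncard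
  set n := Nat.card α
  set N := Nat.card β
  obtain ⟨q, hq⟩ := exists_generation_bound (α := α) (β := β) (2 * (3 * (m * n)) + 1)
  obtain ⟨R, hR1, hR⟩ := ((eventually_ge_atTop 1).and
    (eventually_mul_log_pathBound_le (2 * q * (2 * n * (N * (m * ρ)))) n m)).exists
  refine ⟨2 * R, fun C => ?_⟩
  set L := Real.log (pathBound n m R)
  have hL : 0 ≤ L := Real.log_natCast_nonneg _
  set z₀ := Kw.ncard * ((C + 1) * N)
  obtain ⟨Λ, hΛ⟩ := exists_nat_ge (2 * (q * (2 * z₀ + 1) + 2 * q * (2 * n * (N * m)) * L +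
    2 * q * z₀ * L : ℝ))
  refine ⟨Λ, fun f hC hf => ?_⟩
  obtain ⟨lam, hlam, hmax⟩ : ∃ lam : ℕ, (∀ i, (f (FreeGroup.of i)).norm ≤ lam) ∧
      ∀ c : ℕ, (∀ i, (f (FreeGroup.of i)).norm ≤ c) → lam ≤ c :=
    ⟨Finset.univ.sup fun i => (f (FreeGroup.of i)).norm,
      fun i => Finset.le_sup (f := fun i => (f (FreeGroup.of i)).norm) (Finset.mem_univ i),
      fun c hc => Finset.sup_le fun i _ => hc i⟩
  obtain ⟨Z, hZ⟩ : ∃ Z : Finset (LEdge α β), (Z : Set (LEdge α β)) = trackEdges f Kw :=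
    ⟨((finite_span (finite_ballPrefixes f hlam).1).subset (trackEdges_subset_span hK)).toFinset,
      Set.Finite.coe_toFinset _⟩
  obtain ⟨b, hb, hcl⟩ := exists_branch_set j hj hρ hK hrig hlam hf Z hZ
  have hv := card_vert_track_le hK Z hZ
  have hh := card_hor_track_le hKf hC Z hZ
  have h1 := hmax _ (hq _ (fun g hg => ?_) hcl f _ fun g hg => hg.2)
  swap
  · exact hg.1.trans (by gcongr)
  refine fun i => (hlam i).trans ?_
  have h2 : lam ≤ q * (2 * (z₀ + b) + 1) := h1.trans (by gcongr)
  have h2' : (lam : ℝ) ≤ q * (2 * (z₀ + b) + 1) := by exact_mod_cast h2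
  have hR0 : (1 : ℝ) ≤ R := by exact_mod_cast hR1
  have h3 : (R : ℝ) * b ≤ (2 * n * (N * (m * (ρ * lam + 1))) + R * z₀) * L := by
    refine hb.trans (mul_le_mul_of_nonneg_right ?_ hL)
    push_cast
    have : ((horEdges Z).card : ℝ) ≤ z₀ := by exact_mod_cast hh
    gcongr
  have h4 : (R : ℝ) * lam ≤ R * (q * (2 * z₀ + 1)) + 2 * q * (R * b) := by
    have := mul_le_mul_of_nonneg_left h2' (zero_le_one.trans hR0)
    linarith
  have h5 : 2 * q * (R * b) ≤ 2 * (q : ℝ) * ((2 * n * (N * (m * (ρ * lam + 1))) + R * z₀) * L) := by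
    gcongr
  have h6 := mul_le_mul_of_nonneg_right hR (Nat.cast_nonneg (α := ℝ) lam)
  have h7 : 2 * q * (2 * n * (N * m)) * L ≤ R * (2 * q * (2 * n * (N * m)) * L : ℝ) :=
    le_mul_of_one_le_left (by positivity) hR0
  have h8 : (R : ℝ) * lam ≤ R * (2 * (q * (2 * z₀ + 1) + 2 * q * (2 * n * (N * m)) * L +
      2 * q * z₀ * L)) := by
    nlinarith
  have h9 := le_of_mul_le_mul_left h8 (by linarith)
  exact_mod_cast h9.trans hΛ

section Logic

variable {F : Type*} [Group F] {A : Set F}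

theorem mem_acl_iff {b : F} : b ∈ acl A ↔
    ∃ s : Set (Fin 1 → F), A.Definable grpLang s ∧ s.Finite ∧ (fun _ => b) ∈ s := by
  have key : ∀ φ : grpLang.Formula (↥A ⊕ Fin 1),
      {v : Fin 1 → F | φ.Realize (Sum.elim Subtype.val v)} =
        (fun (c : F) (_ : Fin 1) => c) '' {c | φ.Realize (Sum.elim Subtype.val fun _ => c)} := by
    intro φ
    ext v
    constructor
    · intro hv
      have e : (fun _ : Fin 1 => v 0) = v := funext fun i => congrArg v (Subsingleton.elim _ _)
      refine ⟨v 0, ?_, e⟩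
      change φ.Realize (Sum.elim Subtype.val fun _ => v 0)
      rw [e]
      exact hv
    · rintro ⟨c, hc, rfl⟩
      exact hc
  have hinj : Function.Injective fun (c : F) (_ : Fin 1) => c := fun x y h => congrFun h 0
  constructor
  · rintro ⟨φ, hfin, hb⟩
    refine ⟨{v | φ.Realize (Sum.elim Subtype.val v)},
      Set.definable_iff_exists_formula_sum.2 ⟨φ, rfl⟩, ?_, hb⟩
    rw [key]
    exact hfin.image _
  · rintro ⟨s, hs, hfin, hb⟩
    obtain ⟨φ, rfl⟩ := Set.definable_iff_exists_formula_sum.1 hs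
    refine ⟨φ, ?_, hb⟩
    rw [key] at hfin
    exact hfin.of_finite_image hinj.injOn

theorem exists_term_realize_eq_lift {α : Type} (k : FreeGroup α) :
    ∃ t : grpLang.Term α, ∀ x : α → F, t.realize x = FreeGroup.lift x k := by
  have hinv : ∀ k : FreeGroup α, (∃ t : grpLang.Term α, ∀ x : α → F, t.realize x = FreeGroup.lift x k) →
      ∃ t : grpLang.Term α, ∀ x : α → F, t.realize x = FreeGroup.lift x k⁻¹ := by
    rintro k ⟨t, ht⟩
    refine ⟨Language.Term.func (L := grpLang) (l := 1) GrpFunc.inv ![t], fun x => ?_⟩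
    rw [map_inv, ← ht]
    rfl
  induction k using FreeGroup.induction_on with
  | C1 =>
    refine ⟨Language.Term.func (L := grpLang) (l := 0) GrpFunc.one ![], fun x => ?_⟩
    rw [map_one]
    rfl
  | of i => exact ⟨.var i, fun x => by simp⟩
  | inv_of i h => exact hinv _ h
  | mul a b ha hb =>
    obtain ⟨s, hs⟩ := ha
    obtain ⟨t, ht⟩ := hb
    refine ⟨Language.Term.func (L := grpLang) (l := 2) GrpFunc.mul ![s, t], fun x => ?_⟩
    rw [map_mul, ← hs, ← ht]
    rfl

theorem definableFun_lift {α : Type} (k : FreeGroup α) :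
    A.DefinableFun grpLang fun x : α → F => FreeGroup.lift x k := by
  obtain ⟨t, ht⟩ := exists_term_realize_eq_lift (F := F) k
  have := Set.DefinableFun.of_empty (A := A) t.definableFun_realize
  rwa [funext ht] at this

theorem mem_acl_of_rigid {n N : ℕ} (e : F ≃* FreeGroup (Fin N)) (j : FreeGroup (Fin n) →* F)
    (hj : Function.Injective j) {Kw : Set (FreeGroup (Fin n))} (hKf : Kw.Finite)
    (hKacl : ∀ k ∈ Kw, j k ∈ acl A)
    (hrig : ∀ (c : FreeGroup (Fin n)) (P : Subgroup (FreeGroup (Fin n))),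
      StepOver (j c) (P.map j) j.range → (∀ k ∈ Kw, k ∈ P) → P = ⊤) (i : Fin n) :
    j (FreeGroup.of i) ∈ acl A := by
  obtain ⟨R, hR⟩ := exists_norm_bound (β := Fin N) j hj hKf hrig
  have hX : ∀ k : Kw, ∃ s : Set (Fin 1 → F), A.Definable grpLang s ∧ s.Finite ∧
      (fun _ => j k) ∈ s := fun k => mem_acl_iff.1 (hKacl k k.2)
  choose X hXd hXf hXm using hX
  have : Finite Kw := hKf
  let W : Set (FreeGroup (Fin n)) := {g | g.norm ≤ R ∧ g ≠ 1}
  have hW : W.Finite := (FreeWord.finite_ball R).subset fun g hg => hg.1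
  have : Finite W := hW
  let S : Set (Fin n → F) := (⋂ k : Kw, (fun x => fun _ : Fin 1 => FreeGroup.lift x (k : FreeGroup (Fin n))) ⁻¹' X k) ∩
    ⋂ g : W, {x | FreeGroup.lift x (g : FreeGroup (Fin n)) = FreeGroup.lift x 1}ᶜ
  have hSd : A.Definable grpLang S := by
    refine Set.Definable.inter (Set.definable_iInter_of_finite fun k => ?_)
      (Set.definable_iInter_of_finite fun g => ?_)
    · exact Set.Definable.preimage_map (fun _ => definableFun_lift _) (hXd k)
    · exact (Set.DefinableFun.ofPred_eq (definableFun_lift _) (definableFun_lift _)).compl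
  have hSm : (fun i => j (FreeGroup.of i)) ∈ S := by
    have hl : FreeGroup.lift (fun i => j (FreeGroup.of i)) = j :=
      FreeGroup.ext_hom _ _ fun i => by simp
    refine ⟨Set.mem_iInter.2 fun k => ?_, Set.mem_iInter.2 fun g hg => ?_⟩
    · change (fun _ => FreeGroup.lift (fun i => j (FreeGroup.of i)) (k : FreeGroup (Fin n))) ∈ X k
      rw [hl]
      exact hXm k
    · have hg' : FreeGroup.lift (fun i => j (FreeGroup.of i)) (g : FreeGroup (Fin n)) =
        FreeGroup.lift (fun i => j (FreeGroup.of i)) 1 := hg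
      rw [hl] at hg'
      exact g.2.2 (hj hg')
  have hSf : S.Finite := by
    obtain ⟨C, hC⟩ : ∃ C : ℕ, ∀ k : Kw, ∀ v ∈ X k, (e (v 0)).norm ≤ C := by
      obtain ⟨C, hC⟩ := ((Set.finite_iUnion hXf).image fun v => (e (v 0)).norm).bddAbove
      exact ⟨C, fun k v hv => hC ⟨v, Set.mem_iUnion.2 ⟨k, hv⟩, rfl⟩⟩
    obtain ⟨Λ, hΛ⟩ := hR C
    have hfin : {v : F | (e v).norm ≤ Λ}.Finite :=
      (FreeWord.finite_ball Λ).preimage e.injective.injOn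
    refine (Set.Finite.pi' fun _ : Fin n => hfin).subset fun x hx i => ?_
    have h1 := hΛ (e.toMonoidHom.comp (FreeGroup.lift x)) (fun k hk => by
        exact hC ⟨k, hk⟩ _ (Set.mem_iInter.1 hx.1 ⟨k, hk⟩)) (fun g hg h1 => by
        by_contra hne
        refine Set.mem_iInter.1 hx.2 ⟨g, hg, hne⟩ ?_
        change FreeGroup.lift x g = FreeGroup.lift x 1
        rw [map_one]
        exact (map_eq_one_iff e e.injective).1 h1) i
    simpa using h1
  refine mem_acl_iff.2 ⟨(fun x => x ∘ fun _ : Fin 1 => i) '' S, hSd.image_comp _, hSf.image _,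
    _, hSm, rfl⟩

end Logic

section FreeSplitting

variable {F α : Type*} [Group F] [DecidableEq α] (e : F ≃* FreeGroup α)

/-- Adjacency in the Cayley tree of a free group. -/
def CayleyAdj (x y : F) : Prop := ∃ s : α × Bool, e y = e x * FreeWord.letter s

/-- Adjacency in the union of the translates of a subset of the Cayley tree by a subgroup. -/
def TranslateAdj (D : FreeGroup α → Prop) (G : Subgroup F) (x y : F) : Prop :=
  CayleyAdj e x y ∧ ∃ g : G, D (e (g • x)) ∧ D (e (g • y))

variable {e}

omit [DecidableEq α] in
theorem CayleyAdj.symm {x y : F} (h : CayleyAdj e x y) : CayleyAdj e y x := by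
  obtain ⟨s, hs⟩ := h
  exact ⟨(s.1, !s.2), by rw [hs, ← FreeWord.letter_inv, mul_inv_cancel_right]⟩

omit [DecidableEq α] in
theorem CayleyAdj.smul {G : Subgroup F} (g : G) {x y : F} (h : CayleyAdj e x y) :
    CayleyAdj e (g • x) (g • y) := by
  obtain ⟨s, hs⟩ := h
  exact ⟨s, by rw [Subgroup.smul_def, Subgroup.smul_def, smul_eq_mul, smul_eq_mul, map_mul, map_mul,
    hs, mul_assoc]⟩

variable {D : FreeGroup α → Prop} {G : Subgroup F}

omit [DecidableEq α] in
theorem TranslateAdj.symm {x y : F} (h : TranslateAdj e D G x y) : TranslateAdj e D G y x :=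
  ⟨h.1.symm, h.2.imp fun _ => And.symm⟩

omit [DecidableEq α] in
theorem TranslateAdj.smul (g : G) {x y : F} (h : TranslateAdj e D G x y) :
    TranslateAdj e D G (g • x) (g • y) := by
  obtain ⟨h1, g', h2, h3⟩ := h
  refine ⟨h1.smul g, g' * g⁻¹, ?_⟩
  rw [smul_smul, smul_smul, inv_mul_cancel_right]
  exact ⟨h2, h3⟩

theorem rtg_translateAdj_of_mem (hD : FreeWord.PrefixClosed D) {x : F} (hx : D (e x)) :
    Relation.ReflTransGen (TranslateAdj e D G) 1 x := by
  induction hn : (e x).norm using Nat.strong_induction_on generalizing x with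
  | _ n ih =>
    by_cases h1 : e x = 1
    · rw [map_eq_one_iff e e.injective] at h1
      rw [h1]
    · obtain ⟨s, hs⟩ := FreeWord.exists_letter h1
      have h2 : e (e.symm (e x * FreeWord.letter s)) = e x * FreeWord.letter s := by simp
      have h3 : D (e x * FreeWord.letter s) := hD _ s hx hs
      refine (ih _ (by rw [← hn, h2]; omega) (by rwa [h2]) rfl).tail ?_
      refine TranslateAdj.symm ⟨⟨s, h2⟩, 1, ?_⟩
      rw [one_smul, one_smul, h2]
      exact ⟨hx, h3⟩

/-- An edge of the Cayley tree separating two points of a subgroup, and not in a family of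
invariant edges, gives a free splitting. -/
theorem exists_free_splitting (S : F → F → Prop) (hSE : ∀ x y, S x y → CayleyAdj e x y)
    (hSs : ∀ x y, S x y → S y x) (hSG : ∀ (g : G) x y, S x y → S (g • x) (g • y))
    {v v' : F} {s : α × Bool} (hs : e v = e v' * FreeWord.letter s)
    (hn : (e v' * FreeWord.letter s).norm + 1 = (e v').norm) (h1v : Relation.ReflTransGen S 1 v)
    (hvv : ¬ S v v') {g₀ : F} (hg₀ : g₀ ∈ G) (hp : FreeWord.Prefix (e v') (e g₀)) :
    ∃ P : Subgroup F, StepOver 1 P G ∧ P ≠ G ∧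
      ∀ g ∈ G, Relation.ReflTransGen S 1 g → g ∈ P := by
  let Φ : F → F → Prop := fun x y => x = v ∧ y = v'
  let H : F → Prop := fun x => FreeWord.Prefix (e v') (e x)
  have hadj : CayleyAdj e v v' := CayleyAdj.symm ⟨s, hs⟩
  have hHv : ¬ H v := by
    intro h
    have := h.norm_le
    rw [hs] at this
    omega
  have hHv' : H v' := FreeWord.Prefix.refl _
  have hne : v ≠ v' := by rintro rfl; exact hHv hHv'
  have hfix : ∀ g : G, g • v = v → g = 1 := by
    intro g hg
    rw [Subgroup.smul_def, smul_eq_mul] at hg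
    exact Subtype.ext (mul_eq_right.1 hg)
  have hcross : ∀ x y, CayleyAdj e x y → ¬ H x → H y → Φ x y := by
    rintro x y ⟨t, ht⟩ hx hy
    have hxt : e x = e y * FreeWord.letter (t.1, !t.2) := by
      rw [ht, ← FreeWord.letter_inv, mul_inv_cancel_right]
    rcases FreeWord.norm_mul_letter (e x) t with h | h
    · rw [← ht] at h
      have h' : (e y * FreeWord.letter (t.1, !t.2)).norm + 1 = (e y).norm := by
        rw [← hxt]; exact h.symm
      by_cases hyv : e v' = e y
      · obtain rfl := e.injective hyv
        refine ⟨e.injective ?_, rfl⟩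
        rw [hxt, hs, FreeWord.letter_unique h' hn]
      · refine absurd ?_ hx
        have := FreeWord.Prefix.drop_letter hy hyv h'
        rwa [← hxt] at this
    · refine absurd (FreeWord.Prefix.trans hy ?_) hx
      rw [ht]
      exact FreeWord.Prefix.mul_letter (FreeWord.Prefix.refl _) h
  have hE1 : ∀ x, Relation.ReflTransGen (CayleyAdj e) 1 x := by
    intro x
    have := rtg_translateAdj_of_mem (e := e) (G := G) (D := fun _ => True)
      (fun _ _ _ _ => trivial) (x := x) trivial
    exact rtg_lift id (fun _ _ h => h.1) this
  have hEs : ∀ x y, CayleyAdj e x y → CayleyAdj e y x := fun _ _ h => h.symm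
  have htf : ∀ g : F, g * g = 1 → g = 1 := fun g hg =>
    (map_eq_one_iff e e.injective).1 (FreeWord.mul_self_eq_one (by rw [← map_mul, hg, map_one]))
  obtain ⟨P, hP, hst⟩ := exists_stepOver_of_wall G.subtype G.subtype_injective (CayleyAdj e) Φ H
    v v' 1 hEs (fun g x y h => h.smul g) ⟨rfl, rfl⟩
    (by rintro x y ⟨rfl, rfl⟩; exact ⟨hadj, hHv, hHv'⟩) hcross
    (by
      rintro g x y ⟨rfl, rfl⟩ ⟨h1, -⟩ x' y' h2
      obtain rfl := hfix g h1
      rwa [one_smul, one_smul])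
    (by
      rintro g x y ⟨rfl, rfl⟩ ⟨h1, h2⟩
      have h3 : g * g = 1 := hfix _ (by rw [mul_smul, h2, h1])
      have h4 : g = 1 := Subtype.ext (htf g (congrArg Subtype.val h3))
      rw [h4, one_smul] at h1
      exact hne h1.symm)
    (fun g => (rtg_symm hEs (hE1 v)).trans (hE1 _))
    (by rintro x y ⟨rfl, rfl⟩; exact ⟨.refl, .refl⟩)
    (by
      intro g
      rw [Subgroup.zpowers_one_eq_bot, Subgroup.mem_bot]
      refine ⟨fun h => hfix g h.1, ?_⟩
      rintro rfl
      exact ⟨one_smul _ _, one_smul _ _⟩)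
  have hSU : ∀ x y, S x y → Uncrossed G (CayleyAdj e) Φ x y := by
    intro x y h
    refine ⟨hSE x y h, fun g => ⟨fun h' => hvv ?_, fun h' => hvv ?_⟩⟩
    · have := hSG g x y h
      rwa [h'.1, h'.2] at this
    · have := hSs _ _ (hSG g x y h)
      rwa [h'.1, h'.2] at this
  have hUs : ∀ x y, Uncrossed G (CayleyAdj e) Φ x y → Uncrossed G (CayleyAdj e) Φ y x :=
    fun x y h => ⟨h.1.symm, fun g => (h.2 g).symm⟩
  have hU : ∀ {x y}, Relation.ReflTransGen S x y →
      Relation.ReflTransGen (Uncrossed G (CayleyAdj e) Φ) x y :=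
    fun h => rtg_lift id hSU h
  have h1g : ∀ g : G, Relation.ReflTransGen S (g : F) (g • v) := by
    intro g
    have := rtg_lift (r' := S) (g • ·) (fun _ _ h => hSG g _ _ h) h1v
    simpa [Subgroup.smul_def] using this
  have hUH : ∀ {x y}, Relation.ReflTransGen (Uncrossed G (CayleyAdj e) Φ) x y → (H x ↔ H y) := by
    intro x y h
    induction h with
    | refl => rfl
    | tail _ h ih =>
      rw [ih]
      have h1 := h.2 1
      rw [one_smul, one_smul] at h1
      constructor
      · intro hy; by_contra hz; exact h1.2 (hcross _ _ h.1.symm hz hy)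
      · intro hy; by_contra hz; exact h1.1 (hcross _ _ h.1 hz hy)
  have hr : G.subtype.range = G := Subgroup.range_subtype G
  rw [hr] at hst
  refine ⟨P.map G.subtype, hst, fun hPG => ?_, fun g hg h => ?_⟩
  · have : g₀ ∈ P.map G.subtype := by rw [hPG]; exact hg₀
    obtain ⟨g, hgP, rfl⟩ := Subgroup.mem_map.1 this
    have h2 := ((hP g).1 hgP).trans (rtg_symm hUs (hU (h1g g)))
    exact hHv ((hUH h2).2 hp)
  · refine Subgroup.mem_map.2 ⟨⟨g, hg⟩, (hP _).2 ?_, rfl⟩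
    exact hU (((rtg_symm hSs h1v).trans h).trans (h1g ⟨g, hg⟩))

/-- A subgroup without free splittings relative to `C` is generated by its elements in a set that
depends on `C` only. -/
theorem eq_closure_of_no_free_splitting (hD : FreeWord.PrefixClosed D) (hD1 : D 1) {C : Set F}
    (hC : ∀ k ∈ C, D (e k)) (hCG : C ⊆ G)
    (hG : ∀ P : Subgroup F, StepOver 1 P G → C ⊆ P → P = G) :
    G = Subgroup.closure (G ∩ {x | ∃ d d', D (e d) ∧ D (e d') ∧ x = d * d'⁻¹}) := by
  have hconn : ∀ {g}, g ∈ G → ∀ x, FreeWord.Prefix (e x) (e g) →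
      Relation.ReflTransGen (TranslateAdj e D G) 1 x := by
    intro g hg x hx
    induction hn : (e x).norm using Nat.strong_induction_on generalizing x with
    | _ n ih =>
      by_cases h1 : e x = 1
      · rw [map_eq_one_iff e e.injective] at h1
        rw [h1]
      · obtain ⟨s, hs⟩ := FreeWord.exists_letter h1
        have h2 : e (e.symm (e x * FreeWord.letter s)) = e x * FreeWord.letter s := by simp
        have h3 := ih _ (by rw [← hn, h2]; omega) (e.symm (e x * FreeWord.letter s))
          (by rw [h2]; exact hx.mul_letter hs) rfl
        by_contra hcon
        obtain ⟨P, hst, hne, hP⟩ := exists_free_splitting (G := G) (TranslateAdj e D G)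
          (fun _ _ h => h.1) (fun _ _ h => h.symm) (fun g _ _ h => h.smul g) h2 hs h3
          (fun h => hcon (h3.tail h)) hg hx
        exact hne (hG P hst fun k hk => hP k (hCG hk)
          (rtg_translateAdj_of_mem hD (hC k hk)))
  set Y := {x : F | ∃ d d', D (e d) ∧ D (e d') ∧ x = d * d'⁻¹} with hY
  refine le_antisymm (fun g hg => ?_) ((Subgroup.closure_le G).2 Set.inter_subset_left)
  have key : ∀ x, Relation.ReflTransGen (TranslateAdj e D G) 1 x →
      ∃ h ∈ Subgroup.closure (G ∩ Y), ∃ d, D (e d) ∧ x = h * d := by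
    intro x hx
    induction hx with
    | refl => exact ⟨1, one_mem _, 1, by rwa [map_one], by simp⟩
    | @tail x y _ hs ih =>
      obtain ⟨h, hh, d, hd, rfl⟩ := ih
      obtain ⟨-, g', h1, h2⟩ := hs
      rw [Subgroup.smul_def, smul_eq_mul] at h1 h2
      have hle : Subgroup.closure (G ∩ Y) ≤ G := (Subgroup.closure_le G).2 Set.inter_subset_left
      have hmem : d * (g' * (h * d))⁻¹ ∈ (G : Set F) ∩ Y := by
        refine ⟨?_, d, _, hd, h1, rfl⟩
        have : d * ((g' : F) * (h * d))⁻¹ = h⁻¹ * (g' : F)⁻¹ := by group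
        rw [this]
        exact mul_mem (inv_mem (hle hh)) (inv_mem g'.2)
      exact ⟨h * (d * (g' * (h * d))⁻¹), mul_mem hh (Subgroup.subset_closure hmem), _, h2,
        by group⟩
  obtain ⟨h, hh, d, hd, rfl⟩ := key g (hconn hg g (FreeWord.Prefix.refl _))
  have hle : Subgroup.closure (G ∩ Y) ≤ G := (Subgroup.closure_le G).2 Set.inter_subset_left
  refine mul_mem hh (Subgroup.subset_closure ⟨?_, d, 1, hd, by rwa [map_one], by simp⟩)
  exact (Subgroup.mul_mem_cancel_left G (hle hh)).1 hg

/-- There are finitely many subgroups without free splittings relative to a finite set. -/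
theorem finite_no_free_splitting [Finite α] (e : F ≃* FreeGroup α) {C : Set F} (hC : C.Finite) :
    {G : Subgroup F | C ⊆ G ∧
      ∀ P : Subgroup F, StepOver 1 P G → C ⊆ P → P = G}.Finite := by
  classical
  obtain ⟨r, hr⟩ := (hC.image fun k => (e k).norm).bddAbove
  let D : FreeGroup α → Prop := fun g => g.norm ≤ r
  have hDf : {x : F | D (e x)}.Finite :=
    (FreeWord.finite_ball r).preimage e.injective.injOn
  have hYf : {x : F | ∃ d d', D (e d) ∧ D (e d') ∧ x = d * d'⁻¹}.Finite := by
    refine ((hDf.prod hDf).image fun p => p.1 * p.2⁻¹).subset ?_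
    rintro x ⟨d, d', h1, h2, rfl⟩
    exact ⟨(d, d'), ⟨h1, h2⟩, rfl⟩
  refine (hYf.finite_subsets.image Subgroup.closure).subset ?_
  rintro G ⟨h1, h2⟩
  refine ⟨_, Set.inter_subset_right, (eq_closure_of_no_free_splitting (e := e) (D := D)
    (fun p s hp hs => ?_) ?_ (fun k hk => hr ⟨k, hk, rfl⟩) h1 h2).symm⟩
  · change p.norm ≤ r at hp
    change _ ≤ r
    omega
  · change FreeGroup.norm 1 ≤ r
    simp

end FreeSplitting

section Assembly

variable {F : Type*} [Group F]

theorem StepOver.le {c : F} {P G : Subgroup F} (h : StepOver c P G) : P ≤ G := by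
  rcases h with ⟨B, hP, hB, h1, h2, h3⟩ | ⟨C, D, φ, c', d, hC, hD, -, -, h⟩
  · exact h2
  · exact isHNNOf_le h

/-- The whole group is obtained from `G` by splittings over cyclic subgroups. -/
def Reaches (G : Subgroup F) : Prop :=
  Relation.ReflTransGen (fun P G : Subgroup F => ∃ c, StepOver c P G) G ⊤

theorem Reaches.constructibleFrom {G : Subgroup F} (h : Reaches G) : ConstructibleFrom G ⊤ :=
  rtg_lift id (fun _ _ ⟨_, h⟩ => h.constructStep) h

theorem StepOver.card_le [IsFreeGroup F] {c : F} {P G : Subgroup F} (h : StepOver c P G)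
    [Finite (G →* Z2)] : Finite (P →* Z2) ∧ Nat.card (P →* Z2) ≤ Nat.card (G →* Z2) ∧
      (c = 1 → P ≠ G → Nat.card (P →* Z2) < Nat.card (G →* Z2)) := by
  obtain ⟨f, hf, hs⟩ := h.exists_injection
  refine ⟨Finite.of_injective f hf, Nat.card_le_card_of_injective f hf, fun h1 h2 => ?_⟩
  refine lt_of_le_of_ne (Nat.card_le_card_of_injective f hf) fun heq => hs h1 h2 ?_
  have := Finite.of_injective f hf
  exact ((Nat.bijective_iff_injective_and_card f).2 ⟨hf, heq⟩).2

theorem Reaches.card_le [IsFreeGroup F] [Finite ((⊤ : Subgroup F) →* Z2)] {G : Subgroup F}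
    (h : Reaches G) :
    Finite (G →* Z2) ∧ Nat.card (G →* Z2) ≤ Nat.card ((⊤ : Subgroup F) →* Z2) := by
  induction h using Relation.ReflTransGen.head_induction_on with
  | refl => exact ⟨inferInstance, le_rfl⟩
  | head h _ ih =>
    obtain ⟨c, h⟩ := h
    obtain ⟨h1, h2⟩ := ih
    obtain ⟨h3, h4, -⟩ := h.card_le
    exact ⟨h3, h4.trans h2⟩

theorem Reaches.exists_no_free_splitting [IsFreeGroup F] [Finite ((⊤ : Subgroup F) →* Z2)]
    (C : Set F) {G : Subgroup F} (hG : Reaches G) (hC : C ⊆ G) :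
    ∃ G' : Subgroup F, Reaches G' ∧ G' ≤ G ∧ C ⊆ G' ∧
      ∀ P : Subgroup F, StepOver 1 P G' → C ⊆ P → P = G' := by
  induction hn : Nat.card (G →* Z2) using Nat.strong_induction_on generalizing G with
  | _ n ih =>
    by_cases h : ∀ P : Subgroup F, StepOver 1 P G → C ⊆ P → P = G
    · exact ⟨G, hG, le_rfl, hC, h⟩
    · push Not at h
      obtain ⟨P, hP, hCP, hne⟩ := h
      have := hG.card_le.1
      have hPr : Reaches P := Relation.ReflTransGen.head ⟨1, hP⟩ hG
      obtain ⟨G', h1, h2, h3, h4⟩ :=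
        ih _ (hn ▸ hP.card_le.2.2 rfl hne) hPr hCP rfl
      exact ⟨G', h1, h2.trans hP.le, h3, h4⟩

theorem exists_reaches_rigid [IsFreeGroup F] {N : ℕ} (e : F ≃* FreeGroup (Fin N))
    [Finite ((⊤ : Subgroup F) →* Z2)] {C : Set F} (hC : C.Finite) :
    ∃ G : Subgroup F, Reaches G ∧ C ⊆ G ∧
      ∀ (c : F) (P : Subgroup F), StepOver c P G → C ⊆ P → P = G := by
  have hfin := (finite_no_free_splitting e hC).subset
    (t := {G : Subgroup F | C ⊆ G ∧ (∀ P : Subgroup F, StepOver 1 P G → C ⊆ P → P = G) ∧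
      Reaches G}) (fun G h => ⟨h.1, h.2.1⟩)
  obtain ⟨G₀, h1, -, h3, h4⟩ := Reaches.exists_no_free_splitting C (G := (⊤ : Subgroup F)) .refl
    (fun _ _ => trivial)
  obtain ⟨G, hG⟩ := hfin.exists_minimal ⟨G₀, h3, h4, h1⟩
  refine ⟨G, hG.prop.2.2, hG.prop.1, fun c P hP hCP => ?_⟩
  have hPr : Reaches P := Relation.ReflTransGen.head ⟨c, hP⟩ hG.prop.2.2
  obtain ⟨G', h1, h2, h3, h4⟩ := hPr.exists_no_free_splitting C hCP
  exact le_antisymm hP.le ((hG.le_of_le ⟨h3, h4, h1⟩ (h2.trans hP.le)).trans h2)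

theorem exists_reaches_le_closure_acl [IsFreeGroup F] {N : ℕ} (e : F ≃* FreeGroup (Fin N))
    [Finite ((⊤ : Subgroup F) →* Z2)] {A C : Set F} (hC : C.Finite) (hCA : C ⊆ acl A) :
    ∃ G : Subgroup F, Reaches G ∧ C ⊆ G ∧ G ≤ Subgroup.closure (acl A) := by
  obtain ⟨G, hG, hCG, hrig⟩ := exists_reaches_rigid e hC
  refine ⟨G, hG, hCG, ?_⟩
  have := hG.card_le.1
  obtain ⟨n, ⟨i⟩⟩ := exists_freeGroup_equiv_of_finite_hom (B := G)
  let j : FreeGroup (Fin n) →* F := G.subtype.comp i.toMonoidHom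
  have hj : Function.Injective j := G.subtype_injective.comp i.injective
  have hjr : j.range = G := by
    ext x
    constructor
    · rintro ⟨y, rfl⟩
      exact (i y).2
    · intro hx
      exact ⟨i.symm ⟨x, hx⟩, by simp [j]⟩
  have hacl := mem_acl_of_rigid (A := A) e j hj (Kw := j ⁻¹' C) (hC.preimage hj.injOn)
    (fun k hk => hCA hk) (fun c P hP hk => by
      rw [hjr] at hP
      have h := hrig _ _ hP fun k hkC => by
        have : k ∈ j.range := by rw [hjr]; exact hCG hkC
        obtain ⟨k, rfl⟩ := this
        exact Subgroup.mem_map_of_mem j (hk k hkC)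
      refine eq_top_iff.2 fun x _ => ?_
      have hx : j x ∈ P.map j := by
        rw [h]
        exact (i x).2
      obtain ⟨y, hy, hxy⟩ := Subgroup.mem_map.1 hx
      rwa [← hj hxy])
  rw [← hjr]
  rintro _ ⟨y, rfl⟩
  induction y using FreeGroup.induction_on with
  | C1 => rw [map_one]; exact one_mem _
  | of k => exact Subgroup.subset_closure (hacl k)
  | inv_of k h => rw [map_inv]; exact inv_mem h
  | mul x y hx hy => rw [map_mul]; exact mul_mem hx hy

theorem exists_finite_subset_mem_closure {S : Set F} {k : F} (hk : k ∈ Subgroup.closure S) :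
    ∃ C ⊆ S, C.Finite ∧ k ∈ Subgroup.closure C := by
  induction hk using Subgroup.closure_induction with
  | mem x hx =>
    exact ⟨{x}, Set.singleton_subset_iff.2 hx, Set.finite_singleton x,
      Subgroup.subset_closure rfl⟩
  | one => exact ⟨∅, Set.empty_subset _, Set.finite_empty, one_mem _⟩
  | mul x y _ _ hx hy =>
    obtain ⟨C, h1, h2, h3⟩ := hx
    obtain ⟨C', h1', h2', h3'⟩ := hy
    exact ⟨C ∪ C', Set.union_subset h1 h1', h2.union h2', mul_mem
      (Subgroup.closure_mono Set.subset_union_left h3)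
      (Subgroup.closure_mono Set.subset_union_right h3')⟩
  | inv x _ hx =>
    obtain ⟨C, h1, h2, h3⟩ := hx
    exact ⟨C, h1, h2, inv_mem h3⟩

theorem exists_finite_subset_closure_eq {S : Set F} (h : (Subgroup.closure S).FG) :
    ∃ C ⊆ S, C.Finite ∧ Subgroup.closure C = Subgroup.closure S := by
  obtain ⟨B, hB⟩ := h
  have hk : ∀ k : B, ∃ C ⊆ S, C.Finite ∧ (k : F) ∈ Subgroup.closure C := fun k =>
    exists_finite_subset_mem_closure (hB ▸ Subgroup.subset_closure k.2)
  choose C h1 h2 h3 using hk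
  refine ⟨⋃ k, C k, Set.iUnion_subset h1, Set.finite_iUnion h2,
    le_antisymm (Subgroup.closure_mono (Set.iUnion_subset h1)) ?_⟩
  rw [← hB, Subgroup.closure_le]
  exact fun k hk => Subgroup.closure_mono (Set.subset_iUnion C ⟨k, hk⟩) (h3 ⟨k, hk⟩)

theorem finite_hom_closure_acl [IsFreeGroup F] {N : ℕ} (e : F ≃* FreeGroup (Fin N))
    [Finite ((⊤ : Subgroup F) →* Z2)] (A : Set F) :
    Finite (Subgroup.closure (acl A) →* Z2) := by
  by_contra hinf
  rw [not_finite_iff_infinite] at hinf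
  set m := Nat.card ((⊤ : Subgroup F) →* Z2) with hm
  let χ : Fin (m + 1) → (Subgroup.closure (acl A) →* Z2) := fun i => Infinite.natEmbedding _ i
  have hχ : Function.Injective χ := fun i i' h =>
    Fin.ext ((Infinite.natEmbedding _).injective h)
  have hsep : ∀ p : Fin (m + 1) × Fin (m + 1), ∃ k : acl A, p.1 ≠ p.2 →
      χ p.1 ⟨k, Subgroup.subset_closure k.2⟩ ≠ χ p.2 ⟨k, Subgroup.subset_closure k.2⟩ := by
    intro p
    by_contra! hcon
    have h1 : (1 : F) ∈ acl A := mem_acl_iff.2 ⟨{v | FreeGroup.lift v 1 = v 0},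
      (definableFun_lift 1).ofPred_eq (.proj _), (Set.finite_singleton (fun _ => (1 : F))).subset
        (fun v hv => funext fun i => by
          have hv' : FreeGroup.lift v 1 = v 0 := hv
          rw [Subsingleton.elim i 0, ← hv', map_one]), map_one _⟩
    refine (hcon ⟨1, h1⟩).1 (hχ ?_)
    refine MonoidHom.ext fun x => ?_
    obtain ⟨x, hx⟩ := x
    induction hx using Subgroup.closure_induction with
    | mem x hx => exact (hcon ⟨x, hx⟩).2
    | one => exact (map_one (χ p.1)).trans (map_one (χ p.2)).symm
    | mul x y hx hy h h' =>
      have h2 := congrArg₂ (· * ·) h h'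
      simp only [← map_mul] at h2
      exact h2
    | inv x hx h =>
      have h2 := congrArg (·⁻¹) h
      simp only [← map_inv] at h2
      exact h2
  choose k hk using hsep
  obtain ⟨G, hG, hCG, hGA⟩ := exists_reaches_le_closure_acl e (A := A)
    (C := Set.range fun p => (k p : F)) (Set.finite_range _) (by
      rintro _ ⟨p, rfl⟩
      exact (k p).2)
  obtain ⟨hfin, hle⟩ := hG.card_le
  have hinj : Function.Injective fun i => (χ i).comp (Subgroup.inclusion hGA) := by
    intro i i' h
    by_contra hne
    exact hk (i, i') hne (DFunLike.congr_fun h ⟨k (i, i'), hCG ⟨(i, i'), rfl⟩⟩)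
  have := Nat.card_le_card_of_injective _ hinj
  rw [Nat.card_fin] at this
  omega

end Assembly

end AclConstruct

/-- Let `F` be a free group of finite rank and `A` a nonabelian
subgroup. Then `F` is constructible from `acl(A)` by a finite sequence of amalgamated
free products and HNN-extensions along cyclic subgroups; in particular `acl(A)` is
finitely generated. -/
theorem constructible_from_acl {F : Type*} [Group F] (hF : IsFreeOfFiniteRank F)
    (A : Subgroup F) (hA : Nonabelian (A : Set F)) :
    ConstructibleFrom (Subgroup.closure (acl (A : Set F))) (⊤ : Subgroup F) ∧
    (Subgroup.closure (acl (A : Set F))).FG := by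
  obtain ⟨N, ⟨e⟩⟩ := hF
  have : IsFreeGroup F := IsFreeGroup.ofMulEquiv e.symm
  have : Finite ((⊤ : Subgroup F) →* AclConstruct.Z2) := by
    have : Finite (Fin N → AclConstruct.Z2) := Pi.finite
    refine Finite.of_injective (β := Fin N → AclConstruct.Z2)
      (fun χ i => χ ⟨e.symm (FreeGroup.of i), trivial⟩) fun χ χ' h => ?_
    have h1 : (χ.comp (Subgroup.topEquiv.symm.toMonoidHom.comp e.symm.toMonoidHom)) =
        χ'.comp (Subgroup.topEquiv.symm.toMonoidHom.comp e.symm.toMonoidHom) :=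
      FreeGroup.ext_hom _ _ fun i => congrFun h i
    refine MonoidHom.ext fun x => ?_
    have h2 := DFunLike.congr_fun h1 (e x)
    simpa using! h2
  have hfin := AclConstruct.finite_hom_closure_acl e (A : Set F)
  obtain ⟨n, ⟨i⟩⟩ :=
    AclConstruct.exists_freeGroup_equiv_of_finite_hom (B := Subgroup.closure (acl (A : Set F)))
  have hfg : (Subgroup.closure (acl (A : Set F))).FG := by
    rw [← Group.fg_iff_subgroup_fg]
    exact Group.fg_of_surjective (f := i.toMonoidHom) i.surjective
  obtain ⟨C, hCA, hCf, hC⟩ := AclConstruct.exists_finite_subset_closure_eq hfg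
  obtain ⟨G, hG, hCG, hGA⟩ := AclConstruct.exists_reaches_le_closure_acl e hCf hCA
  have : G = Subgroup.closure (acl (A : Set F)) :=
    le_antisymm hGA (hC ▸ (Subgroup.closure_le G).2 hCG)
  exact ⟨this ▸ hG.constructibleFrom, hfg⟩
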